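/- Let a, b be Borel coefficients on [0,T]×SP×ℝ^d as in the context. For every weakly continuous solution (Γ_t)_{t∈[0,T]} to (SP-CE) there exists a probability measure η on C([0,T],SP) (with the σ-algebra generated by the projections e_t) which is concentrated on subprobability solutions to (NLFPK) — i.e. there is a measurable set S ⊆ C([0,T],SP) with η(S) = 1 all of whose elements are subprobability solutions to (NLFPK) — such that η ∘ e_t⁻¹ = Γ_t for every t ∈ [0,T]. Moreover, if Γ₀ is concentrated on P (the probability measures on ℝ^d), then η is concentrated on weakly continuous probability solutions to (NLFPK). -/

import Mathlib

open MeasureTheory Topology Filter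

noncomputable section

/-- Euclidean space `ℝ^d`. -/
abbrev Rd (d : ℕ) := Fin d → ℝ

/-- The space of subprobability measures on `ℝ^d`. -/
def SP (d : ℕ) : Type := {μ : Measure (Rd d) // μ Set.univ ≤ 1}

/-- The vague topology on `SP d`: the initial topology of the maps `μ ↦ ∫ g dμ` for
`g : ℝ^d → ℝ` continuous with compact support. -/
instance (d : ℕ) : TopologicalSpace (SP d) :=
  ⨅ g : {g : Rd d → ℝ // Continuous g ∧ HasCompactSupport g},
    TopologicalSpace.induced (fun μ : SP d => ∫ x, g.1 x ∂μ.1) inferInstance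

instance (d : ℕ) : MeasurableSpace (SP d) := borel (SP d)
instance (d : ℕ) : BorelSpace (SP d) := ⟨rfl⟩

/-- First-order partial derivative `∂_i f`. -/
def pd {n : ℕ} (f : (Fin n → ℝ) → ℝ) (i : Fin n) (x : Fin n → ℝ) : ℝ :=
  fderiv ℝ f x (Pi.single i 1)

/-- Second-order partial derivative `∂²_{ij} f`. -/
def pd2 {n : ℕ} (f : (Fin n → ℝ) → ℝ) (i j : Fin n) (x : Fin n → ℝ) : ℝ :=
  fderiv ℝ (fun y => pd f j y) x (Pi.single i 1)

/-- Twice continuously differentiable with compact support. -/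
def IsC2c {n : ℕ} (φ : (Fin n → ℝ) → ℝ) : Prop :=
  ContDiff ℝ 2 φ ∧ HasCompactSupport φ

/-- Twice continuously differentiable, bounded, with bounded first and second order
partial derivatives. -/
def IsC2b {n : ℕ} (f : (Fin n → ℝ) → ℝ) : Prop :=
  ContDiff ℝ 2 f ∧ ∃ M : ℝ, ∀ x, |f x| ≤ M ∧ (∀ i, |pd f i x| ≤ M) ∧ ∀ i j, |pd2 f i j x| ≤ M

/-- Borel coefficients, with `a` symmetric and positive semidefinite (`S⁺_d`-valued). -/
def GoodCoeffs (d : ℕ) (a : ℝ → SP d → Rd d → Fin d → Fin d → ℝ)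
    (b : ℝ → SP d → Rd d → Fin d → ℝ) : Prop :=
  (∀ i j, Measurable fun p : ℝ × SP d × Rd d => a p.1 p.2.1 p.2.2 i j) ∧
  (∀ i, Measurable fun p : ℝ × SP d × Rd d => b p.1 p.2.1 p.2.2 i) ∧
  (∀ t μ x i j, a t μ x i j = a t μ x j i) ∧
  (∀ t μ x (v : Fin d → ℝ), 0 ≤ ∑ i, ∑ j, v i * a t μ x i j * v j)

/-- The Kolmogorov operator `L_{t,μ}φ = ∑ a_ij ∂²_ij φ + ∑ b_i ∂_i φ`. -/
def Lop {d : ℕ} (a : ℝ → SP d → Rd d → Fin d → Fin d → ℝ)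
    (b : ℝ → SP d → Rd d → Fin d → ℝ) (t : ℝ) (μ : SP d) (φ : Rd d → ℝ) (x : Rd d) : ℝ :=
  (∑ i, ∑ j, a t μ x i j * pd2 φ i j x) + ∑ i, b t μ x i * pd φ i x

/-- Global integrability condition for (NLFPK). -/
def NLFPKIntegrable (d : ℕ) (T : ℝ) (a : ℝ → SP d → Rd d → Fin d → Fin d → ℝ)
    (b : ℝ → SP d → Rd d → Fin d → ℝ) (μ : ℝ → SP d) : Prop :=
  ∀ i j, ∫⁻ t in Set.Ioc (0:ℝ) T,
      ∫⁻ x, ENNReal.ofReal (|a t (μ t) x i j| + |b t (μ t) x i|) ∂(μ t).1 < ⊤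

/-- The weak form of the nonlinear FPK equation, tested against `φ` at time `t`. -/
def NLFPKEq (d : ℕ) (a : ℝ → SP d → Rd d → Fin d → Fin d → ℝ)
    (b : ℝ → SP d → Rd d → Fin d → ℝ) (μ : ℝ → SP d) (φ : Rd d → ℝ) (t : ℝ) : Prop :=
  ∫ x, φ x ∂(μ t).1 - ∫ x, φ x ∂(μ 0).1 = ∫ s in (0:ℝ)..t, ∫ x, Lop a b s (μ s) φ x ∂(μ s).1

/-- Subprobability solution to (NLFPK): a vaguely continuous, globally integrable curve
in `SP` satisfying the weak equation for all test functions in `C²_c(ℝ^d)`. -/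
def IsSubprobSolution (d : ℕ) (T : ℝ) (a : ℝ → SP d → Rd d → Fin d → Fin d → ℝ)
    (b : ℝ → SP d → Rd d → Fin d → ℝ) (μ : ℝ → SP d) : Prop :=
  ContinuousOn μ (Set.Icc 0 T) ∧ NLFPKIntegrable d T a b μ ∧
  ∀ φ : Rd d → ℝ, IsC2c φ → ∀ t ∈ Set.Icc (0:ℝ) T, NLFPKEq d a b μ φ t

/-- Weak continuity (in duality with bounded continuous functions) of a curve in `SP`. -/
def WeaklyContinuousOn {d : ℕ} (μ : ℝ → SP d) (s : Set ℝ) : Prop :=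
  ∀ f : Rd d → ℝ, Continuous f → (∃ M, ∀ x, |f x| ≤ M) →
    ContinuousOn (fun t => ∫ x, f x ∂(μ t).1) s

/-- Probability solution to (NLFPK): a weakly continuous solution consisting of
probability measures. -/
def IsProbSolution (d : ℕ) (T : ℝ) (a : ℝ → SP d → Rd d → Fin d → Fin d → ℝ)
    (b : ℝ → SP d → Rd d → Fin d → ℝ) (μ : ℝ → SP d) : Prop :=
  IsSubprobSolution d T a b μ ∧ (∀ t ∈ Set.Icc (0:ℝ) T, (μ t).1 Set.univ = 1) ∧
  WeaklyContinuousOn μ (Set.Icc 0 T)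

/-- `φ` and `ψ` are uniformly `ε`-close, together with their first and second order
partial derivatives (closeness in the `C²_b` norm). -/
def C2Close {n : ℕ} (φ ψ : (Fin n → ℝ) → ℝ) (ε : ℝ) : Prop :=
  (∀ x, |φ x - ψ x| ≤ ε) ∧ (∀ i x, |pd φ i x - pd ψ i x| ≤ ε) ∧
  ∀ i j x, |pd2 φ i j x - pd2 ψ i j x| ≤ ε

/-- A countable family `g i ∈ C²_c(ℝ^d) \ {0}` which is dense in `C²_c(ℝ^d)` with respect
to the `C²_b` norm. -/
def GFamily (d : ℕ) (g : ℕ → Rd d → ℝ) : Prop :=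
  (∀ i, IsC2c (g i)) ∧ (∀ i, g i ≠ 0) ∧
  ∀ φ : Rd d → ℝ, IsC2c φ → ∀ ε : ℝ, 0 < ε → ∃ i, C2Close (g i) φ ε

/-- The global chart `G : SP → ℝ^∞`, `G(μ) = (μ(g_i))_i`. -/
def Gmap {d : ℕ} (g : ℕ → Rd d → ℝ) (μ : SP d) : ℕ → ℝ := fun i => ∫ x, g i x ∂μ.1

/-- `F(μ) = f(μ(g_1),…,μ(g_n))`, a typical element of `FC²_b(G)`. -/
def Fof {d : ℕ} (g : ℕ → Rd d → ℝ) {n : ℕ} (f : (Fin n → ℝ) → ℝ) (μ : SP d) : ℝ :=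
  f fun k : Fin n => ∫ x, g k x ∂μ.1

/-- The action `𝐋_t F(μ) = ⟨∇^{SP} F(μ), b(t,μ) + a(t,μ)∇⟩_{L²(μ)}` of the linearized
operator on `F(μ) = f(μ(g_1),…,μ(g_n)) ∈ FC²_b(G)`. -/
def bL {d : ℕ} (a : ℝ → SP d → Rd d → Fin d → Fin d → ℝ)
    (b : ℝ → SP d → Rd d → Fin d → ℝ) (g : ℕ → Rd d → ℝ) {n : ℕ}
    (f : (Fin n → ℝ) → ℝ) (t : ℝ) (μ : SP d) : ℝ :=
  ∑ k : Fin n, pd f k (fun l : Fin n => ∫ x, g l x ∂μ.1) * ∫ x, Lop a b t μ (g k) x ∂μ.1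

/-- Weak continuity of a curve of Borel measures on `SP`. -/
def WeaklyContinuousMeasOn {d : ℕ} (Γ : ℝ → Measure (SP d)) (s : Set ℝ) : Prop :=
  ∀ F : SP d → ℝ, Continuous F → (∃ M, ∀ μ, |F μ| ≤ M) →
    ContinuousOn (fun t => ∫ μ, F μ ∂(Γ t)) s

/-- Weakly continuous solution to the linearized continuity equation (SP-CE) on `P(SP)`. -/
def IsSPCESolution (d : ℕ) (T : ℝ) (a : ℝ → SP d → Rd d → Fin d → Fin d → ℝ)
    (b : ℝ → SP d → Rd d → Fin d → ℝ) (g : ℕ → Rd d → ℝ)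
    (Γ : ℝ → Measure (SP d)) : Prop :=
  (∀ t ∈ Set.Icc (0:ℝ) T, IsProbabilityMeasure (Γ t)) ∧
  WeaklyContinuousMeasOn Γ (Set.Icc 0 T) ∧
  (∫⁻ t in Set.Ioc (0:ℝ) T, ∫⁻ μ : SP d,
      (∫⁻ x, ENNReal.ofReal ((∑ i, |b t μ x i|) + ∑ i, ∑ j, |a t μ x i j|) ∂μ.1) ∂(Γ t) < ⊤) ∧
  ∀ (n : ℕ) (f : (Fin n → ℝ) → ℝ), IsC2b f → ∀ t ∈ Set.Icc (0:ℝ) T,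
    ∫ μ, Fof g f μ ∂(Γ t) - ∫ μ, Fof g f μ ∂(Γ 0) =
      ∫ s in (0:ℝ)..t, ∫ μ, bL a b g f s μ ∂(Γ s)

/-- Vaguely continuous paths `[0,T] → SP`. -/
def PathSP (d : ℕ) (T : ℝ) := {γ : Set.Icc (0:ℝ) T → SP d // Continuous γ}

/-- The σ-algebra on path space generated by the point evaluations `e_t`. -/
instance (d : ℕ) (T : ℝ) : MeasurableSpace (PathSP d T) :=
  ⨆ t : Set.Icc (0:ℝ) T, MeasurableSpace.comap (fun γ : PathSP d T => γ.1 t) inferInstance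

/-- Extension of a path on `[0,T]` to all of `ℝ` (by the zero measure outside `[0,T]`). -/
def extendPath {d : ℕ} {T : ℝ} (γ : Set.Icc (0:ℝ) T → SP d) : ℝ → SP d :=
  fun t => if h : t ∈ Set.Icc (0:ℝ) T then γ ⟨t, h⟩ else ⟨0, by simp⟩

/-- On a compact metrizable space, every positive linear functional on `C(X, ℝ)` is the integral
against a finite measure. -/
theorem exists_measure_of_positive_functional {X : Type*} [TopologicalSpace X] [T2Space X]
    [CompactSpace X] [MeasurableSpace X] [BorelSpace X] (L : C(X, ℝ) →ₗ[ℝ] ℝ)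
    (hL : ∀ f : C(X, ℝ), (∀ x, 0 ≤ f x) → 0 ≤ L f) :
    ∃ π : Measure X, IsFiniteMeasure π ∧ ∀ f : C(X, ℝ), ∫ x, f x ∂π = L f := by
  let Λ₀ : CompactlySupportedContinuousMap X ℝ →ₗ[ℝ] ℝ :=
    { toFun := fun f => L f.1
      map_add' := fun f g => L.map_add f.1 g.1
      map_smul' := fun c f => L.map_smul c f.1 }
  let Λ : CompactlySupportedContinuousMap X ℝ →ₚ[ℝ] ℝ :=
    PositiveLinearMap.mk₀ Λ₀ (fun f hf => hL f.1 (fun x => hf x))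
  refine ⟨RealRMK.rieszMeasure Λ, inferInstance, fun f => ?_⟩
  exact RealRMK.integral_rieszMeasure Λ ⟨f, HasCompactSupport.of_compactSpace _⟩

theorem ContinuousMap.integrable_of_compactSpace {X : Type*} [TopologicalSpace X] [CompactSpace X]
    [MeasurableSpace X] [OpensMeasurableSpace X] (P : Measure X) [IsFiniteMeasure P] (f : C(X, ℝ)) :
    Integrable f P :=
  (BoundedContinuousFunction.mkOfCompact f).integrable P

theorem measure_ext_of_integral_continuousMap {X : Type*} [TopologicalSpace X] [CompactSpace X]
    [MeasurableSpace X] [BorelSpace X] [HasOuterApproxClosed X] {P Q : Measure X}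
    [IsFiniteMeasure P] [IsFiniteMeasure Q]
    (h : ∀ f : C(X, ℝ), ∫ x, f x ∂P = ∫ x, f x ∂Q) : P = Q :=
  ext_of_forall_integral_eq_of_IsFiniteMeasure fun f => h f.toContinuousMap

/-- Kantorovich duality, in the form of existence of a coupling with small cost. -/
theorem exists_coupling_of_dual_bound {K : Type*} [TopologicalSpace K] [CompactSpace K]
    [PolishSpace K] [MeasurableSpace K] [BorelSpace K] (P Q : Measure K)
    [IsProbabilityMeasure P] [IsProbabilityMeasure Q] (cost : C(K × K, ℝ)) (ε : ℝ)
    (H : ∀ φ ψ : C(K, ℝ), (∀ x y, ψ y ≤ φ x + cost (x, y)) → ∫ y, ψ y ∂Q ≤ ∫ x, φ x ∂P + ε) :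
    ∃ π : Measure (K × K), IsProbabilityMeasure π ∧ π.map Prod.fst = P ∧ π.map Prod.snd = Q ∧
      ∫ z, cost z ∂π ≤ ε := by
  let := TopologicalSpace.metrizableSpaceMetric K
  let p1 : C(K × K, K) := ⟨Prod.fst, continuous_fst⟩
  let p2 : C(K × K, K) := ⟨Prod.snd, continuous_snd⟩
  let Φ : (C(K, ℝ) × C(K, ℝ) × ℝ) →ₗ[ℝ] (C(K × K, ℝ) × ℝ) :=
    { toFun := fun u => (u.1.comp p1 + u.2.1.comp p2, u.2.2)
      map_add' := fun u v => by
        ext <;> simp; ring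
      map_smul' := fun c u => by
        ext <;> simp }
  have hint : ∀ f : C(K × K, ℝ), Integrable f (P.prod Q) := fun f =>
    f.integrable_of_compactSpace _
  let F : (C(K × K, ℝ) × ℝ) →ₗ[ℝ] ℝ :=
    { toFun := fun u => ∫ z, u.1 z ∂(P.prod Q) + u.2 * ε
      map_add' := fun u v => by
        have := integral_add (hint u.1) (hint v.1)
        simp only [Prod.fst_add, Prod.snd_add, ContinuousMap.add_apply, this]; ring
      map_smul' := fun c u => by
        simp only [Prod.smul_fst, Prod.smul_snd, ContinuousMap.smul_apply, smul_eq_mul,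
          integral_const_mul, RingHom.id_apply]; ring }
  have hFΦ : ∀ u, F (Φ u) = ∫ x, u.1 x ∂P + ∫ y, u.2.1 y ∂Q + u.2.2 * ε := by
    intro u
    have h1 := hint (u.1.comp p1)
    have h2 := hint (u.2.1.comp p2)
    have := integral_add h1 h2
    have e1 : ∫ z, (u.1.comp p1) z ∂(P.prod Q) = ∫ x, u.1 x ∂P := by
      have := integral_fun_fst (μ := P) (ν := Q) (fun x => u.1 x)
      simpa [p1] using this
    have e2 : ∫ z, (u.2.1.comp p2) z ∂(P.prod Q) = ∫ x, u.2.1 x ∂Q := by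
      have := integral_fun_snd (μ := P) (ν := Q) (fun x => u.2.1 x)
      simpa [p2] using this
    rw [e1, e2] at this
    simp only [F, Φ, LinearMap.coe_mk, AddHom.coe_mk, ContinuousMap.add_apply, this]
  let s : PointedCone ℝ (C(K × K, ℝ) × ℝ) :=
    { carrier := {u | 0 ≤ u.2 ∧ ∀ z, 0 ≤ u.1 z + u.2 * cost z}
      add_mem' := fun {u v} hu hv => ⟨add_nonneg hu.1 hv.1, fun z => by
        have := add_nonneg (hu.2 z) (hv.2 z)
        simp only [Prod.fst_add, Prod.snd_add, ContinuousMap.add_apply]; linarith⟩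
      zero_mem' := ⟨le_rfl, fun z => by simp⟩
      smul_mem' := fun c u hu => ⟨mul_nonneg c.2 hu.1, fun z => by
        have := mul_nonneg c.2 (hu.2 z)
        change 0 ≤ (c : ℝ) * u.1 z + (c : ℝ) * u.2 * cost z
        linarith⟩ }
  have nonneg : ∀ x : (F.toPMap (LinearMap.range Φ)).domain,
      (x : C(K × K, ℝ) × ℝ) ∈ s → 0 ≤ (F.toPMap (LinearMap.range Φ)) x := by
    rintro ⟨_, ⟨u, rfl⟩⟩ hu
    change 0 ≤ F (Φ u)
    obtain ⟨h0, h1⟩ := hu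
    change 0 ≤ u.2.2 at h0
    replace h1 : ∀ z : K × K, 0 ≤ (u.1 z.1 + u.2.1 z.2) + u.2.2 * cost z := h1
    rcases h0.eq_or_lt with h | h
    · change 0 ≤ _ + u.2.2 * ε
      rw [← h, zero_mul, add_zero]
      refine integral_nonneg fun z => ?_
      have := h1 z
      rw [← h, zero_mul, add_zero] at this
      exact this
    · rw [hFΦ]
      have := H (u.2.2⁻¹ • u.1) (-(u.2.2⁻¹ • u.2.1)) (fun x y => by
        have := h1 (x, y)
        simp only [ContinuousMap.neg_apply, ContinuousMap.smul_apply, smul_eq_mul]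
        have h3 : 0 ≤ u.2.2⁻¹ * (u.1 x + u.2.1 y + u.2.2 * cost (x, y)) := by positivity
        have h4 : u.2.2⁻¹ * (u.1 x + u.2.1 y + u.2.2 * cost (x, y)) =
          u.2.2⁻¹ * u.1 x + u.2.2⁻¹ * u.2.1 y + cost (x, y) := by field_simp
        linarith)
      simp only [ContinuousMap.neg_apply, ContinuousMap.smul_apply, smul_eq_mul,
        integral_neg, integral_const_mul] at this
      have h3 : 0 ≤ u.2.2 * (u.2.2⁻¹ * ∫ x, u.1 x ∂P + ε + u.2.2⁻¹ * ∫ x, u.2.1 x ∂Q) := by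
        apply mul_nonneg h.le; linarith
      have h4 : u.2.2 * (u.2.2⁻¹ * ∫ x, u.1 x ∂P + ε + u.2.2⁻¹ * ∫ x, u.2.1 x ∂Q) =
        ∫ x, u.1 x ∂P + u.2.2 * ε + ∫ x, u.2.1 x ∂Q := by field_simp
      linarith
  have dense : ∀ y, ∃ x : (F.toPMap (LinearMap.range Φ)).domain,
      (x : C(K × K, ℝ) × ℝ) + y ∈ s := by
    intro y
    refine ⟨⟨_, ⟨(ContinuousMap.const K (‖y.1‖ + (|y.2| + y.2) * ‖cost‖), 0, |y.2|), rfl⟩⟩, ?_⟩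
    have h0 : 0 ≤ |y.2| + y.2 := by linarith [neg_abs_le y.2]
    refine ⟨h0, fun z => ?_⟩
    have h1 : -‖y.1‖ ≤ y.1 z := (abs_le.1 (y.1.norm_coe_le_norm z)).1
    have h2 : -‖cost‖ ≤ cost z := (abs_le.1 (cost.norm_coe_le_norm z)).1
    change 0 ≤ ((‖y.1‖ + (|y.2| + y.2) * ‖cost‖) + 0 + y.1 z) + (|y.2| + y.2) * cost z
    nlinarith
  obtain ⟨g, hg1, hg2⟩ := riesz_extension s (F.toPMap (LinearMap.range Φ)) nonneg dense
  have hgΦ : ∀ u, g (Φ u) = ∫ x, u.1 x ∂P + ∫ y, u.2.1 y ∂Q + u.2.2 * ε := fun u => by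
    rw [← hFΦ]; exact hg1 ⟨Φ u, ⟨u, rfl⟩⟩
  obtain ⟨π, hπ, hπL⟩ := exists_measure_of_positive_functional
    (g.comp (LinearMap.inl ℝ C(K × K, ℝ) ℝ)) (fun f hf => hg2 _ ⟨le_rfl, fun z => by
      simpa using hf z⟩)
  have hfst : π.map Prod.fst = P := by
    refine measure_ext_of_integral_continuousMap fun f => ?_
    rw [integral_map measurable_fst.aemeasurable
      f.continuous.measurable.aestronglyMeasurable]
    have h1 := hπL (f.comp p1)
    have h2 := hgΦ (f, 0, 0)
    have h3 : Φ (f, 0, 0) = (f.comp p1, 0) := by ext <;> simp [Φ]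
    rw [h3] at h2
    simpa [p1, p2] using h1.trans h2
  have hsnd : π.map Prod.snd = Q := by
    refine measure_ext_of_integral_continuousMap fun f => ?_
    rw [integral_map measurable_snd.aemeasurable
      f.continuous.measurable.aestronglyMeasurable]
    have h1 := hπL (f.comp p2)
    have h2 := hgΦ (0, f, 0)
    have h3 : Φ (0, f, 0) = (f.comp p2, 0) := by ext <;> simp [Φ]
    rw [h3] at h2
    simpa [p1, p2] using h1.trans h2
  refine ⟨π, ⟨?_⟩, hfst, hsnd, ?_⟩
  · have : π.map Prod.fst Set.univ = 1 := by rw [hfst]; exact measure_univ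
    rwa [Measure.map_apply measurable_fst MeasurableSet.univ] at this
  · rw [hπL cost]
    have h1 := hg2 (-cost, 1) ⟨zero_le_one, fun z => by simp⟩
    have h2 := hgΦ (0, 0, 1)
    have h3 : Φ (0, 0, 1) = (0, 1) := by ext <;> simp [Φ]
    have h4 : ((-cost, 1) : C(K × K, ℝ) × ℝ) = (0, 1) - (cost, 0) := by ext <;> simp
    rw [h3] at h2
    rw [h4, map_sub, h2] at h1
    simp only [LinearMap.comp_apply, LinearMap.inl_apply]
    simp at h1
    linarith

/-- Gluing of couplings along a chain. -/
theorem exists_chain_of_couplings {K : Type*} [MeasurableSpace K] [StandardBorelSpace K]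
    (N : ℕ) (G : ℕ → Measure K) (hG : IsProbabilityMeasure (G 0)) (π : ℕ → Measure (K × K))
    (hπ : ∀ k < N, IsProbabilityMeasure (π k)) (h1 : ∀ k < N, (π k).map Prod.fst = G k)
    (h2 : ∀ k < N, (π k).map Prod.snd = G (k + 1)) :
    ∀ n ≤ N, ∃ ρ : Measure (ℕ → K), IsProbabilityMeasure ρ ∧
      (∀ k ≤ n, ρ.map (fun ω => ω k) = G k) ∧
      ∀ k < n, ρ.map (fun ω => (ω k, ω (k + 1))) = π k := by
  intro n
  have hne : Nonempty K := nonempty_of_isProbabilityMeasure (G 0)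
  induction n with
  | zero =>
    intro _
    have hm : Measurable (fun (x : K) (_ : ℕ) => x) := measurable_pi_iff.2 fun _ => measurable_id
    refine ⟨(G 0).map (fun x _ => x), Measure.isProbabilityMeasure_map hm.aemeasurable, ?_, ?_⟩
    · intro k hk
      obtain rfl : k = 0 := by omega
      rw [Measure.map_map (measurable_pi_apply 0) hm]
      exact Measure.map_id
    · intro k hk; omega
  | succ n ih =>
    intro hn
    obtain ⟨ρ, hρ, hm, hp⟩ := ih (by omega)
    have := hπ n (by omega)
    let κ : ProbabilityTheory.Kernel (ℕ → K) K :=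
      (π n).condKernel.comap (fun ω => ω n) (measurable_pi_apply n)
    let up : (ℕ → K) × K → (ℕ → K) := fun p => Function.update p.1 (n + 1) p.2
    have hup : Measurable up := by
      refine measurable_pi_iff.2 fun k => ?_
      by_cases hk : k = n + 1
      · subst hk; simpa [up] using measurable_snd
      · simpa [up, Function.update_of_ne hk, Function.comp_def] using
          (measurable_pi_apply k).comp measurable_fst
    have hlast : (ρ.compProd κ).map (fun p => (p.1 n, p.2)) = π n := by
      conv_rhs => rw [← (π n).disintegrate (π n).condKernel]
      refine Measure.ext_of_lintegral _ fun f hf => ?_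
      have hmeas : Measurable fun p : (ℕ → K) × K => (p.1 n, p.2) := by fun_prop
      rw [lintegral_map hf hmeas,
        Measure.lintegral_compProd (f := fun p : (ℕ → K) × K => f (p.1 n, p.2)) (hf.comp hmeas),
        Measure.lintegral_compProd hf]
      have : (π n).fst = ρ.map (fun ω => ω n) := by
        rw [hm n le_rfl, ← h1 n (by omega)]; rfl
      rw [this, lintegral_map hf.lintegral_kernel_prod_right' (measurable_pi_apply n)]
      rfl
    have hold : ∀ {α : Type _} [MeasurableSpace α] (f : (ℕ → K) → α), Measurable f →
        (ρ.compProd κ).map (fun p => f p.1) = ρ.map f := by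
      intro α _ f hf
      have : (fun p : (ℕ → K) × K => f p.1) = f ∘ Prod.fst := rfl
      rw [this, ← Measure.map_map hf measurable_fst]
      congr 1
      exact Measure.fst_compProd _ _
    have hpair : ∀ k < n + 1, ((ρ.compProd κ).map up).map (fun ω => (ω k, ω (k + 1))) = π k := by
      intro k hk
      have hmeas : Measurable fun ω : ℕ → K => (ω k, ω (k + 1)) := by fun_prop
      rw [Measure.map_map hmeas hup]
      rcases Nat.lt_succ_iff_lt_or_eq.1 hk with h | rfl
      · rw [← hp k h, ← hold _ hmeas]
        congr 1
        ext p : 1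
        simp [up, Function.update_of_ne (show k ≠ n + 1 by omega),
          Function.update_of_ne (show k + 1 ≠ n + 1 by omega)]
      · rw [← hlast]
        congr 1
        ext p : 1
        simp [up]
    refine ⟨(ρ.compProd κ).map up, Measure.isProbabilityMeasure_map hup.aemeasurable, ?_, hpair⟩
    intro k hk
    rcases Nat.le_succ_iff.1 hk with h | rfl
    · rw [Measure.map_map (measurable_pi_apply k) hup, ← hm k h,
        ← hold _ (measurable_pi_apply k)]
      congr 1
      ext p : 1
      simp [up, Function.update_of_ne (show k ≠ n + 1 by omega)]
    · have hmeas : Measurable fun ω : ℕ → K => (ω n, ω (n + 1)) := by fun_prop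
      rw [← h2 n (by omega), ← hpair n (by omega), Measure.map_map measurable_snd hmeas]
      rfl

theorem fderiv_le_of_abs_sub_le {m : ℕ} {χ : (Fin m → ℝ) → ℝ} (hχ : Differentiable ℝ χ)
    (h : ∀ z z', |χ z - χ z'| ≤ ∑ i, |z i - z' i|) (z v : Fin m → ℝ) :
    fderiv ℝ χ z v ≤ ∑ i, |v i| := by
  have h1 := (hχ z).hasFDerivAt.hasLineDerivAt v
  have h2 : Tendsto (fun t : ℝ => t⁻¹ • (χ (z + t • v) - χ z)) (𝓝[>] 0) (𝓝 (fderiv ℝ χ z v)) :=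
    (hasDerivAt_iff_tendsto_slope_zero.1 (by simpa [HasLineDerivAt] using h1)).mono_left
      (nhdsWithin_mono _ fun t ht => ne_of_gt ht) |>.congr (by simp)
  refine le_of_tendsto h2 ?_
  filter_upwards [self_mem_nhdsWithin] with t (ht : 0 < t)
  have h3 := (le_abs_self _).trans (h (z + t • v) z)
  have h4 : ∑ i, |(z + t • v) i - z i| = t * ∑ i, |v i| := by
    rw [Finset.mul_sum]
    refine Finset.sum_congr rfl fun i _ => ?_
    simp [abs_mul, abs_of_pos ht]
  rw [h4] at h3
  rw [smul_eq_mul, inv_mul_le_iff₀ ht]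
  exact h3

/-- Mollification of a function which is `1`-Lipschitz for the `ℓ¹` distance. -/
theorem exists_smooth_approx_of_abs_sub_le {m : ℕ} {ψ : (Fin m → ℝ) → ℝ}
    (h : ∀ z z', |ψ z - ψ z'| ≤ ∑ i, |z i - z' i|) {δ : ℝ} (hδ : 0 < δ) :
    ∃ χ : (Fin m → ℝ) → ℝ, ContDiff ℝ (⊤ : ℕ∞) χ ∧ (∀ z, |χ z - ψ z| ≤ δ) ∧
      ∀ z v, fderiv ℝ χ z v ≤ ∑ i, |v i| := by
  have hsum : ∀ z z' : Fin m → ℝ, ∑ i, |z i - z' i| ≤ m * dist z z' := fun z z' => by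
    calc ∑ i, |z i - z' i| ≤ ∑ _i : Fin m, dist z z' :=
          Finset.sum_le_sum fun i _ => by
            rw [← Real.dist_eq]; exact dist_le_pi_dist z z' i
      _ = m * dist z z' := by simp
  have hcont : Continuous ψ := by
    refine (LipschitzWith.of_dist_le_mul (K := m) fun z z' => ?_).continuous
    rw [Real.dist_eq]; exact (h z z').trans (by simpa using hsum z z')
  let ε := δ / (m + 1)
  have hε : 0 < ε := by positivity
  let φ : ContDiffBump (0 : Fin m → ℝ) := ⟨ε / 2, ε, half_pos hε, half_lt_self hε⟩
  let χ := convolution (φ.normed volume) ψ (ContinuousLinearMap.lsmul ℝ ℝ) volume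
  have hχ : ContDiff ℝ (⊤ : ℕ∞) χ := φ.hasCompactSupport_normed.contDiff_convolution_left _
    φ.contDiff_normed hcont.locallyIntegrable
  have hex : ∀ z, Integrable (fun t => φ.normed volume t * ψ (z - t)) := fun z => by
    refine Continuous.integrable_of_hasCompactSupport ?_ ?_
    · exact φ.continuous_normed.mul (hcont.comp (by fun_prop))
    · exact φ.hasCompactSupport_normed.mul_right
  refine ⟨χ, hχ, fun z => ?_, fderiv_le_of_abs_sub_le (hχ.differentiable (by simp)) ?_⟩
  · rw [← Real.dist_eq]
    refine φ.dist_normed_convolution_le hcont.aestronglyMeasurable fun y hy => ?_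
    rw [Real.dist_eq]
    have hy' : dist y z < ε := hy
    calc |ψ y - ψ z| ≤ m * dist y z := (h y z).trans (hsum y z)
      _ ≤ (m + 1) * ε := by
        gcongr; linarith
      _ = δ := by simp only [ε]; field_simp
  · intro z z'
    have e : χ z - χ z' = ∫ t, φ.normed volume t * (ψ (z - t) - ψ (z' - t)) := by
      simp only [χ, convolution, ContinuousLinearMap.lsmul_apply, smul_eq_mul]
      rw [← integral_sub (hex z) (hex z')]
      simp only [mul_sub]
    rw [e]
    refine abs_integral_le_integral_abs.trans ?_
    have h1 : ∫ t, φ.normed volume t * ∑ i, |z i - z' i| = ∑ i, |z i - z' i| := by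
      rw [integral_mul_const, φ.integral_normed, one_mul]
    rw [← h1]
    refine integral_mono_of_nonneg (ae_of_all _ fun _ => abs_nonneg _)
      (φ.integrable_normed.mul_const _) (ae_of_all _ fun t => ?_)
    simp only [abs_mul, abs_of_nonneg (φ.nonneg_normed t)]
    refine mul_le_mul_of_nonneg_left ?_ (φ.nonneg_normed t)
    simpa using h (z - t) (z' - t)

/-- A function whose increments are of second order with respect to a monotone function is
constant. -/
theorem eq_of_abs_sub_le_mul_mono {G V : ℝ → ℝ} {C s t : ℝ} (hst : s ≤ t)
    (h : ∀ r r', s ≤ r → r ≤ r' → r' ≤ t → |G r' - G r| ≤ C * (r' - r) * (V r' - V r)) :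
    G t = G s := by
  have key : ∀ n : ℕ, |G t - G s| ≤ C * (t - s) * (V t - V s) / (n + 1) := by
    intro n
    let τ : ℕ → ℝ := fun k => s + k * ((t - s) / (n + 1))
    have hn : (0 : ℝ) < n + 1 := by positivity
    have h0 : τ 0 = s := by simp [τ]
    have h1 : τ (n + 1) = t := by simp only [τ]; push_cast; field_simp; ring
    have hd : 0 ≤ (t - s) / (n + 1) := div_nonneg (by linarith) hn.le
    have hτ : ∀ k, τ (k + 1) - τ k = (t - s) / (n + 1) := fun k => by
      simp only [τ]; push_cast; ring
    have hmono : Monotone τ := monotone_nat_of_le_succ fun k => by linarith [hτ k]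
    rw [← h0, ← h1, ← Finset.sum_range_sub (fun k => G (τ k)) (n + 1)]
    refine (Finset.abs_sum_le_sum_abs _ _).trans ?_
    calc _ ≤ ∑ k ∈ Finset.range (n + 1), C * ((t - s) / (n + 1)) * (V (τ (k + 1)) - V (τ k)) := by
          refine Finset.sum_le_sum fun k hk => ?_
          have hk' := Finset.mem_range.1 hk
          rw [← hτ k]
          refine h _ _ ?_ (hmono (Nat.le_succ k)) ?_
          · rw [← h0]; exact hmono (Nat.zero_le _)
          · rw [← h1]; exact hmono hk'
      _ = _ := by
          rw [← Finset.mul_sum, Finset.sum_range_sub (fun k => V (τ k)) (n + 1), h0, h1]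
          ring
  have : |G t - G s| ≤ 0 := by
    refine ge_of_tendsto' (x := atTop) (f := fun n : ℕ => C * (t - s) * (V t - V s) / ((n : ℝ) + 1))
      ?_ key
    exact (tendsto_const_nhds (x := C * (t - s) * (V t - V s)) (f := atTop)).div_atTop
      (tendsto_atTop_add_const_right atTop (1 : ℝ) tendsto_natCast_atTop_atTop)
  linarith [abs_nonpos_iff.1 this]

theorem ContDiff.exists_lipschitz_of_isCompact {E F : Type*} [NormedAddCommGroup E]
    [NormedSpace ℝ E] [NormedAddCommGroup F] [NormedSpace ℝ F] {f : E → F} (hf : ContDiff ℝ 1 f)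
    {B : Set E} (hB : IsCompact B) :
    ∃ C : ℝ, 0 ≤ C ∧ ∀ x ∈ B, ∀ y ∈ B, ‖f x - f y‖ ≤ C * ‖x - y‖ := by
  obtain ⟨C, hC⟩ := LocallyLipschitzOn.exists_lipschitzOnWith_of_compact hB
    (hf.locallyLipschitz.locallyLipschitzOn (s := B))
  exact ⟨C, C.2, fun x hx y hy => by simpa [dist_eq_norm] using hC.dist_le_mul x hx y hy⟩

/-- A solution of a continuity equation on a compact space, in the coordinates `x i`. -/
structure ContinuityEquation (K : Type*) [TopologicalSpace K] [CompactSpace K] [PolishSpace K]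
    [MeasurableSpace K] [BorelSpace K] where
  T : ℝ
  T_pos : 0 < T
  x : ℕ → C(K, ℝ)
  separates : ∀ μ ν, (∀ i, x i μ = x i ν) → μ = ν
  Γ : ProbabilityTheory.Kernel ℝ K
  markov : ProbabilityTheory.IsMarkovKernel Γ
  continuous_Γ : ∀ f : C(K, ℝ), Continuous fun t => ∫ μ, f μ ∂(Γ t)
  β : ℕ → ℝ × K → ℝ
  integrable_β : ∀ i, Integrable (β i) ((volume.restrict (Set.Ioc 0 T)).compProd Γ)
  eqn : ∀ (n : ℕ) (f : (Fin n → ℝ) → ℝ), ContDiff ℝ 2 f → ∀ s t, 0 ≤ s → s ≤ t → t ≤ T →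
    ∫ μ, f (fun k => x k μ) ∂(Γ t) - ∫ μ, f (fun k => x k μ) ∂(Γ s) =
      ∫ p in Set.Ioc s t ×ˢ Set.univ, fderiv ℝ f (fun k => x k p.2) (fun k => β k p)
        ∂((volume.restrict (Set.Ioc 0 T)).compProd Γ)

namespace ContinuityEquation

theorem measurableSet_strip {K : Type*} [MeasurableSpace K] (s t : ℝ) :
    MeasurableSet (Set.Ioc s t ×ˢ (Set.univ : Set K)) :=
  measurableSet_Ioc.prod .univ

variable {K : Type*} [TopologicalSpace K] [CompactSpace K] [PolishSpace K]
    [MeasurableSpace K] [BorelSpace K] (D : ContinuityEquation K)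

instance : ProbabilityTheory.IsMarkovKernel D.Γ := D.markov

/-- The space-time measure `Γ_t dt` on `(0,T] × K`. -/
def Λ : Measure (ℝ × K) := (volume.restrict (Set.Ioc 0 D.T)).compProd D.Γ

instance : IsFiniteMeasure D.Λ := by unfold Λ; infer_instance

/-- The first `n` coordinates. -/
def X (n : ℕ) (μ : K) : Fin n → ℝ := fun k => D.x k μ

/-- The first `n` components of the vector field. -/
def B (n : ℕ) (p : ℝ × K) : Fin n → ℝ := fun k => D.β k p

theorem continuous_X (n : ℕ) : Continuous (D.X n) := continuous_pi fun k => (D.x k).continuous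

theorem integrable_B (n : ℕ) : Integrable (D.B n) D.Λ :=
  Integrable.of_eval fun k => D.integrable_β k

theorem ae_mem : ∀ᵐ p ∂D.Λ, p.1 ∈ Set.Ioc 0 D.T := by
  refine Measure.ae_compProd_of_ae_fst _ measurableSet_Ioc ?_
  exact ae_restrict_mem measurableSet_Ioc

theorem setIntegral_strip {s t : ℝ} (hs : 0 ≤ s) (ht : t ≤ D.T) {f : ℝ × K → ℝ}
    (hf : Integrable f D.Λ) :
    ∫ p in Set.Ioc s t ×ˢ Set.univ, f p ∂D.Λ = ∫ r in Set.Ioc s t, ∫ μ, f (r, μ) ∂(D.Γ r) := by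
  rw [Λ, Measure.setIntegral_compProd measurableSet_Ioc .univ hf.integrableOn,
    Measure.restrict_restrict measurableSet_Ioc,
    Set.inter_eq_left.2 (Set.Ioc_subset_Ioc hs ht)]
  simp

theorem integral_Λ {f : ℝ × K → ℝ} (hf : Integrable f D.Λ) :
    ∫ p, f p ∂D.Λ = ∫ r in Set.Ioc 0 D.T, ∫ μ, f (r, μ) ∂(D.Γ r) :=
  Measure.integral_compProd hf

theorem setIntegral_strip_add {r s t : ℝ} (h1 : r ≤ s) (h2 : s ≤ t) {f : ℝ × K → ℝ}
    (hf : Integrable f D.Λ) :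
    ∫ p in Set.Ioc r s ×ˢ Set.univ, f p ∂D.Λ + ∫ p in Set.Ioc s t ×ˢ Set.univ, f p ∂D.Λ =
      ∫ p in Set.Ioc r t ×ˢ Set.univ, f p ∂D.Λ := by
  rw [← setIntegral_union _ (measurableSet_strip s t) hf.integrableOn hf.integrableOn,
    ← Set.union_prod, Set.Ioc_union_Ioc_eq_Ioc h1 h2]
  rw [Set.disjoint_prod]
  exact Or.inl (Set.Ioc_disjoint_Ioc_of_le le_rfl)

theorem setIntegral_strip_one {s t : ℝ} (hs : 0 ≤ s) (hst : s ≤ t) (ht : t ≤ D.T) :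
    ∫ _p in Set.Ioc s t ×ˢ Set.univ, (1 : ℝ) ∂D.Λ = t - s := by
  rw [D.setIntegral_strip hs ht (integrable_const _)]
  simp [hst]

theorem exists_bound {E : Type*} [NormedAddCommGroup E] {A : ℝ × K → E} (hA : Continuous A) :
    ∃ C, 0 ≤ C ∧ ∀ t ∈ Set.Icc 0 D.T, ∀ μ, ‖A (t, μ)‖ ≤ C := by
  obtain ⟨C, hC⟩ := (isCompact_Icc (a := (0 : ℝ)) (b := D.T)).prod
    (isCompact_univ (X := K)) |>.exists_bound_of_continuousOn hA.continuousOn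
  exact ⟨max C 0, le_max_right _ _, fun t ht μ => (hC (t, μ) ⟨ht, trivial⟩).trans (le_max_left _ _)⟩

theorem integrable_continuous {A : ℝ × K → ℝ} (hA : Continuous A) : Integrable A D.Λ := by
  obtain ⟨C, _, hC⟩ := D.exists_bound hA
  refine Integrable.of_bound hA.aestronglyMeasurable C ?_
  filter_upwards [D.ae_mem] with p hp
  exact hC p.1 (Set.Ioc_subset_Icc_self hp) p.2

theorem integrable_clm_apply {E : Type*} [NormedAddCommGroup E] [NormedSpace ℝ E]
    {A : ℝ × K → E →L[ℝ] ℝ} (hA : Continuous A) {v : ℝ × K → E} (hv : Integrable v D.Λ) :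
    Integrable (fun p => A p (v p)) D.Λ := by
  obtain ⟨C, _, hC⟩ := D.exists_bound hA
  refine (hv.norm.const_mul C).mono' ?_ ?_
  · exact isBoundedBilinearMap_apply.continuous.comp_aestronglyMeasurable
      (hA.aestronglyMeasurable.prodMk hv.aestronglyMeasurable)
  · filter_upwards [D.ae_mem] with p hp
    exact (A p).le_of_opNorm_le (hC p.1 (Set.Ioc_subset_Icc_self hp) p.2) _

theorem integrable_of_continuous {f : K → ℝ} (hf : Continuous f) (t : ℝ) :
    Integrable f (D.Γ t) :=
  ContinuousMap.integrable_of_compactSpace _ ⟨f, hf⟩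

theorem eqn' {n : ℕ} {f : (Fin n → ℝ) → ℝ} (hf : ContDiff ℝ 2 f) {s t : ℝ} (hs : 0 ≤ s)
    (hst : s ≤ t) (ht : t ≤ D.T) :
    ∫ μ, f (D.X n μ) ∂(D.Γ t) - ∫ μ, f (D.X n μ) ∂(D.Γ s) =
      ∫ p in Set.Ioc s t ×ˢ Set.univ, fderiv ℝ f (D.X n p.2) (D.B n p) ∂D.Λ :=
  D.eqn n f hf s t hs hst ht

theorem abs_setIntegral_strip_le {s t C : ℝ} {f h : ℝ × K → ℝ} (hh : Integrable h D.Λ)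
    (hs : 0 ≤ s) (ht : t ≤ D.T)
    (H : ∀ r ∈ Set.Ioc s t, r ∈ Set.Icc 0 D.T → ∀ μ, |f (r, μ)| ≤ C * h (r, μ)) :
    |∫ p in Set.Ioc s t ×ˢ Set.univ, f p ∂D.Λ| ≤
      C * ∫ p in Set.Ioc s t ×ˢ Set.univ, h p ∂D.Λ := by
  rw [← integral_const_mul, ← Real.norm_eq_abs]
  refine norm_integral_le_of_norm_le (hh.integrableOn.const_mul C) ?_
  refine (ae_restrict_mem (measurableSet_strip s t)).mono fun p hp => ?_
  exact H p.1 hp.1 ⟨hs.trans hp.1.1.le, hp.1.2.trans ht⟩ p.2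

/-- The continuity equation tested against time-dependent functions. -/
theorem eqn_time {n : ℕ} {U : ℝ × (Fin n → ℝ) → ℝ} (hU : ContDiff ℝ (⊤ : ℕ∞) U) {s t : ℝ}
    (hs : 0 ≤ s) (hst : s ≤ t) (ht : t ≤ D.T) :
    ∫ μ, U (t, D.X n μ) ∂(D.Γ t) - ∫ μ, U (s, D.X n μ) ∂(D.Γ s) =
      ∫ p in Set.Ioc s t ×ˢ Set.univ, fderiv ℝ U (p.1, D.X n p.2) (1, D.B n p) ∂D.Λ := by
  have hX := D.continuous_X n
  have hUd : Differentiable ℝ U := hU.differentiable (by simp)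
  have hL : ContDiff ℝ (⊤ : ℕ∞) (fderiv ℝ U) := hU.fderiv_right (by simp)
  -- a compact convex neighbourhood of the range
  obtain ⟨R, hR0, hR⟩ : ∃ R, 0 < R ∧ ∀ μ, ‖D.X n μ‖ < R := by
    obtain ⟨C, hC0, hC⟩ := D.exists_bound (hX.comp continuous_snd)
    exact ⟨C + 1, by linarith, fun μ => by
      have := hC 0 ⟨le_rfl, D.T_pos.le⟩ μ
      simp only [Function.comp] at this
      linarith⟩
  let S : Set (ℝ × (Fin n → ℝ)) := Set.Icc 0 D.T ×ˢ Metric.closedBall 0 R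
  have hS : IsCompact S := isCompact_Icc.prod (isCompact_closedBall _ _)
  obtain ⟨C, hC0, hC⟩ := (hL.of_le (by simp)).exists_lipschitz_of_isCompact hS
  let w : ℝ → (Fin n → ℝ) → ℝ := fun r z => fderiv ℝ U (r, z) (1, 0)
  have hw : ∀ r, ContDiff ℝ (⊤ : ℕ∞) (w r) := fun r =>
    (hL.comp (contDiff_const.prodMk contDiff_id)).clm_apply contDiff_const
  have hwc : Continuous fun p : ℝ × K => w p.1 (D.X n p.2) :=
    (hL.continuous.comp (by fun_prop)).clm_apply continuous_const
  have hmem : ∀ r ∈ Set.Icc 0 D.T, ∀ μ, (r, D.X n μ) ∈ S := fun r hr μ =>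
    ⟨hr, by simpa using (hR μ).le⟩
  have e1 : ‖((1 : ℝ), (0 : Fin n → ℝ))‖ = 1 := by simp [Prod.norm_def]
  -- derivative of `w`
  have hwL : ∀ r ∈ Set.Icc 0 D.T, ∀ μ, ‖fderiv ℝ (w r) (D.X n μ)‖ ≤ C := by
    intro r hr μ
    refine norm_fderiv_le_of_lip' ℝ hC0 ?_
    have : Metric.ball (0 : Fin n → ℝ) R ∈ 𝓝 (D.X n μ) :=
      Metric.isOpen_ball.mem_nhds (by simpa using hR μ)
    filter_upwards [this] with z hz
    have h1 := hC (r, z) ⟨hr, Metric.ball_subset_closedBall hz⟩ (r, D.X n μ) (hmem r hr μ)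
    have h2 := (fderiv ℝ U (r, z) - fderiv ℝ U (r, D.X n μ)).le_of_opNorm_le h1 (1, 0)
    rw [e1, mul_one] at h2
    simpa [w, Prod.norm_def] using h2
  have hBn := (D.integrable_B n).norm
  -- oscillation of the time derivative
  have hosc : ∀ r q, 0 ≤ r → r ≤ q → q ≤ D.T → ∀ f : (Fin n → ℝ) → ℝ, ContDiff ℝ 2 f →
      (∀ μ, ‖fderiv ℝ f (D.X n μ)‖ ≤ C) →
      |∫ μ, f (D.X n μ) ∂(D.Γ q) - ∫ μ, f (D.X n μ) ∂(D.Γ r)| ≤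
        C * ∫ p in Set.Ioc r q ×ˢ Set.univ, ‖D.B n p‖ ∂D.Λ := by
    intro r q hr hrq hq f hf hfC
    rw [D.eqn' hf hr hrq hq]
    refine D.abs_setIntegral_strip_le hBn hr hq fun u _ _ μ => ?_
    exact (fderiv ℝ f _).le_of_opNorm_le (hfC μ) _
  have hint1 : Integrable (fun p => fderiv ℝ U (p.1, D.X n p.2) (1, D.B n p)) D.Λ :=
    D.integrable_clm_apply (hL.continuous.comp (by fun_prop))
      ((integrable_const (1 : ℝ)).prodMk (D.integrable_B n))
  let G : ℝ → ℝ := fun q => ∫ μ, U (q, D.X n μ) ∂(D.Γ q) -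
    ∫ p in Set.Ioc 0 q ×ˢ Set.univ, fderiv ℝ U (p.1, D.X n p.2) (1, D.B n p) ∂D.Λ
  let V : ℝ → ℝ := fun q => 2 * q + 2 * ∫ p in Set.Ioc 0 q ×ˢ Set.univ, ‖D.B n p‖ ∂D.Λ
  have key : ∀ r r', s ≤ r → r ≤ r' → r' ≤ t → |G r' - G r| ≤ C * (r' - r) * (V r' - V r) := by
    intro r r' hsr hrr' hr't
    have hr : 0 ≤ r := hs.trans hsr
    have hr' : r' ≤ D.T := hr't.trans ht
    have hrm : r ∈ Set.Icc 0 D.T := ⟨hr, hrr'.trans hr'⟩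
    have hrm' : r' ∈ Set.Icc 0 D.T := ⟨hr.trans hrr', hr'⟩
    have hVa := D.setIntegral_strip_add hr hrr' hBn
    have hGa := D.setIntegral_strip_add hr hrr' hint1
    set J := ∫ p in Set.Ioc r r' ×ˢ Set.univ, ‖D.B n p‖ ∂D.Λ
    have hJ : V r' - V r = 2 * ((r' - r) + J) := by simp only [V]; linarith
    have hfU : ContDiff ℝ 2 fun z => U (r', z) :=
      contDiff_infty.1 (hU.comp (contDiff_const.prodMk contDiff_id)) 2
    have hfd : ∀ z v, fderiv ℝ (fun z => U (r', z)) z v = fderiv ℝ U (r', z) (0, v) := by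
      intro z v
      have h1 : HasFDerivAt (fun z : Fin n → ℝ => (r', z))
          (ContinuousLinearMap.inr ℝ ℝ (Fin n → ℝ)) z := hasFDerivAt_prodMk_right _ _
      have h2 := ((hUd (r', z)).hasFDerivAt.comp z h1).fderiv
      rw [show (fun z => U (r', z)) = U ∘ fun z => (r', z) from rfl, h2]
      simp
    have hA := D.eqn' hfU hr hrr' hr'
    simp only [hfd] at hA
    have hintA : Integrable (fun p => fderiv ℝ U (r', D.X n p.2) (0, D.B n p)) D.Λ :=
      D.integrable_clm_apply (hL.continuous.comp (by fun_prop))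
        ((integrable_const (0 : ℝ)).prodMk (D.integrable_B n))
    have hintA' : Integrable (fun p => fderiv ℝ U (p.1, D.X n p.2) (0, D.B n p)) D.Λ :=
      D.integrable_clm_apply (hL.continuous.comp (by fun_prop))
        ((integrable_const (0 : ℝ)).prodMk (D.integrable_B n))
    have hintw : Integrable (fun p => w p.1 (D.X n p.2)) D.Λ := D.integrable_continuous hwc
    have hwc' : Continuous fun p : ℝ × K => w r' (D.X n p.2) :=
      (hw r').continuous.comp (hX.comp continuous_snd)
    have hintw' : Integrable (fun p => w r' (D.X n p.2)) D.Λ := D.integrable_continuous hwc'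
    have hdist : ∀ u ∈ Set.Icc r r', ∀ z, ‖((r' : ℝ), (z : Fin n → ℝ)) - (u, z)‖ ≤ r' - r := by
      intro u hu z
      simp only [Prod.mk_sub_mk, sub_self, Prod.norm_def, norm_zero, Real.norm_eq_abs]
      rw [abs_of_nonneg (by linarith [hu.2])]
      exact max_le (by linarith [hu.1]) (by linarith)
    have hdL : ∀ u ∈ Set.Icc r r', ∀ μ,
        ‖fderiv ℝ U (r', D.X n μ) - fderiv ℝ U (u, D.X n μ)‖ ≤ C * (r' - r) := by
      intro u hu μ
      refine (hC _ (hmem r' hrm' μ) _ (hmem u ⟨hr.trans hu.1, hu.2.trans hr'⟩ μ)).trans ?_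
      exact mul_le_mul_of_nonneg_left (hdist u hu _) hC0
    have b1 : |∫ p in Set.Ioc r r' ×ˢ Set.univ, (fderiv ℝ U (r', D.X n p.2) (0, D.B n p) -
        fderiv ℝ U (p.1, D.X n p.2) (0, D.B n p)) ∂D.Λ| ≤ C * (r' - r) * J := by
      refine D.abs_setIntegral_strip_le hBn hr hr' fun u hu _ μ => ?_
      have := (fderiv ℝ U (r', D.X n μ) - fderiv ℝ U (u, D.X n μ)).le_of_opNorm_le
        (hdL u (Set.Ioc_subset_Icc_self hu) μ) (0, D.B n (u, μ))
      simpa [Prod.norm_def] using this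
    have b2 : |∫ p in Set.Ioc r r' ×ˢ Set.univ, (w r' (D.X n p.2) - w p.1 (D.X n p.2)) ∂D.Λ| ≤
        C * (r' - r) * (r' - r) := by
      rw [← D.setIntegral_strip_one hr hrr' hr']
      refine D.abs_setIntegral_strip_le (integrable_const _) hr hr' fun u hu _ μ => ?_
      rw [D.setIntegral_strip_one hr hrr' hr']
      have := (fderiv ℝ U (r', D.X n μ) - fderiv ℝ U (u, D.X n μ)).le_of_opNorm_le
        (hdL u (Set.Ioc_subset_Icc_self hu) μ) (1, 0)
      rw [e1] at this
      simpa [w] using this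
    have hcU : ∀ q, Continuous fun μ => U (q, D.X n μ) := fun q =>
      hU.continuous.comp (by fun_prop)
    have hiU : ∀ q q', Integrable (fun μ => U (q, D.X n μ)) (D.Γ q') := fun q q' =>
      D.integrable_of_continuous (hcU q) q'
    have hiw : ∀ q', Integrable (fun μ => w r' (D.X n μ)) (D.Γ q') := fun q' =>
      D.integrable_of_continuous ((hw r').continuous.comp hX) q'
    have b3 : |∫ μ, (U (r', D.X n μ) - U (r, D.X n μ) - (r' - r) * w r' (D.X n μ)) ∂(D.Γ r)| ≤
        C * (r' - r) * (r' - r) := by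
      have : ∀ μ, ‖U (r', D.X n μ) - U (r, D.X n μ) - (r' - r) * w r' (D.X n μ)‖ ≤
          C * (r' - r) * (r' - r) := by
        intro μ
        have h1 := (convex_segment (𝕜 := ℝ) (r, D.X n μ) (r', D.X n μ)).norm_image_sub_le_of_norm_fderiv_le'
          (f := U) (φ := fderiv ℝ U (r', D.X n μ)) (C := C * (r' - r))
          (fun z _ => hUd z) ?_ (left_mem_segment _ _ _) (right_mem_segment _ _ _)
        · have h2 : ((r' : ℝ), D.X n μ) - (r, D.X n μ) = (r' - r) • ((1 : ℝ), (0 : Fin n → ℝ)) := by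
            ext <;> simp
          rw [h2, map_smul, norm_smul, e1, mul_one, Real.norm_eq_abs (r' - r),
            abs_of_nonneg (by linarith : 0 ≤ r' - r), smul_eq_mul] at h1
          exact h1
        · intro z hz
          rw [segment_eq_image_lineMap] at hz
          obtain ⟨θ, hθ, rfl⟩ := hz
          have hu : AffineMap.lineMap (r, D.X n μ) (r', D.X n μ) θ =
              (r + θ * (r' - r), D.X n μ) := by
            ext <;> simp [AffineMap.lineMap_apply]; ring
          rw [hu, norm_sub_rev]
          exact hdL _ ⟨by nlinarith [hθ.1], by nlinarith [hθ.2]⟩ μ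
      have h4 := norm_integral_le_of_norm_le_const (μ := D.Γ r) (ae_of_all _ this)
      simpa using h4
    have b4 : |(r' - r) * ∫ μ, w r' (D.X n μ) ∂(D.Γ r) -
        ∫ p in Set.Ioc r r' ×ˢ Set.univ, w r' (D.X n p.2) ∂D.Λ| ≤ (C * J) * (r' - r) := by
      have h1 : (r' - r) * ∫ μ, w r' (D.X n μ) ∂(D.Γ r) =
          ∫ _q in Set.Ioc r r', ∫ μ, w r' (D.X n μ) ∂(D.Γ r) := by
        simp [hrr']
      have hcont : Continuous fun q => ∫ μ, w r' (D.X n μ) ∂(D.Γ q) :=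
        D.continuous_Γ ⟨_, (hw r').continuous.comp hX⟩
      rw [h1, D.setIntegral_strip hr hr' hintw', ← integral_sub (integrable_const _)
        hcont.integrableOn_Ioc]
      have h5 := norm_setIntegral_le_of_norm_le_const (μ := volume) (s := Set.Ioc r r')
        (f := fun q => ∫ μ, w r' (D.X n μ) ∂(D.Γ r) - ∫ μ, w r' (D.X n μ) ∂(D.Γ q))
        (C := C * J) (by simp) ?_
      · simpa [hrr'] using h5
      · intro q hq
        rw [Real.norm_eq_abs, abs_sub_comm]
        refine (hosc r q hr hq.1.le (hq.2.trans hr') _ (contDiff_infty.1 (hw r') 2)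
          (hwL r' hrm')).trans ?_
        refine mul_le_mul_of_nonneg_left ?_ hC0
        refine setIntegral_mono_set hBn.integrableOn (ae_of_all _ fun _ => norm_nonneg _) ?_
        exact (Set.prod_mono (Set.Ioc_subset_Ioc_right hq.2) le_rfl).eventuallyLE
    rw [integral_sub hintA.integrableOn hintA'.integrableOn] at b1
    rw [integral_sub hintw'.integrableOn hintw.integrableOn] at b2
    rw [integral_sub (f := fun μ => U (r', D.X n μ) - U (r, D.X n μ)) ((hiU _ _).sub (hiU _ _))
      ((hiw _).const_mul _), integral_sub (hiU _ _) (hiU _ _),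
      integral_const_mul] at b3
    have hsplit : ∫ p in Set.Ioc r r' ×ˢ Set.univ, fderiv ℝ U (p.1, D.X n p.2) (1, D.B n p) ∂D.Λ =
        ∫ p in Set.Ioc r r' ×ˢ Set.univ, w p.1 (D.X n p.2) ∂D.Λ +
        ∫ p in Set.Ioc r r' ×ˢ Set.univ, fderiv ℝ U (p.1, D.X n p.2) (0, D.B n p) ∂D.Λ := by
      rw [← integral_add hintw.integrableOn hintA'.integrableOn]
      refine integral_congr_ae (ae_of_all _ fun p => ?_)
      simp only [w]
      rw [← map_add]
      simp
    rw [hJ]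
    simp only [G]
    rw [abs_le] at b1 b2 b3 b4 ⊢
    constructor <;> nlinarith
  have := eq_of_abs_sub_le_mul_mono hst key
  have h2 := D.setIntegral_strip_add hs hst hint1
  simp only [G] at this
  linarith

end ContinuityEquation

theorem fderiv_comp_add_smul {E F : Type*} [NormedAddCommGroup E] [NormedSpace ℝ E]
    [NormedAddCommGroup F] [NormedSpace ℝ F] {χ : F → ℝ} (hχ : Differentiable ℝ χ) {c : E → F}
    (hc : Differentiable ℝ c) (pr : E →L[ℝ] F) (t r : ℝ) (z v : E) :
    fderiv ℝ (fun q : ℝ × E => χ (pr q.2 + (t - q.1) • c q.2)) (r, z) (1, v) =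
      fderiv ℝ χ (pr z + (t - r) • c z) (pr v - c z + (t - r) • fderiv ℝ c z v) := by
  have h1 : HasFDerivAt (fun q : ℝ × E => c q.2)
      ((fderiv ℝ c z).comp (ContinuousLinearMap.snd ℝ ℝ E)) (r, z) :=
    HasFDerivAt.comp (r, z) (hc z).hasFDerivAt hasFDerivAt_snd
  have h2 : HasFDerivAt (fun q : ℝ × E => t - q.1)
      (-(ContinuousLinearMap.fst ℝ ℝ E)) (r, z) := hasFDerivAt_fst.const_sub t
  have h3 : HasFDerivAt (fun q : ℝ × E => pr q.2)
      (pr.comp (ContinuousLinearMap.snd ℝ ℝ E)) (r, z) :=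
    HasFDerivAt.comp (r, z) pr.hasFDerivAt hasFDerivAt_snd
  have h4 : HasFDerivAt (fun q : ℝ × E => χ (pr q.2 + (t - q.1) • c q.2)) _ (r, z) :=
    HasFDerivAt.comp (r, z) (hχ (pr z + (t - r) • c z)).hasFDerivAt (h3.add (h2.smul h1))
  rw [h4.fderiv]
  simp only [ContinuousLinearMap.comp_apply, add_apply,
    smul_apply, ContinuousLinearMap.smulRight_apply,
    neg_apply, ContinuousLinearMap.coe_fst', ContinuousLinearMap.coe_snd']
  congr 1
  module

namespace ContinuityEquation

variable {K : Type*} [TopologicalSpace K] [CompactSpace K] [PolishSpace K]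
    [MeasurableSpace K] [BorelSpace K] (D : ContinuityEquation K)

/-- Coupling of `Γ_s` and `Γ_t` under which the increment of the coordinates is close to the one
prescribed by a vector field frozen at time `s`. -/
theorem exists_step_coupling {m M : ℕ} (hm : m ≤ M) {c : (Fin M → ℝ) → Fin m → ℝ}
    (hc : ContDiff ℝ (⊤ : ℕ∞) c) {L : ℝ}
    (hL : ∀ μ v, ∑ i, |fderiv ℝ c (D.X M μ) v i| ≤ L * ‖v‖) {s t : ℝ}
    (hs : 0 ≤ s) (hst : s ≤ t) (ht : t ≤ D.T) :
    ∃ π : Measure (K × K), IsProbabilityMeasure π ∧ π.map Prod.fst = D.Γ s ∧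
      π.map Prod.snd = D.Γ t ∧
      ∫ z, ∑ i : Fin m, |D.x i z.2 - D.x i z.1 - (t - s) * c (D.X M z.1) i| ∂π ≤
        ∫ p in Set.Ioc s t ×ˢ Set.univ,
          (∑ i : Fin m, |D.β i p - c (D.X M p.2) i| + (t - s) * L * ‖D.B M p‖) ∂D.Λ := by
  have hX := D.continuous_X M
  have hcd : Differentiable ℝ c := hc.differentiable (by simp)
  have hci : ∀ i, Continuous fun μ => c (D.X M μ) i := fun i =>
    (continuous_apply i).comp (hc.continuous.comp hX)
  have : Nonempty K := nonempty_of_isProbabilityMeasure (D.Γ s)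
  let Φ : K → Fin m → ℝ := fun x i => D.x i x + (t - s) * c (D.X M x) i
  have hΦ : Continuous Φ := continuous_pi fun i =>
    (D.x i).continuous.add (continuous_const.mul (hci i))
  let cost : C(K × K, ℝ) :=
    ⟨fun z => ∑ i : Fin m, |D.x i z.2 - D.x i z.1 - (t - s) * c (D.X M z.1) i|,
      continuous_finsetSum _ fun i _ =>
        ((((D.x i).continuous.comp continuous_snd).sub ((D.x i).continuous.comp continuous_fst)).sub
          (continuous_const.mul ((hci i).comp continuous_fst))).abs⟩
  have hcost : ∀ x y, cost (x, y) = ∑ i : Fin m, |D.X m y i - Φ x i| := fun x y => by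
    simp only [cost, ContinuousMap.coe_mk, Φ, X]
    exact Finset.sum_congr rfl fun i _ => by congr 1; ring
  refine exists_coupling_of_dual_bound (D.Γ s) (D.Γ t) cost _ fun φ ψ hφψ => ?_
  let hat : (Fin m → ℝ) → ℝ := fun z => ⨅ x, (φ x + ∑ i, |z i - Φ x i|)
  have hbdd : ∀ z : Fin m → ℝ, BddBelow (Set.range fun x => φ x + ∑ i, |z i - Φ x i|) := fun z =>
    (isCompact_range (f := fun x => φ x + ∑ i, |z i - Φ x i|) (φ.continuous.add
      (continuous_finsetSum _ fun i _ =>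
        (continuous_const.sub ((continuous_apply i).comp hΦ)).abs))).bddBelow
  have hat1 : ∀ z z', hat z ≤ hat z' + ∑ i, |z i - z' i| := by
    intro z z'
    rw [← sub_le_iff_le_add]
    refine le_ciInf fun x => ?_
    have h1 := ciInf_le (hbdd z) x
    have h2 : ∑ i, |z i - Φ x i| ≤ ∑ i, |z i - z' i| + ∑ i, |z' i - Φ x i| := by
      rw [← Finset.sum_add_distrib]
      exact Finset.sum_le_sum fun i _ => abs_sub_le _ _ _
    simp only [hat]
    linarith
  have hatL : ∀ z z', |hat z - hat z'| ≤ ∑ i, |z i - z' i| := by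
    intro z z'
    have h1 := hat1 z z'
    have h2 := hat1 z' z
    simp only [abs_sub_comm (z' _) (z _)] at h2
    rw [abs_le]; constructor <;> linarith
  have hatψ : ∀ y, ψ y ≤ hat (D.X m y) := fun y => le_ciInf fun x => by
    rw [← hcost]; exact hφψ x y
  have hatφ : ∀ x, hat (Φ x) ≤ φ x := fun x =>
    (ciInf_le (hbdd (Φ x)) x).trans (by simp)
  refine le_of_forall_pos_le_add fun ε hε => ?_
  obtain ⟨χ, hχ, hχd, hχL⟩ := exists_smooth_approx_of_abs_sub_le hatL (half_pos hε)
  have hχdf : Differentiable ℝ χ := hχ.differentiable (by simp)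
  let pr : (Fin M → ℝ) →L[ℝ] (Fin m → ℝ) :=
    ContinuousLinearMap.pi fun i => ContinuousLinearMap.proj (Fin.castLE hm i)
  have hpr : ∀ μ, pr (D.X M μ) = D.X m μ := fun μ => rfl
  let U : ℝ × (Fin M → ℝ) → ℝ := fun q => χ (pr q.2 + (t - q.1) • c q.2)
  have hU : ContDiff ℝ (⊤ : ℕ∞) U := by
    refine hχ.comp ?_
    exact (pr.contDiff.comp contDiff_snd).add
      ((contDiff_const.sub contDiff_fst).smul (hc.comp contDiff_snd))
  have hUd : ∀ r z v, fderiv ℝ U (r, z) (1, v) =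
      fderiv ℝ χ (pr z + (t - r) • c z) (pr v - c z + (t - r) • fderiv ℝ c z v) :=
    fderiv_comp_add_smul hχdf hcd pr t
  have key := D.eqn_time hU hs hst ht
  have hUi : ∀ r q, Integrable (fun μ => U (r, D.X M μ)) (D.Γ q) := fun r q =>
    D.integrable_of_continuous (hU.continuous.comp (by fun_prop)) q
  have i1 : ∫ y, ψ y ∂(D.Γ t) ≤ ∫ μ, U (t, D.X M μ) ∂(D.Γ t) + ε / 2 := by
    have : ∫ y, ψ y ∂(D.Γ t) ≤ ∫ μ, (U (t, D.X M μ) + ε / 2) ∂(D.Γ t) := by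
      refine integral_mono (D.integrable_of_continuous ψ.continuous t)
        ((hUi t t).add (integrable_const _)) fun y => ?_
      have h1 := (abs_le.1 (hχd (D.X m y))).1
      have h2 := hatψ y
      simp only [U, sub_self, zero_smul, add_zero, hpr]
      linarith
    rwa [integral_add (hUi t t) (integrable_const _), integral_const, probReal_univ, one_smul] at this
  have i2 : ∫ μ, U (s, D.X M μ) ∂(D.Γ s) ≤ ∫ x, φ x ∂(D.Γ s) + ε / 2 := by
    have hφi := D.integrable_of_continuous φ.continuous s
    have : ∫ μ, U (s, D.X M μ) ∂(D.Γ s) ≤ ∫ x, (φ x + ε / 2) ∂(D.Γ s) := by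
      refine integral_mono (hUi s s) (hφi.add (integrable_const _)) fun x => ?_
      have h1 := (abs_le.1 (hχd (Φ x))).2
      have h2 := hatφ x
      have h3 : pr (D.X M x) + (t - s) • c (D.X M x) = Φ x := by
        ext i; simp [hpr, Φ, X]
      simp only [U, h3]
      linarith
    rwa [integral_add hφi (integrable_const _), integral_const, probReal_univ, one_smul] at this
  have i3 : ∫ p in Set.Ioc s t ×ˢ Set.univ, fderiv ℝ U (p.1, D.X M p.2) (1, D.B M p) ∂D.Λ ≤
      ∫ p in Set.Ioc s t ×ˢ Set.univ,
          (∑ i : Fin m, |D.β i p - c (D.X M p.2) i| + (t - s) * L * ‖D.B M p‖) ∂D.Λ := by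
    refine setIntegral_mono_on ?_ ?_ (measurableSet_strip s t) ?_
    · exact (D.integrable_clm_apply ((hU.continuous_fderiv (by simp)).comp (by fun_prop))
        ((integrable_const (1 : ℝ)).prodMk (D.integrable_B M))).integrableOn
    · refine Integrable.integrableOn (.add (integrable_finsetSum _ fun i _ => ?_)
        ((D.integrable_B M).norm.const_mul _))
      exact ((D.integrable_β i).sub (D.integrable_continuous ((hci i).comp continuous_snd))).abs
    · intro p hp
      rw [hUd]
      refine (hχL _ _).trans ?_
      have h1 : 0 ≤ t - p.1 := by linarith [hp.1.2]
      have h2 : t - p.1 ≤ t - s := by linarith [hp.1.1]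
      have h3 := hL p.2 (D.B M p)
      have h4 : 0 ≤ L * ‖D.B M p‖ := (Finset.sum_nonneg fun i _ => abs_nonneg _).trans h3
      calc ∑ i, |(pr (D.B M p) - c (D.X M p.2) +
              (t - p.1) • fderiv ℝ c (D.X M p.2) (D.B M p)) i|
          ≤ ∑ i : Fin m, (|D.β i p - c (D.X M p.2) i| +
              (t - p.1) * |fderiv ℝ c (D.X M p.2) (D.B M p) i|) := by
            refine Finset.sum_le_sum fun i _ => (abs_add_le _ _).trans_eq ?_
            simp only [Pi.sub_apply, Pi.smul_apply, smul_eq_mul, abs_mul, abs_of_nonneg h1]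
            rfl
        _ = ∑ i : Fin m, |D.β i p - c (D.X M p.2) i| +
              (t - p.1) * ∑ i, |fderiv ℝ c (D.X M p.2) (D.B M p) i| := by
            rw [Finset.sum_add_distrib, Finset.mul_sum]
        _ ≤ _ := by
            rw [mul_assoc]
            gcongr
  linarith

end ContinuityEquation

/-- Convergence of left Riemann sums. -/
theorem tendsto_riemann_sum {g : ℝ → ℝ} (hg : Continuous g) {T : ℝ} (hT : 0 ≤ T) :
    Tendsto (fun N : ℕ => T / N * ∑ k ∈ Finset.range N, g (k * (T / N))) atTop
      (𝓝 (∫ r in Set.Ioc 0 T, g r)) := by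
  rw [← intervalIntegral.integral_of_le hT, Metric.tendsto_atTop]
  intro ε hε
  have huc := (isCompact_Icc (a := (0 : ℝ)) (b := T)).uniformContinuousOn_of_continuous
    hg.continuousOn
  rw [Metric.uniformContinuousOn_iff] at huc
  obtain ⟨δ, hδ, huc⟩ := huc (ε / (2 * (T + 1))) (by positivity)
  obtain ⟨N0, hN0⟩ := exists_nat_gt (T / δ)
  refine ⟨N0 + 1, fun N hN => ?_⟩
  have hN1 : (0 : ℝ) < N := by exact_mod_cast (by omega : 0 < N)
  have hNδ : T / N < δ := by
    rw [div_lt_iff₀ hδ] at hN0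
    rw [div_lt_iff₀ hN1]
    have : (N0 : ℝ) ≤ N := by exact_mod_cast (by omega : N0 ≤ N)
    nlinarith
  set h := T / N with hh
  have hh0 : 0 ≤ h := by positivity
  have hNh : (N : ℝ) * h = T := by rw [hh]; field_simp
  have hsum : ∫ r in (0 : ℝ)..T, g r =
      ∑ k ∈ Finset.range N, ∫ r in (k * h : ℝ)..((k + 1 : ℕ) * h : ℝ), g r := by
    rw [intervalIntegral.sum_integral_adjacent_intervals
      (a := fun k : ℕ => (k : ℝ) * h) fun k _ => hg.intervalIntegrable _ _]
    simp [hNh]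
  rw [hsum, Real.dist_eq, Finset.mul_sum, ← Finset.sum_sub_distrib]
  have hterm : ∀ k ∈ Finset.range N,
      |h * g (k * h) - ∫ r in (k * h : ℝ)..((k + 1 : ℕ) * h : ℝ), g r| ≤
        ε / (2 * (T + 1)) * h := by
    intro k hk
    have hkN : ((k + 1 : ℕ) : ℝ) ≤ N := by exact_mod_cast Finset.mem_range.1 hk
    have hle : (k * h : ℝ) ≤ (k + 1 : ℕ) * h := by push_cast; nlinarith
    have hkT : ((k + 1 : ℕ) : ℝ) * h ≤ T := by rw [← hNh]; gcongr
    have h1 : h * g (k * h) = ∫ _r in (k * h : ℝ)..((k + 1 : ℕ) * h : ℝ), g (k * h) := by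
      rw [intervalIntegral.integral_const, smul_eq_mul]; push_cast; ring
    rw [h1, ← intervalIntegral.integral_sub (by simp) (hg.intervalIntegrable _ _)]
    have h2 := intervalIntegral.norm_integral_le_of_norm_le_const (a := (k * h : ℝ))
      (b := ((k + 1 : ℕ) * h : ℝ)) (f := fun r => g (k * h) - g r)
      (C := ε / (2 * (T + 1))) ?_
    · rw [abs_of_nonneg (by linarith)] at h2
      refine h2.trans_eq ?_
      push_cast; ring
    · intro r hr
      rw [Set.uIoc_of_le hle] at hr
      have h0 : 0 ≤ (k : ℝ) * h := by positivity
      rw [← dist_eq_norm]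
      refine (huc _ ⟨h0, hle.trans hkT⟩ r ⟨h0.trans hr.1.le, hr.2.trans hkT⟩ ?_).le
      rw [Real.dist_eq, abs_sub_lt_iff]
      have : ((k + 1 : ℕ) : ℝ) * h = k * h + h := by push_cast; ring
      constructor <;> linarith [hr.1, hr.2]
  calc _ ≤ ∑ k ∈ Finset.range N, ε / (2 * (T + 1)) * h :=
        (Finset.abs_sum_le_sum_abs _ _).trans (Finset.sum_le_sum hterm)
    _ = ε / (2 * (T + 1)) * T := by
        rw [Finset.sum_const, Finset.card_range, nsmul_eq_mul, ← hNh]; ring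
    _ < ε := by
        rw [div_mul_eq_mul_div, div_lt_iff₀ (by positivity)]
        nlinarith

namespace ContinuityEquation

variable {K : Type*} [TopologicalSpace K] [CompactSpace K] [PolishSpace K]
    [MeasurableSpace K] [BorelSpace K] (D : ContinuityEquation K)

/-- Smooth functions of time and finitely many coordinates. -/
def IsCyl (c : ℝ × K → ℝ) : Prop :=
  ∃ M₀, ∀ M, M₀ ≤ M → ∃ f : ℝ × (Fin M → ℝ) → ℝ, ContDiff ℝ (⊤ : ℕ∞) f ∧
    ∀ p, c p = f (p.1, D.X M p.2)

variable {D} in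
theorem IsCyl.add {c c' : ℝ × K → ℝ} (h : D.IsCyl c) (h' : D.IsCyl c') : D.IsCyl (c + c') := by
  obtain ⟨M₁, h⟩ := h
  obtain ⟨M₂, h'⟩ := h'
  refine ⟨max M₁ M₂, fun M hM => ?_⟩
  obtain ⟨f, hf, hfc⟩ := h M ((le_max_left _ _).trans hM)
  obtain ⟨f', hf', hfc'⟩ := h' M ((le_max_right _ _).trans hM)
  exact ⟨f + f', hf.add hf', fun p => by simp [hfc, hfc']⟩

variable {D} in
theorem IsCyl.mul {c c' : ℝ × K → ℝ} (h : D.IsCyl c) (h' : D.IsCyl c') : D.IsCyl (c * c') := by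
  obtain ⟨M₁, h⟩ := h
  obtain ⟨M₂, h'⟩ := h'
  refine ⟨max M₁ M₂, fun M hM => ?_⟩
  obtain ⟨f, hf, hfc⟩ := h M ((le_max_left _ _).trans hM)
  obtain ⟨f', hf', hfc'⟩ := h' M ((le_max_right _ _).trans hM)
  exact ⟨f * f', hf.mul hf', fun p => by simp [hfc, hfc']⟩

theorem isCyl_const (r : ℝ) : D.IsCyl fun _ => r :=
  ⟨0, fun _ _ => ⟨fun _ => r, contDiff_const, fun _ => rfl⟩⟩

theorem isCyl_time : D.IsCyl fun p => p.1 :=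
  ⟨0, fun _ _ => ⟨fun q => q.1, contDiff_fst, fun _ => rfl⟩⟩

theorem isCyl_x (i : ℕ) : D.IsCyl fun p => D.x i p.2 :=
  ⟨i + 1, fun M hM => ⟨fun q => q.2 ⟨i, hM⟩, by fun_prop, fun _ => rfl⟩⟩

variable {D} in
theorem IsCyl.continuous {c : ℝ × K → ℝ} (h : D.IsCyl c) : Continuous c := by
  obtain ⟨M₀, h⟩ := h
  obtain ⟨f, hf, hfc⟩ := h M₀ le_rfl
  rw [funext hfc]
  have := D.continuous_X M₀
  exact hf.continuous.comp (by fun_prop)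

variable {D} in
theorem IsCyl.exists_lipschitz {c : ℝ × K → ℝ} (h : D.IsCyl c) :
    ∃ (L : ℝ) (M : ℕ), 0 ≤ L ∧ ∀ t ∈ Set.Icc 0 D.T, ∀ t' ∈ Set.Icc 0 D.T, ∀ μ μ',
      |c (t, μ) - c (t', μ')| ≤
        L * (|t - t'| + ∑ k ∈ Finset.range M, |D.x k μ - D.x k μ'|) := by
  obtain ⟨M, h⟩ := h
  obtain ⟨f, hf, hfc⟩ := h M le_rfl
  obtain ⟨L, hL0, hL⟩ := (contDiff_infty.1 hf 1).exists_lipschitz_of_isCompact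
    ((isCompact_Icc (a := (0 : ℝ)) (b := D.T)).prod (isCompact_range (D.continuous_X M)))
  refine ⟨L, M, hL0, fun t ht t' ht' μ μ' => ?_⟩
  rw [hfc, hfc, ← Real.norm_eq_abs]
  refine (hL _ ⟨ht, μ, rfl⟩ _ ⟨ht', μ', rfl⟩).trans (mul_le_mul_of_nonneg_left ?_ hL0)
  rw [Prod.norm_def]
  have h1 : ‖D.X M μ - D.X M μ'‖ ≤ ∑ k ∈ Finset.range M, |D.x k μ - D.x k μ'| := by
    refine (pi_norm_le_iff_of_nonneg (Finset.sum_nonneg fun _ _ => abs_nonneg _)).2 fun i => ?_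
    exact Finset.single_le_sum (f := fun k => |D.x k μ - D.x k μ'|) (fun _ _ => abs_nonneg _)
      (Finset.mem_range.2 i.2)
  refine max_le ?_ ?_
  · have : 0 ≤ ∑ k ∈ Finset.range M, |D.x k μ - D.x k μ'| :=
      Finset.sum_nonneg fun _ _ => abs_nonneg _
    simpa using this
  · exact h1.trans (by simp)

/-- Smooth cylindrical functions are dense in `L¹(Λ)`. -/
theorem exists_isCyl_near {u : ℝ × K → ℝ} (hu : Integrable u D.Λ) {ε : ℝ} (hε : 0 < ε) :
    ∃ c, D.IsCyl c ∧ ∫ p, |u p - c p| ∂D.Λ ≤ ε := by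
  let := TopologicalSpace.metrizableSpaceMetric K
  obtain ⟨g, hg, hgi⟩ := hu.exists_boundedContinuous_integral_sub_le (half_pos hε)
  let A : Subalgebra ℝ C(Set.Icc (0 : ℝ) D.T × K, ℝ) :=
    { carrier := {F | ∃ c, D.IsCyl c ∧ ∀ p, F p = c (p.1, p.2)}
      mul_mem' := by
        rintro F F' ⟨c, hc, h⟩ ⟨c', hc', h'⟩
        exact ⟨c * c', hc.mul hc', fun p => by simp [h, h']⟩
      add_mem' := by
        rintro F F' ⟨c, hc, h⟩ ⟨c', hc', h'⟩
        exact ⟨c + c', hc.add hc', fun p => by simp [h, h']⟩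
      algebraMap_mem' := fun r => ⟨fun _ => r, D.isCyl_const r, fun p => rfl⟩ }
  have hA : A.SeparatesPoints := by
    intro p q hpq
    by_contra! hcon
    refine hpq (Prod.ext (Subtype.ext ?_) (D.separates _ _ fun i => ?_))
    · have := hcon (fun p : Set.Icc (0 : ℝ) D.T × K => (p.1 : ℝ))
        ⟨⟨fun p => p.1, by fun_prop⟩, ⟨_, D.isCyl_time, fun p => rfl⟩, rfl⟩
      exact this
    · have := hcon (fun p : Set.Icc (0 : ℝ) D.T × K => D.x i p.2)
        ⟨⟨fun p => D.x i p.2, (D.x i).continuous.comp continuous_snd⟩,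
          ⟨_, D.isCyl_x i, fun p => rfl⟩, rfl⟩
      exact this
  obtain ⟨F, hF⟩ := ContinuousMap.exists_mem_subalgebra_near_continuous_of_separatesPoints A hA
    (fun p => g (p.1, p.2)) (g.continuous.comp (by fun_prop)) (ε / (2 * D.T))
    (div_pos hε (by linarith [D.T_pos]))
  obtain ⟨c, hc, hFc⟩ := F.2
  refine ⟨c, hc, ?_⟩
  have hci := D.integrable_continuous hc.continuous
  have h1 : ∫ p, |g p - c p| ∂D.Λ ≤ ε / 2 := by
    have h2 : ∀ᵐ p ∂D.Λ, |g p - c p| ≤ ε / (2 * D.T) := by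
      filter_upwards [D.ae_mem] with p hp
      have := (hF (⟨p.1, Set.Ioc_subset_Icc_self hp⟩, p.2)).le
      rw [hFc, norm_sub_rev] at this
      exact this
    have h3 := integral_mono_ae (hgi.sub hci).abs (integrable_const _) h2
    refine h3.trans_eq ?_
    rw [integral_const, Measure.real, Λ, Measure.compProd_apply_univ]
    have := D.T_pos
    simp [this.le]
    field_simp
  calc ∫ p, |u p - c p| ∂D.Λ ≤ ∫ p, (‖u p - g p‖ + |g p - c p|) ∂D.Λ :=
        integral_mono (hu.sub hci).abs ((hu.sub hgi).norm.add (hgi.sub hci).abs)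
          fun p => abs_sub_le _ _ _
    _ = ∫ p, ‖u p - g p‖ ∂D.Λ + ∫ p, |g p - c p| ∂D.Λ :=
        integral_add (hu.sub hgi).norm (hgi.sub hci).abs
    _ ≤ ε := by linarith

theorem continuous_integral {F : ℝ × K → ℝ} (hF : Continuous F) :
    Continuous fun t => ∫ μ, F (t, μ) ∂(D.Γ t) := by
  let G : C(ℝ, C(K, ℝ)) := ContinuousMap.curry ⟨F, hF⟩
  rw [continuous_iff_continuousAt]
  intro t₀
  have h1 := (D.continuous_Γ (G t₀)).tendsto t₀
  have h2 : Tendsto (fun t => ∫ μ, (G t μ - G t₀ μ) ∂(D.Γ t)) (𝓝 t₀) (𝓝 0) := by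
    have h3 : Tendsto (fun t => ‖G t - G t₀‖) (𝓝 t₀) (𝓝 0) := by
      have := (G.continuous.sub (continuous_const (y := G t₀))).norm.tendsto t₀
      simpa using this
    refine squeeze_zero_norm (fun t => ?_) h3
    have := norm_integral_le_of_norm_le_const (μ := D.Γ t) (C := ‖G t - G t₀‖)
      (f := fun μ => G t μ - G t₀ μ) (ae_of_all _ fun μ => (G t - G t₀).norm_coe_le_norm μ)
    simpa using this
  have h4 := h2.add h1
  rw [zero_add] at h4
  refine h4.congr fun t => ?_
  rw [integral_sub (D.integrable_of_continuous (G t).continuous t)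
    (D.integrable_of_continuous (G t₀).continuous t)]
  simp [G]

end ContinuityEquation

namespace ContinuityEquation

variable {K : Type*} [TopologicalSpace K] [CompactSpace K] [PolishSpace K]
    [MeasurableSpace K] [BorelSpace K] (D : ContinuityEquation K)

theorem sum_setIntegral_strip {h : ℝ} (hh : 0 ≤ h) {f : ℝ × K → ℝ} (hf : Integrable f D.Λ)
    (n : ℕ) :
    ∑ k ∈ Finset.range n, ∫ p in Set.Ioc (k * h) ((k + 1 : ℕ) * h) ×ˢ Set.univ, f p ∂D.Λ =
      ∫ p in Set.Ioc 0 (n * h) ×ˢ Set.univ, f p ∂D.Λ := by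
  induction n with
  | zero => simp
  | succ n ih =>
    rw [Finset.sum_range_succ, ih, D.setIntegral_strip_add (by positivity) _ hf]
    push_cast
    nlinarith

theorem setIntegral_strip_eq_integral {f : ℝ × K → ℝ} :
    ∫ p in Set.Ioc 0 D.T ×ˢ Set.univ, f p ∂D.Λ = ∫ p, f p ∂D.Λ := by
  rw [Measure.restrict_eq_self_of_ae_mem]
  filter_upwards [D.ae_mem] with p hp using ⟨hp, trivial⟩

/-- A discrete-time process with the marginals of `Γ` which approximately follows the smooth
cylindrical vector field `F`. -/
theorem eventually_exists_chain {m M : ℕ} (hm : m ≤ M) {F : ℝ × (Fin M → ℝ) → Fin m → ℝ}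
    (hF : ContDiff ℝ (⊤ : ℕ∞) F) {ε : ℝ} (hε : 0 < ε) :
    ∀ᶠ N : ℕ in atTop, ∃ ρ : Measure (ℕ → K), IsProbabilityMeasure ρ ∧
      (∀ k ≤ N, ρ.map (fun ω => ω k) = D.Γ (k * (D.T / N))) ∧
      ∫ ω, ∑ k ∈ Finset.range N, ∑ i : Fin m, |D.x i (ω (k + 1)) - D.x i (ω k) -
        D.T / N * F (k * (D.T / N), D.X M (ω k)) i| ∂ρ ≤
        ∫ p, ∑ i : Fin m, |D.β i p - F (p.1, D.X M p.2) i| ∂D.Λ + ε := by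
  have hX := D.continuous_X M
  have hFd : Differentiable ℝ F := hF.differentiable (by simp)
  have hF' : ContDiff ℝ (⊤ : ℕ∞) (fderiv ℝ F) := hF.fderiv_right (by simp)
  obtain ⟨C, hC0, hC⟩ := D.exists_bound (A := fun p : ℝ × K => fderiv ℝ F (p.1, D.X M p.2))
    (hF'.continuous.comp (by fun_prop))
  obtain ⟨L, hL0, hL⟩ := (contDiff_infty.1 hF 1).exists_lipschitz_of_isCompact
    ((isCompact_Icc (a := (0 : ℝ)) (b := D.T)).prod (isCompact_range hX))
  have hBn := (D.integrable_B M).norm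
  set J := ∫ p, ‖D.B M p‖ ∂D.Λ with hJ
  have hlim : Tendsto (fun N : ℕ => D.T / N * (m * L * D.T + m * C * J)) atTop (𝓝 0) := by
    simpa using (tendsto_const_div_atTop_nhds_zero_nat D.T).mul_const (m * L * D.T + m * C * J)
  filter_upwards [hlim.eventually_lt_const hε, eventually_gt_atTop 0] with N hN hN0
  have hN0' : (0 : ℝ) < N := by exact_mod_cast hN0
  set h := D.T / N with hh
  have hhpos : 0 < h := div_pos D.T_pos hN0'
  have hNh : N * h = D.T := by rw [hh]; field_simp
  have htk : ∀ k : ℕ, k ≤ N → (k : ℝ) * h ≤ D.T := fun k hk => by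
    rw [← hNh]; exact mul_le_mul_of_nonneg_right (by exact_mod_cast hk) hhpos.le
  have htk0 : ∀ k : ℕ, 0 ≤ (k : ℝ) * h := fun k => by positivity
  have hstep : ∀ k : ℕ, k < N → ∃ π : Measure (K × K), IsProbabilityMeasure π ∧
      π.map Prod.fst = D.Γ (k * h) ∧ π.map Prod.snd = D.Γ ((k + 1 : ℕ) * h) ∧
      ∫ z, ∑ i : Fin m, |D.x i z.2 - D.x i z.1 - h * F (k * h, D.X M z.1) i| ∂π ≤
        ∫ p in Set.Ioc (k * h) ((k + 1 : ℕ) * h) ×ˢ Set.univ,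
          (∑ i : Fin m, |D.β i p - F (k * h, D.X M p.2) i| + h * (m * C) * ‖D.B M p‖) ∂D.Λ := by
    intro k hk
    have hsub : ((k + 1 : ℕ) : ℝ) * h - k * h = h := by push_cast; ring
    have := D.exists_step_coupling hm (c := fun z => F (k * h, z)) (L := m * C)
      (hF.comp (contDiff_const.prodMk contDiff_id)) ?_ (htk0 k)
      (mul_le_mul_of_nonneg_right (by push_cast; linarith) hhpos.le) (htk (k + 1) hk)
    · simpa only [hsub] using this
    · intro μ v
      have h1 : HasFDerivAt (fun z : Fin M → ℝ => ((k : ℝ) * h, z))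
          (ContinuousLinearMap.inr ℝ ℝ (Fin M → ℝ)) (D.X M μ) := hasFDerivAt_prodMk_right _ _
      have h2 := ((hFd (k * h, D.X M μ)).hasFDerivAt.comp _ h1).fderiv
      rw [show (fun z => F (k * h, z)) = F ∘ fun z => ((k : ℝ) * h, z) from rfl, h2]
      have h3 := (fderiv ℝ F (k * h, D.X M μ)).le_of_opNorm_le
        (hC _ ⟨htk0 k, htk k hk.le⟩ μ) (0, v)
      have h4 : ‖((0 : ℝ), v)‖ = ‖v‖ := by simp [Prod.norm_def]
      rw [h4] at h3
      calc _ ≤ ∑ _i : Fin m, C * ‖v‖ := Finset.sum_le_sum fun i _ => by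
            simpa using (norm_le_pi_norm _ i).trans h3
        _ = _ := by simp; ring
  choose! π hπ h1 h2 h3 using hstep
  have hρ := exists_chain_of_couplings N (fun k => D.Γ (k * h)) inferInstance π hπ h1 h2 N le_rfl
  obtain ⟨ρ, hρP, hρ1, hρ2⟩ := hρ
  refine ⟨ρ, hρP, hρ1, ?_⟩
  have hFc : ∀ i : Fin m, Continuous fun p : ℝ × K => F (p.1, D.X M p.2) i := fun i =>
    (continuous_apply i).comp (hF.continuous.comp (by fun_prop))
  have hΨ : ∀ k : ℕ, Continuous fun z : K × K =>
      ∑ i : Fin m, |D.x i z.2 - D.x i z.1 - h * F (k * h, D.X M z.1) i| := fun k =>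
    continuous_finsetSum _ fun i _ => ((((D.x i).continuous.comp continuous_snd).sub
      ((D.x i).continuous.comp continuous_fst)).sub (continuous_const.mul
        ((hFc i).comp (continuous_const.prodMk continuous_fst)))).abs
  have hm2 : ∀ k : ℕ, Measurable fun ω : ℕ → K => (ω k, ω (k + 1)) := fun k => by fun_prop
  have hint : Integrable (fun p => ∑ i : Fin m, |D.β i p - F (p.1, D.X M p.2) i|) D.Λ :=
    integrable_finsetSum _ fun i _ =>
      ((D.integrable_β i).sub (D.integrable_continuous (hFc i))).abs
  have hint' : ∀ k : ℕ, Integrable (fun p => ∑ i : Fin m, |D.β i p - F (k * h, D.X M p.2) i|) D.Λ :=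
    fun k => integrable_finsetSum _ fun i _ =>
      ((D.integrable_β i).sub (D.integrable_continuous
        ((hFc i).comp (continuous_const.prodMk continuous_snd)))).abs
  have hintT : Integrable (fun p => ∑ i : Fin m, |D.β i p - F (p.1, D.X M p.2) i| + m * (L * h) +
      h * (m * C) * ‖D.B M p‖) D.Λ :=
    (hint.add (integrable_const _)).add (hBn.const_mul _)
  rw [integral_finsetSum]
  · calc _ ≤ ∑ k ∈ Finset.range N, ∫ p in Set.Ioc (k * h) ((k + 1 : ℕ) * h) ×ˢ Set.univ,
          (∑ i : Fin m, |D.β i p - F (p.1, D.X M p.2) i| + m * (L * h) +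
            h * (m * C) * ‖D.B M p‖) ∂D.Λ := by
          refine Finset.sum_le_sum fun k hk => ?_
          have hk := Finset.mem_range.1 hk
          have e1 := h3 k hk
          rw [← hρ2 k hk, integral_map (hm2 k).aemeasurable
            (hΨ k).aestronglyMeasurable] at e1
          refine e1.trans ?_
          refine setIntegral_mono_on ((hint' k).add (hBn.const_mul _)).integrableOn
            hintT.integrableOn (measurableSet_strip _ _) fun p hp => ?_
          refine add_le_add_left ?_ _
          have hp1 := hp.1
          have hd : ‖F (p.1, D.X M p.2) - F (k * h, D.X M p.2)‖ ≤ L * h := by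
            refine (hL _ ⟨⟨(htk0 k).trans hp1.1.le, hp1.2.trans (htk (k + 1) hk)⟩,
              Set.mem_range_self _⟩ _ ⟨⟨htk0 k, htk k hk.le⟩, Set.mem_range_self _⟩).trans ?_
            refine mul_le_mul_of_nonneg_left ?_ hL0
            simp only [Prod.mk_sub_mk, sub_self, Prod.norm_def, norm_zero, Real.norm_eq_abs]
            have := hp1.2
            push_cast at this
            rw [abs_of_nonneg (by linarith [hp1.1])]
            exact max_le (by linarith) hhpos.le
          calc _ ≤ ∑ i : Fin m, (|D.β i p - F (p.1, D.X M p.2) i| + L * h) := by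
                refine Finset.sum_le_sum fun i _ => ?_
                have h5 := (norm_le_pi_norm _ i).trans hd
                simp only [Pi.sub_apply, Real.norm_eq_abs] at h5
                have h6 := abs_sub_le (D.β i p) (F (p.1, D.X M p.2) i) (F (k * h, D.X M p.2) i)
                linarith
            _ = _ := by rw [Finset.sum_add_distrib]; simp
      _ = ∫ p, (∑ i : Fin m, |D.β i p - F (p.1, D.X M p.2) i|) ∂D.Λ + m * (L * h) * D.T +
            h * (m * C) * J := by
          rw [D.sum_setIntegral_strip hhpos.le hintT, hNh, D.setIntegral_strip_eq_integral,
            integral_add (f := fun p => ∑ i : Fin m, |D.β i p - F (p.1, D.X M p.2) i| + m * (L * h))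
              (hint.add (integrable_const _)) (hBn.const_mul _),
            integral_add hint (integrable_const _), integral_const_mul (h * (m * C))]
          have h7 := D.setIntegral_strip_one le_rfl D.T_pos.le le_rfl
          rw [D.setIntegral_strip_eq_integral] at h7
          simp only [integral_const, smul_eq_mul, mul_one, sub_zero] at h7 ⊢
          rw [h7]; ring
      _ ≤ _ := by
          have : m * (L * h) * D.T + h * (m * C) * J = h * (m * L * D.T + m * C * J) := by ring
          linarith
  · intro k hk
    have hk := Finset.mem_range.1 hk
    have := hπ k hk
    have h8 := ContinuousMap.integrable_of_compactSpace (π k) ⟨_, hΨ k⟩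
    rw [← hρ2 k hk] at h8
    exact h8.comp_measurable (hm2 k)

/-- Discrete-time processes with the marginals of `Γ` approximately following, at the `n`-th
stage, all the vector fields `c j`, `j ≤ n`. -/
theorem exists_discrete_approximation {c : ℕ → ℕ → ℝ × K → ℝ} (hc : ∀ j i, D.IsCyl (c j i))
    (he : ∀ j i, ∫ p, |D.β i p - c j i p| ∂D.Λ ≤ 1 / ((j : ℝ) + 1) ^ 2) (n : ℕ) :
    ∃ N : ℕ, n + 1 ≤ N ∧ ∃ ρ : Measure (ℕ → K), IsProbabilityMeasure ρ ∧
      (∀ k ≤ N, ρ.map (fun ω => ω k) = D.Γ (k * (D.T / N))) ∧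
      ∀ i < n, ∀ j ≤ n, ∫ ω, ∑ k ∈ Finset.range N, |D.x i (ω (k + 1)) - D.x i (ω k) -
        D.T / N * c j i (k * (D.T / N), ω k)| ∂ρ ≤
        ∫ p, |D.β i p - c j i p| ∂D.Λ + 4 / ((n : ℝ) + 1) := by
  have hn : (0 : ℝ) < (n : ℝ) + 1 := by positivity
  choose M₀ hM₀ using fun i => hc n i
  set M := n + ∑ i ∈ Finset.range n, M₀ i with hM
  have hle : ∀ i : Fin n, M₀ i ≤ M := fun i =>
    (Finset.single_le_sum (f := M₀) (fun _ _ => Nat.zero_le _)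
      (Finset.mem_range.2 i.2)).trans (Nat.le_add_left _ _)
  choose f hf hfc using fun i : Fin n => hM₀ i M (hle i)
  have hcc : ∀ j i, Continuous (c j i) := fun j i => (hc j i).continuous
  have hci : ∀ j i, Integrable (c j i) D.Λ := fun j i => D.integrable_continuous (hcc j i)
  have hab : ∀ j i, Integrable (fun p => |D.β i p - c j i p|) D.Λ := fun j i =>
    ((D.integrable_β i).sub (hci j i)).abs
  have hgc : ∀ j i, Continuous fun p => |c n i p - c j i p| := fun j i =>
    ((hcc n i).sub (hcc j i)).abs
  have hev := D.eventually_exists_chain (by lia : n ≤ M)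
    (F := fun q i => f i q) (contDiff_pi.2 hf) (ε := 1 / ((n : ℝ) + 1)) (by positivity)
  have hev2 : ∀ᶠ N : ℕ in atTop, ∀ i ∈ Finset.range n, ∀ j ∈ Finset.range (n + 1),
      D.T / N * ∑ k ∈ Finset.range N, ∫ μ, |c n i (k * (D.T / N), μ) - c j i (k * (D.T / N), μ)|
        ∂(D.Γ (k * (D.T / N))) <
      ∫ p, |c n i p - c j i p| ∂D.Λ + 1 / ((n : ℝ) + 1) := by
    rw [Filter.eventually_all_finset]
    intro i _
    rw [Filter.eventually_all_finset]
    intro j _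
    have h1 := tendsto_riemann_sum (D.continuous_integral (hgc j i)) D.T_pos.le
    rw [← D.integral_Λ (D.integrable_continuous (hgc j i))] at h1
    exact h1.eventually_lt_const (lt_add_of_pos_right _ (by positivity))
  obtain ⟨N, ⟨ρ, hρP, hρ1, hρ2⟩, hN2, hNn⟩ :=
    (hev.and (hev2.and (eventually_ge_atTop (n + 1)))).exists
  refine ⟨N, hNn, ρ, hρP, hρ1, fun i hi j hj => ?_⟩
  set h := D.T / N with hh
  have hhpos : 0 ≤ h := div_nonneg D.T_pos.le (Nat.cast_nonneg _)
  have hmk : ∀ k : ℕ, Measurable fun ω : ℕ → K => ω k := fun k => measurable_pi_apply k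
  have hxc : ∀ k i, Continuous fun ω : ℕ → K => D.x i (ω k) := fun k i =>
    (D.x i).continuous.comp (continuous_apply k)
  have hcω : ∀ (k j i : ℕ), Continuous fun ω : ℕ → K => c j i (k * h, ω k) := fun k j i =>
    (hcc j i).comp (continuous_const.prodMk (continuous_apply k))
  have hΔc : ∀ (k j i : ℕ), Continuous fun ω : ℕ → K =>
      |D.x i (ω (k + 1)) - D.x i (ω k) - h * c j i (k * h, ω k)| := fun k j i =>
    (((hxc (k + 1) i).sub (hxc k i)).sub (continuous_const.mul (hcω k j i))).abs
  have hint : ∀ {g : (ℕ → K) → ℝ}, Continuous g → Integrable g ρ := fun hg =>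
    ContinuousMap.integrable_of_compactSpace ρ ⟨_, hg⟩
  have e1 : ∫ ω, ∑ k ∈ Finset.range N, |D.x i (ω (k + 1)) - D.x i (ω k) -
      h * c n i (k * h, ω k)| ∂ρ ≤ 2 / ((n : ℝ) + 1) := by
    refine le_trans (integral_mono (hint (continuous_finsetSum _ fun k _ => hΔc k n i))
      (hint (continuous_finsetSum _ fun k _ => continuous_finsetSum Finset.univ
        fun (i : Fin n) _ => hΔc k n i)) fun ω => ?_) (b := ∫ ω, ∑ k ∈ Finset.range N,
          ∑ i : Fin n, |D.x i (ω (k + 1)) - D.x i (ω k) - h * c n i (k * h, ω k)| ∂ρ) ?_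
    · refine Finset.sum_le_sum fun k _ => ?_
      exact Finset.single_le_sum (f := fun i : Fin n =>
        |D.x i (ω (k + 1)) - D.x i (ω k) - h * c n i (k * h, ω k)|)
        (fun _ _ => abs_nonneg _) (Finset.mem_univ ⟨i, hi⟩)
    · have hfc' : ∀ (i : Fin n) t μ, f i (t, D.X M μ) = c n i (t, μ) := fun i t μ =>
        (hfc i (t, μ)).symm
      simp only [hfc', Prod.mk.eta] at hρ2
      refine hρ2.trans ?_
      rw [integral_finsetSum _ fun (i : Fin n) _ => hab n i]
      have h1 : ∑ i : Fin n, ∫ p, |D.β i p - c n i p| ∂D.Λ ≤ 1 / ((n : ℝ) + 1) := by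
        calc _ ≤ ∑ _i : Fin n, 1 / ((n : ℝ) + 1) ^ 2 := Finset.sum_le_sum fun i _ => he n i
          _ = n / ((n : ℝ) + 1) ^ 2 := by simp; ring
          _ ≤ ((n : ℝ) + 1) / ((n : ℝ) + 1) ^ 2 := by gcongr; linarith
          _ = _ := by field_simp
      have h2 : 2 / ((n : ℝ) + 1) = 1 / ((n : ℝ) + 1) + 1 / ((n : ℝ) + 1) := by ring
      linarith
  have e2 : ∫ ω, ∑ k ∈ Finset.range N, h * |c n i (k * h, ω k) - c j i (k * h, ω k)| ∂ρ ≤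
      ∫ p, |D.β i p - c j i p| ∂D.Λ + 2 / ((n : ℝ) + 1) := by
    have hcabs : ∀ k : ℕ, Continuous fun ω : ℕ → K =>
        h * |c n i (k * h, ω k) - c j i (k * h, ω k)| := fun k =>
      continuous_const.mul ((hcω k n i).sub (hcω k j i)).abs
    rw [integral_finsetSum _ fun k _ => hint (hcabs k)]
    have h1 := hN2 i (Finset.mem_range.2 hi) j (Finset.mem_range.2 (by lia))
    have h2 : ∀ k ∈ Finset.range N,
        ∫ ω, h * |c n i (k * h, ω k) - c j i (k * h, ω k)| ∂ρ =
        h * ∫ μ, |c n i (k * h, μ) - c j i (k * h, μ)| ∂(D.Γ (k * h)) := by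
      intro k hk
      rw [← hρ1 k (Finset.mem_range.1 hk).le, integral_map (hmk k).aemeasurable
        (f := fun μ => |c n i (k * h, μ) - c j i (k * h, μ)|) ((hgc j i).comp (continuous_const.prodMk continuous_id)).aestronglyMeasurable,
        integral_const_mul]
    rw [Finset.sum_congr rfl h2, ← Finset.mul_sum]
    have h3 : ∫ p, |c n i p - c j i p| ∂D.Λ ≤
        ∫ p, (|D.β i p - c j i p| + |D.β i p - c n i p|) ∂D.Λ := by
      refine integral_mono (D.integrable_continuous (hgc j i))
        ((hab j i).add (hab n i))
        fun p => ?_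
      have := abs_sub_le (c n i p) (D.β i p) (c j i p)
      rw [abs_sub_comm (c n i p) (D.β i p)] at this
      simp only
      linarith
    rw [integral_add (hab j i) (hab n i)] at h3
    have h4 : 1 / ((n : ℝ) + 1) ^ 2 ≤ 1 / ((n : ℝ) + 1) := by
      refine one_div_le_one_div_of_le hn ?_
      nlinarith [Nat.cast_nonneg (α := ℝ) n]
    have h5 := he n i
    have h6 : 2 / ((n : ℝ) + 1) = 1 / ((n : ℝ) + 1) + 1 / ((n : ℝ) + 1) := by ring
    linarith
  have h7 : 4 / ((n : ℝ) + 1) = 2 / ((n : ℝ) + 1) + 2 / ((n : ℝ) + 1) := by ring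
  have e3 : ∫ ω, ∑ k ∈ Finset.range N, |D.x i (ω (k + 1)) - D.x i (ω k) -
      h * c j i (k * h, ω k)| ∂ρ ≤ ∫ ω, ((∑ k ∈ Finset.range N,
        |D.x i (ω (k + 1)) - D.x i (ω k) - h * c n i (k * h, ω k)|) +
        ∑ k ∈ Finset.range N, h * |c n i (k * h, ω k) - c j i (k * h, ω k)|) ∂ρ := by
    have hc1 := continuous_finsetSum (Finset.range N) fun k _ => hΔc k n i
    have hc2 := continuous_finsetSum (Finset.range N) fun k _ => hΔc k j i
    have hc3 := continuous_finsetSum (Finset.range N) fun k _ =>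
      (continuous_const (y := h)).mul ((hcω k n i).sub (hcω k j i)).abs
    refine integral_mono (hint hc2) (hint (hc1.add hc3)) fun ω => ?_
    simp only
    rw [← Finset.sum_add_distrib]
    refine Finset.sum_le_sum fun k _ => ?_
    have := abs_sub_le (D.x i (ω (k + 1)) - D.x i (ω k)) (h * c n i (k * h, ω k))
      (h * c j i (k * h, ω k))
    rwa [← mul_sub, abs_mul, abs_of_nonneg hhpos] at this
  rw [integral_add] at e3
  · linarith
  · exact hint (continuous_finsetSum (Finset.range N) fun k _ => hΔc k n i)
  · exact hint (continuous_finsetSum (Finset.range N) fun k _ =>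
      continuous_const.mul ((hcω k n i).sub (hcω k j i)).abs)

end ContinuityEquation

theorem abs_sub_sub_le_sum_Ico {y u : ℕ → ℝ} {h δ v : ℝ} (hh : 0 ≤ h) {m n : ℕ} (hmn : m ≤ n)
    (hu : ∀ k ∈ Finset.Ico m n, |u k - v| ≤ δ) :
    |y n - y m - h * (n - m) * v| ≤
      ∑ k ∈ Finset.Ico m n, (|y (k + 1) - y k - h * u k| + h * δ) := by
  induction n, hmn using Nat.le_induction with
  | base => simp
  | succ n hmn ih =>
    rw [Finset.sum_Ico_succ_top hmn]
    have h1 := ih fun k hk => hu k (Finset.mem_Ico.2 ⟨(Finset.mem_Ico.1 hk).1,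
      (Finset.mem_Ico.1 hk).2.trans n.lt_succ_self⟩)
    have h2 := mul_le_mul_of_nonneg_left (hu n (Finset.mem_Ico.2 ⟨hmn, n.lt_succ_self⟩)) hh
    have h3 : y (n + 1) - y m - h * ((n + 1 : ℕ) - m) * v =
        (y n - y m - h * (n - m) * v) + ((y (n + 1) - y n - h * u n) + h * (u n - v)) := by
      push_cast; ring
    rw [h3]
    refine (abs_add_le _ _).trans (add_le_add h1 ((abs_add_le _ _).trans ?_))
    rw [abs_mul, abs_of_nonneg hh]
    linarith

theorem abs_sub_sub_sum_le {y u v : ℕ → ℝ} {h δ : ℝ} (hh : 0 ≤ h) {κ : ℕ → ℕ}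
    (hκ : Monotone κ) {L : ℕ} (hu : ∀ r < L, ∀ k ∈ Finset.Ico (κ r) (κ (r + 1)), |u k - v r| ≤ δ) :
    |y (κ L) - y (κ 0) - ∑ r ∈ Finset.range L, h * (κ (r + 1) - κ r) * v r| ≤
      ∑ k ∈ Finset.Ico (κ 0) (κ L), (|y (k + 1) - y k - h * u k| + h * δ) := by
  induction L with
  | zero => simp
  | succ L ih =>
    rw [Finset.sum_range_succ, ← Finset.sum_Ico_consecutive _ (hκ L.zero_le) (hκ L.le_succ)]
    have h1 := ih fun r hr => hu r (hr.trans L.lt_succ_self)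
    have h2 := abs_sub_sub_le_sum_Ico (y := y) hh (hκ L.le_succ) (hu L L.lt_succ_self)
    have h3 : ∀ S : ℝ, y (κ (L + 1)) - y (κ 0) - (S + h * (κ (L + 1) - κ L) * v L) =
      (y (κ L) - y (κ 0) - S) + (y (κ (L + 1)) - y (κ L) - h * (κ (L + 1) - κ L) * v L) :=
      fun S => by ring
    rw [h3]
    exact (abs_add_le _ _).trans (add_le_add h1 h2)

/-- Index of the last point `k h`, `k ≤ N`, of the grid not exceeding `q`. -/
def gridIndex (h : ℝ) (N : ℕ) (q : ℝ) : ℕ := min ⌊q / h⌋₊ N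

theorem gridIndex_le (h : ℝ) (N : ℕ) (q : ℝ) : gridIndex h N q ≤ N := min_le_right _ _

theorem gridIndex_zero (h : ℝ) (N : ℕ) : gridIndex h N 0 = 0 := by simp [gridIndex]

theorem gridIndex_mono {h : ℝ} (hh : 0 < h) (N : ℕ) : Monotone (gridIndex h N) := fun _ _ hpq =>
  min_le_min_right _ (Nat.floor_mono (div_le_div_of_nonneg_right hpq hh.le))

theorem gridIndex_mul_le {h : ℝ} (hh : 0 < h) (N : ℕ) {q : ℝ} (hq : 0 ≤ q) :
    gridIndex h N q * h ≤ q := by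
  rw [← le_div_iff₀ hh]
  exact (Nat.cast_le.2 (min_le_left _ _)).trans (Nat.floor_le (by positivity))

theorem le_gridIndex_mul {h : ℝ} (hh : 0 < h) {N : ℕ} {q : ℝ} (hqN : q ≤ N * h) :
    q ≤ gridIndex h N q * h + h := by
  have h1 : q / h ≤ N := by rwa [div_le_iff₀ hh]
  have h2 : gridIndex h N q = ⌊q / h⌋₊ := by
    refine min_eq_left ?_
    have := Nat.floor_mono h1
    rwa [Nat.floor_natCast] at this
  have h3 := (Nat.lt_floor_add_one (q / h)).le
  rw [div_le_iff₀ hh] at h3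
  rw [h2]; linarith

theorem gridIndex_sub_le {h : ℝ} (hh : 0 < h) (N : ℕ) {p q : ℝ} (hpq : p ≤ q) :
    h * (gridIndex h N q - gridIndex h N p) ≤ q - p + h := by
  by_cases hp : N ≤ ⌊p / h⌋₊
  · have h1 : gridIndex h N p = N := min_eq_right hp
    have h2 : gridIndex h N q = N :=
      le_antisymm (gridIndex_le _ _ _) (h1.symm.le.trans (gridIndex_mono hh N hpq))
    rw [h1, h2]; simp; linarith
  · rw [not_le] at hp
    have h1 : p ≤ gridIndex h N p * h + h := by
      refine le_gridIndex_mul hh ?_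
      rw [← div_le_iff₀ hh]
      have h4 := (Nat.lt_floor_add_one (p / h)).le
      have h5 : ((⌊p / h⌋₊ + 1 : ℕ) : ℝ) ≤ N := by exact_mod_cast hp
      push_cast at h5
      linarith
    rcases le_total 0 q with hq | hq
    · have := gridIndex_mul_le hh N hq
      nlinarith
    · have h6 : gridIndex h N q = 0 :=
        Nat.le_zero.1 (gridIndex_zero h N ▸ gridIndex_mono hh N hq)
      rw [h6]
      have : 0 ≤ h * (gridIndex h N p : ℝ) := by positivity
      simp only [Nat.cast_zero, zero_sub]
      nlinarith

/-- Sequences of probability measures on a compact space have limit points. -/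
theorem exists_limit_probabilityMeasure {Ω : Type*} [TopologicalSpace Ω] [CompactSpace Ω]
    [T2Space Ω] [MeasurableSpace Ω] [BorelSpace Ω] (η : ℕ → Measure Ω)
    [∀ n, IsProbabilityMeasure (η n)] :
    ∃ (U : Ultrafilter ℕ) (P : Measure Ω), (U : Filter ℕ) ≤ atTop ∧ IsProbabilityMeasure P ∧
      ∀ f : C(Ω, ℝ), Tendsto (fun n => ∫ ω, f ω ∂(η n)) U (𝓝 (∫ ω, f ω ∂P)) := by
  let U := hyperfilter ℕ
  let e : ℕ → ProbabilityMeasure Ω := fun n => ⟨η n, inferInstance⟩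
  have hU := (U.map e).le_nhds_lim
  refine ⟨U, (U.map e).lim, Nat.hyperfilter_le_atTop, inferInstance, fun f => ?_⟩
  have h1 : Tendsto e U (𝓝 (U.map e).lim) := hU
  exact (ProbabilityMeasure.tendsto_iff_forall_integral_tendsto.1 h1)
    (BoundedContinuousFunction.mkOfCompact f)

namespace ContinuityEquation

variable {K : Type*} [TopologicalSpace K] [CompactSpace K] [PolishSpace K]
    [MeasurableSpace K] [BorelSpace K] (D : ContinuityEquation K)

/-- The total deviation of a discrete path from following the vector field `c` in the `i`-th
coordinate. -/
def defect (N : ℕ) (c : ℝ × K → ℝ) (i : ℕ) (ω : ℕ → K) : ℝ :=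
  ∑ k ∈ Finset.range N, |D.x i (ω (k + 1)) - D.x i (ω k) - D.T / N * c (k * (D.T / N), ω k)|

/-- A bound for `c` on `[0,T] × K`. -/
def IsBound (c : ℝ × K → ℝ) (M : ℝ) : Prop := 0 ≤ M ∧ ∀ t ∈ Set.Icc 0 D.T, ∀ μ, |c (t, μ)| ≤ M

variable {D} in
theorem grid_mem {N k : ℕ} (hk : k ≤ N) : (k : ℝ) * (D.T / N) ∈ Set.Icc 0 D.T := by
  have hT := D.T_pos.le
  rcases N.eq_zero_or_pos with rfl | hN
  · simpa using hT
  refine ⟨by positivity, ?_⟩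
  have hN : (0 : ℝ) < N := by exact_mod_cast hN
  have : (k : ℝ) ≤ N := by exact_mod_cast hk
  calc (k : ℝ) * (D.T / N) ≤ N * (D.T / N) := by gcongr
    _ = D.T := by field_simp

theorem abs_sub_le_defect_index {N : ℕ} {c : ℝ × K → ℝ} {M : ℝ} (hM : D.IsBound c M) (i : ℕ)
    (ω : ℕ → K) {k k' : ℕ} (hkk' : k ≤ k') (hk' : k' ≤ N) :
    |D.x i (ω k') - D.x i (ω k)| ≤ D.defect N c i ω + M * (D.T / N * (k' - k)) := by
  have hh : 0 ≤ D.T / N := div_nonneg D.T_pos.le (Nat.cast_nonneg _)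
  have h1 := abs_sub_sub_le_sum_Ico (y := fun k => D.x i (ω k))
    (u := fun k => c (k * (D.T / N), ω k)) (v := 0) (δ := M) hh hkk' fun l hl => by
      rw [sub_zero]
      exact hM.2 _ (grid_mem ((Finset.mem_Ico.1 hl).2.le.trans hk')) _
  rw [mul_zero, sub_zero, Finset.sum_add_distrib, Finset.sum_const, Nat.card_Ico, nsmul_eq_mul,
    Nat.cast_sub hkk'] at h1
  refine h1.trans (add_le_add ?_ (le_of_eq (by ring)))
  refine Finset.sum_le_sum_of_subset_of_nonneg ?_ fun _ _ _ => abs_nonneg _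
  intro l hl
  exact Finset.mem_range.2 ((Finset.mem_Ico.1 hl).2.trans_le hk')

theorem abs_sub_le_defect {N : ℕ} (hN : 0 < N) {c : ℝ × K → ℝ} {M : ℝ} (hM : D.IsBound c M)
    (i : ℕ) (ω : ℕ → K) (p q : ℝ) :
    |D.x i (ω (gridIndex (D.T / N) N q)) - D.x i (ω (gridIndex (D.T / N) N p))| ≤
      D.defect N c i ω + M * (|q - p| + D.T / N) := by
  have hh : 0 < D.T / N := div_pos D.T_pos (by exact_mod_cast hN)
  wlog hpq : p ≤ q generalizing p q
  · rw [abs_sub_comm, abs_sub_comm q]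
    exact this q p (le_of_not_ge hpq)
  refine (D.abs_sub_le_defect_index hM i ω (gridIndex_mono hh N hpq) (gridIndex_le _ _ _)).trans ?_
  rw [abs_of_nonneg (by linarith)]
  exact add_le_add le_rfl (mul_le_mul_of_nonneg_left (gridIndex_sub_le hh N hpq) hM.1)

/-- A discrete path with small defect approximately solves the integral equation. -/
theorem abs_sub_sum_le_defect {N : ℕ} (hN : 0 < N) {c : ℝ × K → ℝ} {M : ℝ} (hM : D.IsBound c M)
    {A : ℝ} {m : ℕ} (hA : 0 ≤ A)
    (hc : ∀ t ∈ Set.Icc 0 D.T, ∀ t' ∈ Set.Icc 0 D.T, ∀ μ μ', |c (t, μ) - c (t', μ')| ≤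
      A * (|t - t'| + ∑ k ∈ Finset.range m, |D.x k μ - D.x k μ'|))
    {c' : ℕ → ℝ × K → ℝ} {M' : ℕ → ℝ} (hM' : ∀ a, D.IsBound (c' a) (M' a)) (i : ℕ) (ω : ℕ → K)
    {q : ℝ} (hq : q ∈ Set.Icc 0 D.T) {L : ℕ} (hL : 0 < L) :
    |D.x i (ω (gridIndex (D.T / N) N q)) - D.x i (ω (gridIndex (D.T / N) N 0)) -
      q / L * ∑ r ∈ Finset.range L, c (q * r / L, ω (gridIndex (D.T / N) N (q * r / L)))| ≤
    D.defect N c i ω + D.T * (A * (q / L + D.T / N + ∑ a ∈ Finset.range m,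
      (D.defect N (c' a) a ω + M' a * (q / L + D.T / N)))) + L * (D.T / N) * M := by
  have hN' : (0 : ℝ) < N := by exact_mod_cast hN
  have hL' : (0 : ℝ) < L := by exact_mod_cast hL
  set h := D.T / N with hh
  have hh0 : 0 < h := div_pos D.T_pos hN'
  have hNh : N * h = D.T := by rw [hh]; field_simp
  have hq0 := hq.1
  set τ := q / L with hτ
  have hτ0 : 0 ≤ τ := by positivity
  have hs : ∀ r : ℕ, q * r / L = r * τ := fun r => by rw [hτ]; ring
  simp only [hs]
  have hqL : q = L * τ := by rw [hτ]; field_simp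
  have hsm : ∀ r : ℕ, r ≤ L → (r : ℝ) * τ ∈ Set.Icc 0 D.T := fun r hr =>
    ⟨by positivity, (hqL ▸ mul_le_mul_of_nonneg_right (Nat.cast_le.2 hr) hτ0).trans hq.2⟩
  set κ : ℕ → ℕ := fun r => gridIndex h N (r * τ) with hκ
  have hκm : Monotone κ := fun r r' hrr' => gridIndex_mono hh0 N
    (mul_le_mul_of_nonneg_right (Nat.cast_le.2 hrr') hτ0)
  have hκN : ∀ r, κ r ≤ N := fun r => gridIndex_le _ _ _
  have hκ1 : ∀ r, κ r * h ≤ r * τ := fun r => gridIndex_mul_le hh0 N (by positivity)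
  have hκ2 : ∀ r ≤ L, r * τ ≤ κ r * h + h := fun r hr =>
    le_gridIndex_mul hh0 (hNh ▸ (hsm r hr).2)
  have e1 : gridIndex h N q = κ L := by rw [hqL]
  have e2 : gridIndex h N 0 = κ 0 := by simp [hκ]
  rw [e1, e2]
  set δ := A * (τ + h + ∑ a ∈ Finset.range m, (D.defect N (c' a) a ω + M' a * (τ + h))) with hδ
  have hδ0 : 0 ≤ δ := by
    refine mul_nonneg hA (add_nonneg (by positivity) (Finset.sum_nonneg fun a _ => ?_))
    exact add_nonneg (Finset.sum_nonneg fun _ _ => abs_nonneg _)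
      (mul_nonneg (hM' a).1 (by positivity))
  have hu : ∀ r < L, ∀ k ∈ Finset.Ico (κ r) (κ (r + 1)),
      |c (k * h, ω k) - c (r * τ, ω (κ r))| ≤ δ := by
    intro r hr k hk
    obtain ⟨hk1, hk2⟩ := Finset.mem_Ico.1 hk
    have hkN : k ≤ N := hk2.le.trans (hκN _)
    refine (hc _ (grid_mem hkN) _ (hsm r hr.le) _ _).trans (mul_le_mul_of_nonneg_left ?_ hA)
    have h1 : (κ r : ℝ) * h ≤ k * h := mul_le_mul_of_nonneg_right (Nat.cast_le.2 hk1) hh0.le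
    have h2 : (k : ℝ) * h ≤ κ (r + 1) * h :=
      mul_le_mul_of_nonneg_right (Nat.cast_le.2 hk2.le) hh0.le
    have h3 := hκ1 (r + 1)
    have h4 := hκ2 r hr.le
    push_cast at h3
    refine add_le_add ?_ (Finset.sum_le_sum fun a _ => ?_)
    · rw [abs_le]; constructor <;> linarith
    · refine (D.abs_sub_le_defect_index (hM' a) a ω hk1 hkN).trans ?_
      refine add_le_add le_rfl (mul_le_mul_of_nonneg_left ?_ (hM' a).1)
      rw [← hh]
      linarith
  have h1 := abs_sub_sub_sum_le (y := fun k => D.x i (ω k)) hh0.le hκm hu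
  have h2 : ∑ k ∈ Finset.Ico (κ 0) (κ L), (|D.x i (ω (k + 1)) - D.x i (ω k) -
      h * c (k * h, ω k)| + h * δ) ≤ D.defect N c i ω + D.T * δ := by
    calc _ ≤ ∑ k ∈ Finset.range N, (|D.x i (ω (k + 1)) - D.x i (ω k) -
          h * c (k * h, ω k)| + h * δ) := by
          refine Finset.sum_le_sum_of_subset_of_nonneg (fun l hl => ?_) fun _ _ _ => by positivity
          exact Finset.mem_range.2 ((Finset.mem_Ico.1 hl).2.trans_le (hκN L))
      _ = _ := by
          rw [Finset.sum_add_distrib, Finset.sum_const, Finset.card_range, nsmul_eq_mul,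
            ← mul_assoc, hNh]
          rfl
  have h3 : |∑ r ∈ Finset.range L, h * (κ (r + 1) - κ r) * c (r * τ, ω (κ r)) -
      τ * ∑ r ∈ Finset.range L, c (r * τ, ω (κ r))| ≤ L * h * M := by
    rw [Finset.mul_sum, ← Finset.sum_sub_distrib]
    refine (Finset.abs_sum_le_sum_abs _ _).trans ?_
    calc _ ≤ ∑ _r ∈ Finset.range L, h * M := by
          refine Finset.sum_le_sum fun r hr => ?_
          have hr := Finset.mem_range.1 hr
          rw [← sub_mul, abs_mul]
          refine mul_le_mul ?_ (hM.2 _ (hsm r hr.le) _) (abs_nonneg _) hh0.le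
          have h3 := hκ1 (r + 1)
          have h4 := hκ2 r hr.le
          have h5 := hκ1 r
          have h6 := hκ2 (r + 1) hr
          push_cast at h3 h6
          rw [abs_le]; constructor <;> linarith
      _ = _ := by simp; ring
  have h4 := abs_sub_le (D.x i (ω (κ L)) - D.x i (ω (κ 0)))
    (∑ r ∈ Finset.range L, h * (κ (r + 1) - κ r) * c (r * τ, ω (κ r)))
    (τ * ∑ r ∈ Finset.range L, c (r * τ, ω (κ r)))
  exact h4.trans (add_le_add (h1.trans h2) h3)

end ContinuityEquation

namespace ContinuityEquation

variable {K : Type*} [TopologicalSpace K] [CompactSpace K] [PolishSpace K]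
    [MeasurableSpace K] [BorelSpace K] (D : ContinuityEquation K)

/-- The `L¹` distance between the `i`-th component of the vector field and `c`. -/
def err (c : ℝ × K → ℝ) (i : ℕ) : ℝ := ∫ p, |D.β i p - c p| ∂D.Λ

/-- A limit process indexed by rational times. -/
theorem exists_limit_process {c : ℕ → ℕ → ℝ × K → ℝ} (hc : ∀ j i, D.IsCyl (c j i))
    (he : ∀ j i, D.err (c j i) i ≤ 1 / ((j : ℝ) + 1) ^ 2) {M : ℕ → ℕ → ℝ}
    (hM : ∀ j i, D.IsBound (c j i) (M j i)) :
    ∃ η : Measure (ℚ → K), IsProbabilityMeasure η ∧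
      (∀ q : ℚ, (q : ℝ) ∈ Set.Icc 0 D.T → η.map (fun ω => ω q) = D.Γ q) ∧
      (∀ (j i : ℕ) (F : Finset (ℚ × ℚ)), ∫ ω, ((F.sup fun p => Real.toNNReal
        (|D.x i (ω p.2) - D.x i (ω p.1)| - M j i * |(p.2 : ℝ) - p.1|) : NNReal) : ℝ) ∂η ≤
        D.err (c j i) i) ∧
      ∀ (l i j : ℕ) (q : ℚ), (q : ℝ) ∈ Set.Icc 0 D.T → ∀ (A : ℝ) (m : ℕ), 0 ≤ A →
        (∀ t ∈ Set.Icc 0 D.T, ∀ t' ∈ Set.Icc 0 D.T, ∀ μ μ', |c l i (t, μ) - c l i (t', μ')| ≤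
          A * (|t - t'| + ∑ k ∈ Finset.range m, |D.x k μ - D.x k μ'|)) → ∀ L : ℕ, 0 < L →
        ∫ ω, |D.x i (ω q) - D.x i (ω 0) -
          (q : ℝ) / L * ∑ r ∈ Finset.range L, c l i (q * r / L, ω (q * r / L))| ∂η ≤
        D.err (c l i) i + D.T * (A * ((q : ℝ) / L + ∑ a ∈ Finset.range m,
          (D.err (c j a) a + M j a * ((q : ℝ) / L)))) := by
  choose N hN ρ hρP hρ1 hρ2 using D.exists_discrete_approximation hc he
  have hN0 : ∀ n, 0 < N n := fun n => (Nat.succ_pos n).trans_le (hN n)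
  let S : ∀ n : ℕ, (ℕ → K) → ℚ → K := fun n ω q => ω (gridIndex (D.T / N n) (N n) q)
  have hSc : ∀ n, Continuous (S n) := fun n => continuous_pi fun q => continuous_apply _
  have hint : ∀ n {g : (ℕ → K) → ℝ}, Continuous g → Integrable g (ρ n) := fun n _ hg =>
    ContinuousMap.integrable_of_compactSpace (ρ n) ⟨_, hg⟩
  let η : ℕ → Measure (ℚ → K) := fun n => (ρ n).map (S n)
  have : ∀ n, IsProbabilityMeasure (η n) := fun n =>
    Measure.isProbabilityMeasure_map (hSc n).measurable.aemeasurable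
  obtain ⟨U, P, hU, hP, hlim⟩ := exists_limit_probabilityMeasure η
  have hlim' : ∀ f : C(ℚ → K, ℝ), Tendsto (fun n => ∫ ω, f (S n ω) ∂(ρ n)) U
      (𝓝 (∫ ω, f ω ∂P)) := fun f => (hlim f).congr fun n =>
    integral_map (hSc n).measurable.aemeasurable f.continuous.aestronglyMeasurable
  have hle : ∀ (f : (ℚ → K) → ℝ), Continuous f → ∀ (b : ℕ → ℝ) (B : ℝ),
      Tendsto b atTop (𝓝 B) → (∀ᶠ n in atTop, ∫ ω, f (S n ω) ∂(ρ n) ≤ b n) →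
      ∫ ω, f ω ∂P ≤ B := fun f hf b B hb hfb =>
    le_of_tendsto_of_tendsto (hlim' ⟨f, hf⟩) (hb.mono_left hU) (hU hfb)
  have hxc : ∀ i (q : ℚ), Continuous fun ω : ℚ → K => D.x i (ω q) := fun i q =>
    (D.x i).continuous.comp (continuous_apply q)
  have hcc : ∀ j i, Continuous (c j i) := fun j i => (hc j i).continuous
  have hdc : ∀ n j i, Continuous (D.defect (N n) (c j i) i) := fun n j i =>
    continuous_finsetSum _ fun k _ => ((((D.x i).continuous.comp (continuous_apply (k + 1))).sub
      ((D.x i).continuous.comp (continuous_apply k))).sub (continuous_const.mul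
        ((hcc j i).comp (continuous_const.prodMk (continuous_apply k))))).abs
  have hdi : ∀ j i, ∀ᶠ n : ℕ in atTop, ∫ ω, D.defect (N n) (c j i) i ω ∂(ρ n) ≤
      D.err (c j i) i + 4 / ((n : ℝ) + 1) := fun j i => by
    filter_upwards [eventually_gt_atTop i, eventually_ge_atTop j] with n hi hj
    exact hρ2 n i hi j hj
  have hh : Tendsto (fun n : ℕ => D.T / N n) atTop (𝓝 0) := by
    refine squeeze_zero (fun n => div_nonneg D.T_pos.le (Nat.cast_nonneg _)) (fun n => ?_)
      (tendsto_const_div_atTop_nhds_zero_nat D.T |>.comp (tendsto_add_atTop_nat 1))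
    exact div_le_div_of_nonneg_left D.T_pos.le (by positivity) (by exact_mod_cast hN n)
  have h4 : Tendsto (fun n : ℕ => 4 / ((n : ℝ) + 1)) atTop (𝓝 0) := by
    exact ((tendsto_const_div_atTop_nhds_zero_nat (4 : ℝ)).comp (tendsto_add_atTop_nat 1)).congr
      fun n => by simp
  refine ⟨P, hP, fun q hq => ?_, fun j i F => ?_, fun l i j q hq A m hA hcA L hL => ?_⟩
  · have := Measure.isProbabilityMeasure_map (μ := P) (measurable_pi_apply q).aemeasurable
    refine measure_ext_of_integral_continuousMap fun f => ?_
    rw [integral_map (measurable_pi_apply q).aemeasurable f.continuous.aestronglyMeasurable]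
    have h1 := hlim' ⟨fun ω => f (ω q), by fun_prop⟩
    have h2 : ∀ n, ∫ ω, f (S n ω q) ∂(ρ n) =
        ∫ μ, f μ ∂(D.Γ (gridIndex (D.T / N n) (N n) q * (D.T / N n))) := fun n => by
      rw [← hρ1 n _ (gridIndex_le _ _ _), integral_map (measurable_pi_apply _).aemeasurable
        f.continuous.aestronglyMeasurable]
    simp only [ContinuousMap.coe_mk, h2] at h1
    refine tendsto_nhds_unique h1 (Tendsto.mono_left ?_ hU)
    refine ((D.continuous_Γ f).tendsto q).comp ?_
    refine tendsto_of_tendsto_of_tendsto_of_le_of_le (g := fun n => (q : ℝ) - D.T / N n)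
      (h := fun _ => (q : ℝ)) ?_ tendsto_const_nhds (fun n => ?_) (fun n => ?_)
    · simpa using (tendsto_const_nhds (x := (q : ℝ))).sub hh
    · have hN' : (0 : ℝ) < N n := by exact_mod_cast hN0 n
      have := le_gridIndex_mul (N := N n) (q := q) (div_pos D.T_pos hN')
        (by rw [mul_div_cancel₀ _ hN'.ne']; exact hq.2)
      simp only
      linarith
    · exact gridIndex_mul_le (div_pos D.T_pos (by exact_mod_cast hN0 n)) _ hq.1
  · refine hle _ ?_ (fun n => D.err (c j i) i + 4 / ((n : ℝ) + 1) + M j i * (D.T / N n)) _ ?_ ?_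
    · refine NNReal.continuous_coe.comp (Continuous.finset_sup_apply fun p _ => ?_)
      exact continuous_real_toNNReal.comp ((((hxc i p.2).sub (hxc i p.1)).abs).sub continuous_const)
    · simpa using (tendsto_const_nhds.add h4).add (hh.const_mul (M j i))
    · filter_upwards [hdi j i] with n hn
      have hi : Integrable (fun ω => D.defect (N n) (c j i) i ω + M j i * (D.T / N n)) (ρ n) :=
        hint n ((hdc n j i).add continuous_const)
      have : ∫ ω, (D.defect (N n) (c j i) i ω + M j i * (D.T / N n)) ∂(ρ n) ≤
          D.err (c j i) i + 4 / ((n : ℝ) + 1) + M j i * (D.T / N n) := by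
        have := hρP n
        rw [integral_add (hint n (hdc n j i)) (integrable_const _)]
        simpa using hn
      refine le_trans (integral_mono_of_nonneg (ae_of_all _ fun ω => NNReal.coe_nonneg _) hi
        (ae_of_all _ fun ω => ?_)) this
      have hd0 : 0 ≤ D.defect (N n) (c j i) i ω + M j i * (D.T / N n) :=
        add_nonneg (Finset.sum_nonneg fun _ _ => abs_nonneg _)
          (mul_nonneg (hM j i).1 (div_nonneg D.T_pos.le (Nat.cast_nonneg _)))
      have hs : (F.sup fun p => Real.toNNReal (|D.x i (S n ω p.2) - D.x i (S n ω p.1)| -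
          M j i * |(p.2 : ℝ) - p.1|)) ≤ (⟨_, hd0⟩ : NNReal) := by
        refine Finset.sup_le fun p _ => ?_
        refine Real.toNNReal_le_iff_le_coe.2 ?_
        change _ ≤ D.defect (N n) (c j i) i ω + M j i * (D.T / N n)
        have := D.abs_sub_le_defect (hN0 n) (hM j i) i ω p.1 p.2
        simp only [S]
        linarith
      exact hs
  · refine hle _ ?_ (fun n => D.err (c l i) i + 4 / ((n : ℝ) + 1) +
      D.T * (A * ((q : ℝ) / L + D.T / N n + ∑ a ∈ Finset.range m,
        (D.err (c j a) a + 4 / ((n : ℝ) + 1) + M j a * ((q : ℝ) / L + D.T / N n)))) +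
        L * (D.T / N n) * M l i) _ ?_ ?_
    · refine (((hxc i q).sub (hxc i 0)).sub (continuous_const.mul ?_)).abs
      exact continuous_finsetSum _ fun r _ =>
        (hcc l i).comp (continuous_const.prodMk (continuous_apply _))
    · have e1 := tendsto_finsetSum (Finset.range m) fun a _ =>
        ((tendsto_const_nhds (x := D.err (c j a) a)).add h4).add
          (((tendsto_const_nhds (x := (q : ℝ) / L)).add hh).const_mul (M j a))
      have e2 := (((((tendsto_const_nhds (x := (q : ℝ) / L)).add hh).add e1).const_mul A).const_mul
        D.T)
      have e3 := (((tendsto_const_nhds (x := D.err (c l i) i)).add h4).add e2).add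
        ((hh.const_mul (L : ℝ)).mul_const (M l i))
      simpa using e3
    · have hev : ∀ᶠ n : ℕ in atTop, ∀ a ∈ Finset.range m,
          ∫ ω, D.defect (N n) (c j a) a ω ∂(ρ n) ≤ D.err (c j a) a + 4 / ((n : ℝ) + 1) := by
        rw [Filter.eventually_all_finset]
        exact fun a _ => hdi j a
      filter_upwards [hdi l i, hev] with n hn hn'
      have := hρP n
      have hpt := fun ω => D.abs_sub_sum_le_defect (hN0 n) (hM l i) hA hcA (hM j) i ω hq hL
      have hsc : ∀ a, Continuous fun ω => D.defect (N n) (c j a) a ω +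
          M j a * ((q : ℝ) / L + D.T / N n) := fun a => (hdc n j a).add continuous_const
      have hs : Continuous fun ω => ∑ a ∈ Finset.range m, (D.defect (N n) (c j a) a ω +
          M j a * ((q : ℝ) / L + D.T / N n)) := continuous_finsetSum _ fun a _ => hsc a
      have hs' : Continuous fun ω => D.T * (A * ((q : ℝ) / L + D.T / N n + ∑ a ∈ Finset.range m,
          (D.defect (N n) (c j a) a ω + M j a * ((q : ℝ) / L + D.T / N n)))) :=
        continuous_const.mul (continuous_const.mul (continuous_const.add hs))
      have hi1 : Integrable (fun ω => D.defect (N n) (c l i) i ω +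
          D.T * (A * ((q : ℝ) / L + D.T / N n + ∑ a ∈ Finset.range m,
          (D.defect (N n) (c j a) a ω + M j a * ((q : ℝ) / L + D.T / N n))))) (ρ n) :=
        hint n ((hdc n l i).add hs')
      have hi2 : Integrable (fun ω => D.defect (N n) (c l i) i ω +
          D.T * (A * ((q : ℝ) / L + D.T / N n + ∑ a ∈ Finset.range m,
          (D.defect (N n) (c j a) a ω + M j a * ((q : ℝ) / L + D.T / N n)))) +
          L * (D.T / N n) * M l i) (ρ n) := hi1.add (integrable_const _)
      have e : ∀ a, ∫ ω, (D.defect (N n) (c j a) a ω + M j a * ((q : ℝ) / L + D.T / N n)) ∂(ρ n) =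
          ∫ ω, D.defect (N n) (c j a) a ω ∂(ρ n) + M j a * ((q : ℝ) / L + D.T / N n) := fun a => by
        rw [integral_add (hint n (hdc n j a)) (integrable_const _)]
        simp
      have hI : ∫ ω, (D.defect (N n) (c l i) i ω +
          D.T * (A * ((q : ℝ) / L + D.T / N n + ∑ a ∈ Finset.range m,
          (D.defect (N n) (c j a) a ω + M j a * ((q : ℝ) / L + D.T / N n)))) +
          L * (D.T / N n) * M l i) ∂(ρ n) =
          ∫ ω, D.defect (N n) (c l i) i ω ∂(ρ n) +
          D.T * (A * ((q : ℝ) / L + D.T / N n + ∑ a ∈ Finset.range m,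
          (∫ ω, D.defect (N n) (c j a) a ω ∂(ρ n) + M j a * ((q : ℝ) / L + D.T / N n)))) +
          L * (D.T / N n) * M l i := by
        rw [integral_add hi1 (integrable_const _), integral_add (hint n (hdc n l i)) (hint n hs'),
          integral_const_mul, integral_const_mul,
          integral_add (integrable_const _) (hint n hs),
          integral_finsetSum _ fun a _ => hint n (hsc a)]
        simp [e]
      refine le_trans (integral_mono_of_nonneg (ae_of_all _ fun ω => abs_nonneg _) hi2
        (ae_of_all _ fun ω => ?_)) (hI.le.trans ?_)
      · simp only [S]
        push_cast
        simpa using hpt ω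
      · have hT := D.T_pos.le
        gcongr with a ha
        exact hn' a ha

end ContinuityEquation

/-- A path over the rationals in a compact space whose coordinates are uniformly continuous
extends to a continuous path over the reals. -/
theorem exists_continuous_extension {K : Type*} [TopologicalSpace K] [CompactSpace K]
    (x : ℕ → C(K, ℝ)) (hx : ∀ μ ν, (∀ i, x i μ = x i ν) → μ = ν) (ω : ℚ → K)
    (hω : ∀ i, UniformContinuous fun q => x i (ω q)) :
    ∃ Y : ℝ → K, Continuous Y ∧ ∀ q : ℚ, Y q = ω q := by
  let e : K → ℕ → ℝ := fun μ i => x i μ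
  have hec : Continuous e := continuous_pi fun i => (x i).continuous
  have hei : Function.Injective e := fun μ ν h => hx μ ν fun i => congrFun h i
  have hemb := hec.isClosedEmbedding hei
  have huc : UniformContinuous (e ∘ ω) := uniformContinuous_pi.2 hω
  have hd : DenseRange ((↑) : ℚ → ℝ) := Rat.denseRange_cast
  have hu : IsUniformInducing ((↑) : ℚ → ℝ) := Rat.isUniformEmbedding_coe_real.isUniformInducing
  let Z : ℝ → ℕ → ℝ := (hu.isDenseInducing hd).extend (e ∘ ω)
  have hZ : UniformContinuous Z := uniformContinuous_uniformly_extend hu hd huc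
  have hZq : ∀ q : ℚ, Z q = e (ω q) := fun q => uniformly_extend_of_ind hu hd huc q
  have hmem : ∀ t, Z t ∈ Set.range e := fun t =>
    hd.induction_on (p := fun t => Z t ∈ Set.range e) t
      (hemb.isClosed_range.preimage hZ.continuous) fun q => ⟨ω q, (hZq q).symm⟩
  choose Y hY using hmem
  refine ⟨Y, hemb.isEmbedding.continuous_iff.2 ?_, fun q => hei ((hY q).trans (hZq q))⟩
  exact hZ.continuous.congr fun t => (hY t).symm

theorem uniformContinuous_of_abs_sub_le {f : ℚ → ℝ} {M : ℕ → ℝ}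
    (h : ∀ ε : ℝ, 0 < ε → ∃ j, ∀ p q : ℚ, |f q - f p| ≤ ε + M j * |(q : ℝ) - p|) :
    UniformContinuous f := by
  refine Metric.uniformContinuous_iff.2 fun ε hε => ?_
  obtain ⟨j, hj⟩ := h (ε / 2) (half_pos hε)
  refine ⟨ε / 2 / (|M j| + 1), by positivity, fun {p q} hpq => ?_⟩
  rw [Rat.dist_eq, lt_div_iff₀ (by positivity)] at hpq
  have h1 := hj q p
  have h2 : M j * |(p : ℝ) - q| ≤ |M j| * |(p : ℝ) - q| :=
    mul_le_mul_of_nonneg_right (le_abs_self _) (abs_nonneg _)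
  rw [Real.dist_eq]
  nlinarith [abs_nonneg ((p : ℝ) - q)]

theorem Icc_subset_closure_ratCast {T : ℝ} (hT : 0 < T) :
    Set.Icc 0 T ⊆ closure (Set.Ioo 0 T ∩ Set.range ((↑) : ℚ → ℝ)) := by
  rw [← closure_Ioo hT.ne]
  exact closure_minimal (Rat.denseRange_cast.open_subset_closure_inter isOpen_Ioo) isClosed_closure

namespace ContinuityEquation

variable {K : Type*} [TopologicalSpace K] [CompactSpace K] [PolishSpace K]
    [MeasurableSpace K] [BorelSpace K] (D : ContinuityEquation K)

theorem ae_uniformContinuous {η : Measure (ℚ → K)} [IsProbabilityMeasure η] {M r : ℕ → ℝ}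
    (hr : Tendsto r atTop (𝓝 0)) {i : ℕ}
    (h : ∀ (j : ℕ) (F : Finset (ℚ × ℚ)), ∫ ω, ((F.sup fun p => Real.toNNReal
        (|D.x i (ω p.2) - D.x i (ω p.1)| - M j * |(p.2 : ℝ) - p.1|) : NNReal) : ℝ) ∂η ≤ r j) :
    ∀ᵐ ω ∂η, UniformContinuous fun q => D.x i (ω q) := by
  let R : ℕ → Finset (ℚ × ℚ) → (ℚ → K) → NNReal := fun j F ω => F.sup fun p => Real.toNNReal
        (|D.x i (ω p.2) - D.x i (ω p.1)| - M j * |(p.2 : ℝ) - p.1|)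
  have hRc : ∀ j F, Continuous (R j F) := fun j F => by
    refine Continuous.finset_sup_apply fun p _ => ?_
    have hxc : ∀ q : ℚ, Continuous fun ω : ℚ → K => D.x i (ω q) :=
      fun q => (D.x i).continuous.comp (continuous_apply q)
    exact continuous_real_toNNReal.comp (((hxc _).sub (hxc _)).abs.sub continuous_const)
  have hRm : ∀ j F, Measurable fun ω => (R j F ω : ENNReal) := fun j F =>
    (hRc j F).measurable.coe_nnreal_ennreal
  have hsup : ∀ j, ∫⁻ ω, ⨆ F, (R j F ω : ENNReal) ∂η ≤ ENNReal.ofReal (r j) := fun j => by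
    rw [lintegral_iSup_directed (fun F => (hRm j F).aemeasurable)]
    · refine iSup_le fun F => ?_
      have h1 : ∫⁻ ω, (R j F ω : ENNReal) ∂η = ENNReal.ofReal (∫ ω, (R j F ω : ℝ) ∂η) := by
        rw [ofReal_integral_eq_lintegral_ofReal]
        · simp
        · exact ContinuousMap.integrable_of_compactSpace η
            ⟨_, NNReal.continuous_coe.comp (hRc j F)⟩
        · exact ae_of_all _ fun ω => NNReal.coe_nonneg _
      rw [h1]
      exact ENNReal.ofReal_le_ofReal (h j F)
    · refine directed_of_isDirected_le fun F F' hF ω => ?_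
      exact ENNReal.coe_le_coe.2 (Finset.sup_mono hF)
  have hlim : Tendsto (fun j => ENNReal.ofReal (r j)) atTop (𝓝 0) := by
    simpa [Function.comp_def] using (ENNReal.continuous_ofReal.tendsto 0).comp hr
  have key : ∀ k : ℕ, ∀ᵐ ω ∂η, ∃ j, ⨆ F, (R j F ω : ENNReal) < ((k : ENNReal) + 1)⁻¹ := fun k => by
    have hle : ∀ j, η {ω | ¬∃ j, ⨆ F, (R j F ω : ENNReal) < ((k : ENNReal) + 1)⁻¹} ≤
        ENNReal.ofReal (r j) * ((k : ENNReal) + 1) := fun j => by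
      refine (measure_mono (t := {ω | ((k : ENNReal) + 1)⁻¹ ≤ ⨆ F, (R j F ω : ENNReal)}) ?_).trans
        ((meas_ge_le_lintegral_div (Measurable.iSup fun F => hRm j F).aemeasurable
        (by simp) (by simp)).trans ?_)
      · exact fun ω hω => not_lt.1 fun hlt => hω ⟨j, hlt⟩
      · rw [div_eq_mul_inv, inv_inv]
        gcongr
        exact hsup j
    have h0 : Tendsto (fun j => ENNReal.ofReal (r j) * ((k : ENNReal) + 1)) atTop (𝓝 0) := by
      simpa using ENNReal.Tendsto.mul_const hlim (Or.inr (by finiteness))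
    exact le_antisymm (ge_of_tendsto' h0 hle) zero_le
  filter_upwards [ae_all_iff.2 key] with ω hω
  refine uniformContinuous_of_abs_sub_le (M := M) fun ε hε => ?_
  obtain ⟨k, hk⟩ := exists_nat_one_div_lt hε
  obtain ⟨j, hj⟩ := hω k
  refine ⟨j, fun p q => ?_⟩
  have h1 : (R j {(p, q)} ω : ENNReal) < ((k : ENNReal) + 1)⁻¹ :=
    (le_iSup (fun F => (R j F ω : ENNReal)) {(p, q)}).trans_lt hj
  have h2 : (|D.x i (ω q) - D.x i (ω p)| - M j * |(q : ℝ) - p|) ≤ (R j {(p, q)} ω : ℝ) := by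
    simp only [R, Finset.sup_singleton]
    exact Real.le_coe_toNNReal _
  have h3 : (R j {(p, q)} ω : ℝ) ≤ 1 / ((k : ℝ) + 1) := by
    have := (ENNReal.toReal_le_toReal (by simp) (by simp)).2 h1.le
    simpa [ENNReal.toReal_add] using this
  linarith

/-- The limit process has a continuous modification with the prescribed marginals. -/
theorem exists_continuous_modification {η : Measure (ℚ → K)} [IsProbabilityMeasure η]
    (huc : ∀ᵐ ω ∂η, ∀ i, UniformContinuous fun q => D.x i (ω q))
    (hη : ∀ q : ℚ, (q : ℝ) ∈ Set.Icc 0 D.T → η.map (fun ω => ω q) = D.Γ q) :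
    ∃ Y : (ℚ → K) → ℝ → K, (∀ t, Measurable fun ω => Y ω t) ∧ (∀ ω, Continuous (Y ω)) ∧
      (∀ t ∈ Set.Icc 0 D.T, η.map (fun ω => Y ω t) = D.Γ t) ∧ ∀ᵐ ω ∂η, ∀ q : ℚ, Y ω q = ω q := by
  classical
  obtain ⟨G, hGs, hGm, hG0⟩ := exists_measurable_superset_of_null huc
  have hext : ∀ ω : ℚ → K, ∃ Y : ℝ → K, Continuous Y ∧
      ∀ q : ℚ, Y q = if ω ∈ G then ω 0 else ω q := fun ω => by
    by_cases hω : ω ∈ G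
    · exact ⟨fun _ => ω 0, continuous_const, fun q => by simp [hω]⟩
    · obtain ⟨Y, hY, hYq⟩ := exists_continuous_extension D.x D.separates ω
        (by_contra fun h => hω (hGs h))
      exact ⟨Y, hY, fun q => by simp [hω, hYq]⟩
  choose Y hYc hYq using hext
  have hYm : ∀ t, Measurable fun ω => Y ω t := fun t => by
    obtain ⟨u, hu, hut⟩ := mem_closure_iff_seq_limit.1 (Rat.denseRange_cast (𝕜 := ℝ) t)
    choose q hq using hu
    refine measurable_of_tendsto_metrizable (f := fun n ω => Y ω (q n)) (fun n => ?_)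
      (tendsto_pi_nhds.2 fun ω => ?_)
    · simp only [hYq]
      exact Measurable.ite hGm (measurable_pi_apply _) (measurable_pi_apply _)
    · simp only [hq]
      exact ((hYc ω).tendsto t).comp hut
  have hae : ∀ᵐ ω ∂η, ∀ q : ℚ, Y ω q = ω q := by
    have : ∀ᵐ ω ∂η, ω ∉ G := measure_eq_zero_iff_ae_notMem.1 hG0
    filter_upwards [this] with ω hω q
    simp [hYq, hω]
  refine ⟨Y, hYm, hYc, fun t ht => ?_, hae⟩
  have := D.markov
  have : IsProbabilityMeasure (η.map fun ω => Y ω t) :=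
    Measure.isProbabilityMeasure_map (hYm t).aemeasurable
  refine measure_ext_of_integral_continuousMap fun f => ?_
  rw [integral_map (hYm t).aemeasurable f.continuous.aestronglyMeasurable]
  have h1 : Continuous fun t => ∫ ω, f (Y ω t) ∂η := by
    refine continuous_of_dominated (bound := fun _ => ‖f‖) (fun t => ?_) (fun t => ?_)
      (integrable_const _) (ae_of_all _ fun ω => f.continuous.comp (hYc ω))
    · exact (f.continuous.measurable.comp (hYm t)).aestronglyMeasurable
    · exact ae_of_all _ fun ω => f.norm_coe_le_norm _
  have h2 : Set.EqOn (fun t => ∫ ω, f (Y ω t) ∂η) (fun t => ∫ μ, f μ ∂(D.Γ t))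
      (Set.Ioo 0 D.T ∩ Set.range ((↑) : ℚ → ℝ)) := by
    rintro _ ⟨hq, q, rfl⟩
    have := hη q (Set.Ioo_subset_Icc_self hq)
    simp only
    rw [← this, integral_map (measurable_pi_apply q).aemeasurable
      f.continuous.aestronglyMeasurable]
    refine integral_congr_ae ?_
    filter_upwards [hae] with ω hω
    rw [hω]
  exact (h2.closure h1 (D.continuous_Γ f)) (Icc_subset_closure_ratCast D.T_pos ht)

end ContinuityEquation

namespace ContinuityEquation

variable {K : Type*} [TopologicalSpace K] [CompactSpace K] [PolishSpace K]
    [MeasurableSpace K] [BorelSpace K] (D : ContinuityEquation K)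

section Paths

variable {Ω : Type*} [MeasurableSpace Ω] {η : Measure Ω} [IsProbabilityMeasure η]
    {Y : Ω → ℝ → K}

omit [CompactSpace K] in
theorem measurable_uncurry_path (hYm : ∀ t, Measurable fun ω => Y ω t)
    (hYc : ∀ ω, Continuous (Y ω)) : Measurable fun p : ℝ × Ω => (p.1, Y p.2 p.1) :=
  measurable_fst.prodMk
    (measurable_uncurry_of_continuous_of_measurable (u := fun t ω => Y ω t) hYc hYm)

theorem map_path (hYm : ∀ t, Measurable fun ω => Y ω t) (hYc : ∀ ω, Continuous (Y ω))
    (hY : ∀ t ∈ Set.Icc 0 D.T, η.map (fun ω => Y ω t) = D.Γ t) :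
    ((volume.restrict (Set.Ioc 0 D.T)).prod η).map (fun p => (p.1, Y p.2 p.1)) = D.Λ := by
  have hm := measurable_uncurry_path hYm hYc
  refine Measure.ext fun s hs => ?_
  rw [Measure.map_apply hm hs, Measure.prod_apply (hm hs), Λ, Measure.compProd_apply hs]
  refine setLIntegral_congr_fun measurableSet_Ioc fun r hr => ?_
  have h : MeasurableSet (Prod.mk r ⁻¹' s) := measurable_prodMk_left hs
  rw [← hY r (Set.Ioc_subset_Icc_self hr), Measure.map_apply (hYm r) h]
  rfl

variable {D}

theorem integrable_path (hYm : ∀ t, Measurable fun ω => Y ω t) (hYc : ∀ ω, Continuous (Y ω))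
    (hY : ∀ t ∈ Set.Icc 0 D.T, η.map (fun ω => Y ω t) = D.Γ t) {f : ℝ × K → ℝ}
    (hf : Integrable f D.Λ) :
    Integrable (fun p : ℝ × Ω => f (p.1, Y p.2 p.1)) ((volume.restrict (Set.Ioc 0 D.T)).prod η) := by
  rw [← D.map_path hYm hYc hY] at hf
  exact hf.comp_measurable (measurable_uncurry_path hYm hYc)

theorem integral_path (hYm : ∀ t, Measurable fun ω => Y ω t) (hYc : ∀ ω, Continuous (Y ω))
    (hY : ∀ t ∈ Set.Icc 0 D.T, η.map (fun ω => Y ω t) = D.Γ t) {f : ℝ × K → ℝ}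
    (hf : Integrable f D.Λ) :
    ∫ ω, (∫ r in Set.Ioc 0 D.T, f (r, Y ω r)) ∂η = ∫ p, f p ∂D.Λ := by
  have h := integrable_path hYm hYc hY hf
  rw [← D.map_path hYm hYc hY] at hf ⊢
  rw [integral_map (measurable_uncurry_path hYm hYc).aemeasurable hf.aestronglyMeasurable,
    integral_prod_symm _ h]

/-- A process whose increments are close to those driven by good approximations of the vector
field follows the vector field. -/
theorem ae_eq_integral (hYm : ∀ t, Measurable fun ω => Y ω t) (hYc : ∀ ω, Continuous (Y ω))
    (hY : ∀ t ∈ Set.Icc 0 D.T, η.map (fun ω => Y ω t) = D.Γ t) {i : ℕ} {q : ℝ}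
    (hq : q ∈ Set.Icc 0 D.T) {c : ℕ → ℝ × K → ℝ} (hc : ∀ l, Continuous (c l))
    (he : Tendsto (fun l => D.err (c l) i) atTop (𝓝 0))
    (h : ∀ l, ∫ ω, |D.x i (Y ω q) - D.x i (Y ω 0) - ∫ r in Set.Ioc 0 q, c l (r, Y ω r)| ∂η ≤
      D.err (c l) i) :
    ∀ᵐ ω ∂η, D.x i (Y ω q) - D.x i (Y ω 0) = ∫ r in Set.Ioc 0 q, D.β i (r, Y ω r) := by
  have hsub : Set.Ioc 0 q ⊆ Set.Ioc 0 D.T := Set.Ioc_subset_Ioc_right hq.2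
  have hxm : ∀ t, Integrable (fun ω => D.x i (Y ω t)) η := fun t =>
    Integrable.of_bound ((D.x i).continuous.measurable.comp (hYm t)).aestronglyMeasurable
      ‖D.x i‖ (ae_of_all _ fun ω => (D.x i).norm_coe_le_norm _)
  have hsec : ∀ f : ℝ × K → ℝ, Integrable f D.Λ →
      Integrable (fun ω => ∫ r in Set.Ioc 0 q, f (r, Y ω r)) η := fun f hf => by
    have h1 := (integrable_path hYm hYc hY hf).restrict (s := Set.Ioc 0 q ×ˢ Set.univ)
    rw [← Measure.prod_restrict, Measure.restrict_restrict measurableSet_Ioc,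
      Set.inter_eq_left.2 hsub, Measure.restrict_univ] at h1
    exact h1.integral_prod_right
  have hβ : Integrable (D.β i) D.Λ := D.integrable_β i
  have hci : ∀ l, Integrable (c l) D.Λ := fun l => D.integrable_continuous (hc l)
  have hdi : ∀ l, Integrable (fun p => |D.β i p - c l p|) D.Λ := fun l => (hβ.sub (hci l)).abs
  have hβω : ∀ᵐ ω ∂η, IntegrableOn (fun r => D.β i (r, Y ω r)) (Set.Ioc 0 D.T) :=
    (integrable_path hYm hYc hY hβ).prod_left_ae
  let Z : Ω → ℝ := fun ω => D.x i (Y ω q) - D.x i (Y ω 0) - ∫ r in Set.Ioc 0 q, D.β i (r, Y ω r)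
  have hZ : Integrable Z η := ((hxm q).sub (hxm 0)).sub (hsec _ hβ)
  have hle : ∀ l, ∫ ω, |Z ω| ∂η ≤ D.err (c l) i + D.err (c l) i := fun l => by
    have e1 : Integrable (fun ω => |D.x i (Y ω q) - D.x i (Y ω 0) -
        ∫ r in Set.Ioc 0 q, c l (r, Y ω r)|) η := (((hxm q).sub (hxm 0)).sub (hsec _ (hci l))).abs
    have e2 : Integrable (fun ω => ∫ r in Set.Ioc 0 D.T, |D.β i (r, Y ω r) - c l (r, Y ω r)|) η :=
      (integrable_path hYm hYc hY (hdi l)).integral_prod_right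
    have e3 := integral_path hYm hYc hY (hdi l)
    refine le_trans ?_ (add_le_add (h l) e3.le)
    rw [← integral_add e1 e2]
    refine integral_mono_ae hZ.abs (e1.add e2) ?_
    filter_upwards [hβω] with ω hω
    have hcω : IntegrableOn (fun r => c l (r, Y ω r)) (Set.Ioc 0 D.T) :=
      (((hc l).comp (continuous_id.prodMk (hYc ω))).integrableOn_Icc).mono_set
        Set.Ioc_subset_Icc_self
    have f1 : |(∫ r in Set.Ioc 0 q, D.β i (r, Y ω r)) - ∫ r in Set.Ioc 0 q, c l (r, Y ω r)| ≤
        ∫ r in Set.Ioc 0 D.T, |D.β i (r, Y ω r) - c l (r, Y ω r)| := by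
      rw [← integral_sub (hω.mono_set hsub) (hcω.mono_set hsub)]
      refine abs_integral_le_integral_abs.trans ?_
      exact setIntegral_mono_set (hω.sub hcω).abs (ae_of_all _ fun r => abs_nonneg _)
        hsub.eventuallyLE
    simp only [Z]
    rw [abs_le] at f1 ⊢
    constructor
    · linarith [neg_abs_le (D.x i (Y ω q) - D.x i (Y ω 0) -
        ∫ r in Set.Ioc 0 q, c l (r, Y ω r)), f1.2]
    · linarith [le_abs_self (D.x i (Y ω q) - D.x i (Y ω 0) -
        ∫ r in Set.Ioc 0 q, c l (r, Y ω r)), f1.1]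
  have hZ0 : ∫ ω, |Z ω| ∂η = 0 := le_antisymm
    (ge_of_tendsto' (by simpa using he.add he) hle) (integral_nonneg fun ω => abs_nonneg _)
  have := (integral_eq_zero_iff_of_nonneg (fun ω => abs_nonneg _) hZ.abs).1 hZ0
  filter_upwards [this] with ω hω
  exact sub_eq_zero.1 (abs_eq_zero.1 hω)

/-- Passing to the limit in the Riemann sums along continuous paths. -/
theorem integral_abs_sub_le_of_riemann_sum (hYm : ∀ t, Measurable fun ω => Y ω t)
    (hYc : ∀ ω, Continuous (Y ω)) {i : ℕ} {q : ℝ} (hq : q ∈ Set.Icc 0 D.T) {c : ℝ × K → ℝ}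
    (hc : Continuous c) {b : ℕ → ℝ} {B : ℝ} (hb : Tendsto b atTop (𝓝 B))
    (h : ∀ L : ℕ, 0 < L → ∫ ω, |D.x i (Y ω q) - D.x i (Y ω 0) -
      q / L * ∑ r ∈ Finset.range L, c (q * r / L, Y ω (q * r / L))| ∂η ≤ b L) :
    ∫ ω, |D.x i (Y ω q) - D.x i (Y ω 0) - ∫ r in Set.Ioc 0 q, c (r, Y ω r)| ∂η ≤ B := by
  obtain ⟨C, hC0, hC⟩ := D.exists_bound hc
  refine le_of_tendsto_of_tendsto (tendsto_integral_of_dominated_convergence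
    (F := fun (L : ℕ) ω => |D.x i (Y ω q) - D.x i (Y ω 0) -
      q / L * ∑ r ∈ Finset.range L, c (q * r / L, Y ω (q * r / L))|)
    (fun _ => ‖D.x i‖ + ‖D.x i‖ + q * C) (fun L => ?_) (integrable_const _) (fun L => ?_)
    (ae_of_all _ fun ω => ?_)) hb ((eventually_gt_atTop 0).mono fun L hL => h L hL)
  · have h1 : ∀ t, Measurable fun ω => D.x i (Y ω t) := fun t =>
      (D.x i).continuous.measurable.comp (hYm t)
    have h2 : Measurable fun ω => ∑ r ∈ Finset.range L, c (q * r / L, Y ω (q * r / L)) :=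
      Finset.measurable_sum _ fun r _ => hc.measurable.comp (measurable_const.prodMk (hYm _))
    exact (((h1 q).sub (h1 0)).sub (h2.const_mul _)).abs.aestronglyMeasurable
  · refine ae_of_all _ fun ω => ?_
    have h1 : |q / L * ∑ r ∈ Finset.range L, c (q * r / L, Y ω (q * r / L))| ≤ q * C := by
      rcases L.eq_zero_or_pos with rfl | hL
      · simpa using mul_nonneg hq.1 hC0
      have hL' : (0 : ℝ) < L := by exact_mod_cast hL
      rw [abs_mul, abs_of_nonneg (div_nonneg hq.1 hL'.le)]
      calc q / L * |∑ r ∈ Finset.range L, c (q * r / L, Y ω (q * r / L))|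
          ≤ q / L * ∑ r ∈ Finset.range L, C := by
            refine mul_le_mul_of_nonneg_left ((Finset.abs_sum_le_sum_abs _ _).trans
              (Finset.sum_le_sum fun r hr => ?_)) (div_nonneg hq.1 hL'.le)
            have hr' : (r : ℝ) ≤ L := by exact_mod_cast (Finset.mem_range.1 hr).le
            refine hC _ ⟨div_nonneg (mul_nonneg hq.1 (Nat.cast_nonneg _)) hL'.le, ?_⟩ _
            rw [div_le_iff₀ hL']
            exact mul_le_mul hq.2 hr' (Nat.cast_nonneg _) D.T_pos.le
        _ = q * C := by
            rw [Finset.sum_const, Finset.card_range, nsmul_eq_mul]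
            field_simp
    rw [Real.norm_eq_abs, abs_abs]
    have h2 := (D.x i).norm_coe_le_norm (Y ω q)
    have h3 := (D.x i).norm_coe_le_norm (Y ω 0)
    rw [Real.norm_eq_abs] at h2 h3
    exact (abs_sub _ _).trans (add_le_add ((abs_sub _ _).trans (add_le_add h2 h3)) h1)
  · refine ((tendsto_const_nhds.sub ?_)).abs
    have := tendsto_riemann_sum (hc.comp (continuous_id.prodMk (hYc ω))) hq.1
    refine this.congr fun L => ?_
    have hr : ∀ r : ℕ, (r : ℝ) * (q / L) = q * r / L := fun r => by ring
    simp only [Function.comp, id, hr]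

end Paths

/-- The superposition principle for a continuity equation on a compact space: solutions are
marginals of probability measures concentrated on continuous integral curves. -/
theorem exists_superposition : ∃ (η : Measure (ℚ → K)) (Y : (ℚ → K) → ℝ → K),
    IsProbabilityMeasure η ∧ (∀ t, Measurable fun ω => Y ω t) ∧ (∀ ω, Continuous (Y ω)) ∧
    (∀ t ∈ Set.Icc 0 D.T, η.map (fun ω => Y ω t) = D.Γ t) ∧
    ∀ᵐ ω ∂η, ∀ i, ∀ t ∈ Set.Icc 0 D.T,
      D.x i (Y ω t) - D.x i (Y ω 0) = ∫ r in Set.Ioc 0 t, D.β i (r, Y ω r) := by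
  have hex : ∀ j i : ℕ, ∃ c, D.IsCyl c ∧ D.err c i ≤ 1 / ((j : ℝ) + 1) ^ 2 := fun j i =>
    D.exists_isCyl_near (D.integrable_β i) (by positivity)
  choose c hc he using hex
  have hbd : ∀ j i, ∃ M, D.IsBound (c j i) M := fun j i => D.exists_bound (hc j i).continuous
  choose M hM using hbd
  have herr0 : ∀ j i, 0 ≤ D.err (c j i) i := fun j i => integral_nonneg fun p => abs_nonneg _
  have herr : ∀ i, Tendsto (fun j => D.err (c j i) i) atTop (𝓝 0) := fun i => by
    refine squeeze_zero (fun j => herr0 j i) (fun j => he j i) ?_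
    have := (tendsto_one_div_add_atTop_nhds_zero_nat (𝕜 := ℝ)).pow 2
    simpa using this
  obtain ⟨η, hη, hΓ, hA, hB⟩ := D.exists_limit_process hc he hM
  obtain ⟨Y, hYm, hYc, hY, hYq⟩ := D.exists_continuous_modification
    (ae_all_iff.2 fun i => D.ae_uniformContinuous (herr i) fun j F => hA j i F) hΓ
  refine ⟨η, Y, hη, hYm, hYc, hY, ?_⟩
  have hrat : ∀ (i : ℕ) (q : ℚ), (q : ℝ) ∈ Set.Icc 0 D.T → ∀ᵐ ω ∂η,
      D.x i (Y ω q) - D.x i (Y ω 0) = ∫ r in Set.Ioc 0 (q : ℝ), D.β i (r, Y ω r) := by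
    intro i q hq
    refine ae_eq_integral hYm hYc hY hq (fun l => (hc l i).continuous) (herr i) fun l => ?_
    obtain ⟨A, m, hA0, hAm⟩ := (hc l i).exists_lipschitz
    have hj : ∀ j, ∫ ω, |D.x i (Y ω q) - D.x i (Y ω 0) -
        ∫ r in Set.Ioc 0 (q : ℝ), c l i (r, Y ω r)| ∂η ≤
        D.err (c l i) i + D.T * (A * ∑ a ∈ Finset.range m, D.err (c j a) a) := fun j => by
      have hdiv : Tendsto (fun L : ℕ => (q : ℝ) / L) atTop (𝓝 0) :=
        tendsto_const_div_atTop_nhds_zero_nat _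
      have hs := tendsto_finsetSum (Finset.range m) fun a _ =>
        (tendsto_const_nhds (x := D.err (c j a) a)).add (hdiv.const_mul (M j a))
      have hlim := (tendsto_const_nhds (x := D.err (c l i) i)).add
        (((hdiv.add hs).const_mul A).const_mul D.T)
      simp only [mul_zero, add_zero, zero_add] at hlim
      refine integral_abs_sub_le_of_riemann_sum hYm hYc hq (hc l i).continuous hlim fun L hL => ?_
      refine le_of_eq_of_le (integral_congr_ae ?_) (hB l i j q hq A m hA0 hAm L hL)
      filter_upwards [hYq] with ω hω
      have hω' : ∀ r : ℕ, Y ω ((q : ℝ) * r / L) = ω (q * r / L) := fun r => by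
        rw [← hω]
        push_cast
        rfl
      have h0 : Y ω 0 = ω 0 := by simpa using hω 0
      simp only [hω', hω, h0]
    have hlim := (tendsto_const_nhds (x := D.err (c l i) i)).add
      (((tendsto_finsetSum (Finset.range m) fun a _ => herr a).const_mul A).const_mul D.T)
    simp only [Finset.sum_const_zero, mul_zero, add_zero] at hlim
    exact ge_of_tendsto' hlim hj
  have hint : ∀ i, ∀ᵐ ω ∂η, IntegrableOn (fun r => D.β i (r, Y ω r)) (Set.Ioc 0 D.T) := fun i =>
    (integrable_path hYm hYc hY (D.integrable_β i)).prod_left_ae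
  filter_upwards [ae_all_iff.2 hint, ae_all_iff.2 fun i => ae_all_iff.2 fun q =>
    Filter.eventually_imp_distrib_left.2 (hrat i q)] with ω h1 h2 i t ht
  have heq : Set.EqOn (fun t => D.x i (Y ω t) - D.x i (Y ω 0))
      (fun t => ∫ r in Set.Ioc 0 t, D.β i (r, Y ω r))
      (Set.Ioo 0 D.T ∩ Set.range ((↑) : ℚ → ℝ)) := by
    rintro _ ⟨hq, q, rfl⟩
    exact h2 i q (Set.Ioo_subset_Icc_self hq)
  refine heq.of_subset_closure (t := Set.Icc 0 D.T) ?_ ?_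
    (Set.inter_subset_left.trans Set.Ioo_subset_Icc_self) (Icc_subset_closure_ratCast D.T_pos) ht
  · exact (((D.x i).continuous.comp (hYc ω)).sub continuous_const).continuousOn
  · exact intervalIntegral.continuousOn_primitive
      ((integrableOn_Icc_iff_integrableOn_Ioc (by simp)).2 (h1 i))

end ContinuityEquation

/-- Smooth cutoff functions. -/
theorem exists_isC2c_cutoff {d : ℕ} {K : Set (Rd d)} (hK : IsCompact K) {ε : ℝ} (hε : 0 < ε) :
    ∃ f : Rd d → ℝ, IsC2c f ∧ (∀ x, 0 ≤ f x ∧ f x ≤ 1) ∧ (∀ x ∈ K, f x = 1) ∧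
      ∀ x ∉ Metric.thickening ε K, f x = 0 := by
  obtain ⟨f, hf, hr, h0, h1⟩ := exists_contMDiff_zero_iff_one_iff_of_isClosed
    (modelWithCornersSelf ℝ (Rd d)) (n := 2) (s := (Metric.thickening ε K)ᶜ) (t := K)
    Metric.isOpen_thickening.isClosed_compl hK.isClosed
    (Set.disjoint_compl_left_iff_subset.2 (Metric.self_subset_thickening hε K))
  refine ⟨f, ⟨contMDiff_iff_contDiff.1 hf, ?_⟩, fun x => hr ⟨x, rfl⟩, fun x hx => (h1 x).1 hx,
    fun x hx => (h0 x).1 hx⟩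
  exact HasCompactSupport.intro hK.cthickening fun x hx =>
    (h0 x).1 fun h => hx (Metric.thickening_subset_cthickening ε K h)

theorem exists_isC2c_seq_tendsto {d : ℕ} {K : Set (Rd d)} (hK : IsCompact K) :
    ∃ f : ℕ → Rd d → ℝ, (∀ n, IsC2c (f n)) ∧ ∀ μ : Measure (Rd d), IsFiniteMeasure μ →
      Tendsto (fun n => ∫ x, f n x ∂μ) atTop (𝓝 (μ.real K)) := by
  have h := fun n : ℕ => exists_isC2c_cutoff hK (Nat.one_div_pos_of_nat (α := ℝ) (n := n))
  choose f hf h01 h1 h0 using h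
  refine ⟨f, hf, fun μ hμ => ?_⟩
  rw [← integral_indicator_one hK.measurableSet]
  refine tendsto_integral_of_dominated_convergence (fun _ => 1)
    (fun n => (hf n).1.continuous.aestronglyMeasurable) (integrable_const _)
    (fun n => ae_of_all _ fun x => ?_) (ae_of_all _ fun x => ?_)
  · rw [Real.norm_eq_abs, abs_of_nonneg (h01 n x).1]
    exact (h01 n x).2
  · by_cases hx : x ∈ K
    · simp [hx, h1]
    · have : ∀ᶠ n : ℕ in atTop, x ∉ Metric.thickening (1 / ((n : ℝ) + 1)) K := by
        by_contra hcon
        have hfr : ∃ᶠ n : ℕ in atTop, x ∈ Metric.thickening (1 / ((n : ℝ) + 1)) K := by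
          simpa [Filter.Frequently] using hcon
        refine hx ?_
        rw [← hK.isClosed.closure_eq, Metric.closure_eq_iInter_thickening, Set.mem_iInter₂]
        intro δ hδ
        have hev := (tendsto_one_div_add_atTop_nhds_zero_nat (𝕜 := ℝ)).eventually_lt_const hδ
        obtain ⟨n, hn, hn'⟩ := (hfr.and_eventually hev).exists
        exact Metric.thickening_mono hn'.le K hn
      refine tendsto_const_nhds.congr' ?_
      filter_upwards [this] with n hn
      simp [hx, h0 n x hn]

namespace SP

variable {d : ℕ}

instance (μ : SP d) : IsFiniteMeasure μ.1 := ⟨μ.2.trans_lt ENNReal.one_lt_top⟩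

theorem continuous_integral {g : Rd d → ℝ} (hg : Continuous g) (hc : HasCompactSupport g) :
    Continuous fun μ : SP d => ∫ x, g x ∂μ.1 :=
  continuous_iInf_dom (i := ⟨g, hg, hc⟩) continuous_induced_dom

theorem integral_le_one (μ : SP d) {g : Rd d → ℝ} {C : ℝ} (hC : 0 ≤ C)
    (hgC : ∀ x, |g x| ≤ C) : |∫ x, g x ∂μ.1| ≤ C := by
  refine (norm_integral_le_of_norm_le_const (f := g) (C := C)
    (ae_of_all _ fun x => hgC x)).trans ?_
  have : μ.1.real Set.univ ≤ 1 := ENNReal.toReal_le_of_le_ofReal zero_le_one (by simpa using μ.2)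
  nlinarith

theorem le_nhds {F : Filter (SP d)} {ν : SP d} (h : ∀ g : Rd d → ℝ, Continuous g →
    HasCompactSupport g → Tendsto (fun μ : SP d => ∫ x, g x ∂μ.1) F (𝓝 (∫ x, g x ∂ν.1))) :
    F ≤ 𝓝 ν := by
  refine le_of_le_of_eq (le_iInf fun g => ?_) (nhds_iInf ..).symm
  rw [nhds_induced, ← Filter.map_le_iff_le_comap]
  exact h g.1 g.2.1 g.2.2

instance : CompactSpace (SP d) := by
  refine ⟨isCompact_iff_ultrafilter_le_nhds.2 fun F _ => ?_⟩
  have hint : ∀ (g : CompactlySupportedContinuousMap (Rd d) ℝ) (μ : SP d), Integrable g μ.1 :=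
    fun g μ => g.continuous.integrable_of_hasCompactSupport g.hasCompactSupport
  have hlim : ∀ g : CompactlySupportedContinuousMap (Rd d) ℝ,
      ∃ l : ℝ, Tendsto (fun μ : SP d => ∫ x, g x ∂μ.1) F (𝓝 l) := fun g => by
    obtain ⟨C, hC⟩ := g.hasCompactSupport.exists_bound_of_continuous g.continuous
    have hle : (F.map fun μ : SP d => ∫ x, g x ∂μ.1 : Filter ℝ) ≤
        𝓟 (Set.Icc (-max C 0) (max C 0)) := by
      refine le_principal_iff.2 (Filter.mem_map.2 (univ_mem' fun μ => abs_le.1 ?_))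
      exact μ.integral_le_one (le_max_right _ _) fun x => (hC x).trans (le_max_left _ _)
    obtain ⟨l, -, hl⟩ := isCompact_iff_ultrafilter_le_nhds.1 isCompact_Icc
      (F.map fun μ : SP d => ∫ x, g x ∂μ.1) hle
    exact ⟨l, hl⟩
  choose l hl using hlim
  let L₀ : CompactlySupportedContinuousMap (Rd d) ℝ →ₗ[ℝ] ℝ :=
    { toFun := l
      map_add' := fun f g => by
        refine tendsto_nhds_unique (hl (f + g)) (((hl f).add (hl g)).congr fun μ => ?_)
        exact (integral_add (hint f μ) (hint g μ)).symm
      map_smul' := fun c g => by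
        refine tendsto_nhds_unique (hl (c • g)) (((hl g).const_mul c).congr fun μ => ?_)
        exact (integral_const_mul c _).symm }
  let L : CompactlySupportedContinuousMap (Rd d) ℝ →ₚ[ℝ] ℝ := PositiveLinearMap.mk₀ L₀ fun g hg =>
    ge_of_tendsto' (hl g) fun μ => integral_nonneg fun x => hg x
  have hmass : RealRMK.rieszMeasure L Set.univ ≤ 1 := by
    rw [isOpen_univ.measure_eq_iSup_isCompact]
    refine iSup₂_le fun K _ => iSup_le fun hK => ?_
    obtain ⟨f, hf, h01, h1, -⟩ := exists_isC2c_cutoff hK one_pos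
    let f' : CompactlySupportedContinuousMap (Rd d) ℝ := ⟨⟨f, hf.1.continuous⟩, hf.2⟩
    refine (RealRMK.rieszMeasure_le_of_eq_one L (f := f') (fun x => (h01 x).1) hK h1).trans ?_
    refine ENNReal.ofReal_le_one.2 (le_of_tendsto' (hl f') fun μ => ?_)
    refine (le_abs_self _).trans (μ.integral_le_one zero_le_one fun x => ?_)
    exact abs_le.2 ⟨(neg_one_lt_zero.le).trans (h01 x).1, (h01 x).2⟩
  refine ⟨⟨_, hmass⟩, trivial, ?_⟩
  refine le_nhds fun g hg hc => ?_
  have h2 := RealRMK.integral_rieszMeasure L ⟨⟨g, hg⟩, hc⟩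
  exact (congrArg 𝓝 h2) ▸ hl ⟨⟨g, hg⟩, hc⟩

theorem integrable_of_isC2c (μ : SP d) {φ : Rd d → ℝ} (hφ : IsC2c φ) : Integrable φ μ.1 :=
  hφ.1.continuous.integrable_of_hasCompactSupport hφ.2

theorem ext_of_integral_isC2c {μ ν : SP d}
    (h : ∀ φ : Rd d → ℝ, IsC2c φ → ∫ x, φ x ∂μ.1 = ∫ x, φ x ∂ν.1) : μ = ν := by
  refine Subtype.ext (Measure.ext fun s hs => ?_)
  rw [hs.measure_eq_iSup_isCompact_of_ne_top (measure_ne_top _ _),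
    hs.measure_eq_iSup_isCompact_of_ne_top (measure_ne_top _ _)]
  refine iSup_congr fun K => iSup_congr fun _ => iSup_congr fun hK => ?_
  obtain ⟨f, hf, hlim⟩ := exists_isC2c_seq_tendsto hK
  have := tendsto_nhds_unique ((hlim μ.1 inferInstance).congr fun n => h _ (hf n))
    (hlim ν.1 inferInstance)
  exact (measureReal_eq_measureReal_iff).1 this

theorem injective_Gmap {g : ℕ → Rd d → ℝ} (hg : GFamily d g) :
    Function.Injective (Gmap g) := by
  intro μ ν h
  refine ext_of_integral_isC2c fun φ hφ => ?_
  refine eq_of_forall_dist_le fun ε hε => ?_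
  obtain ⟨i, hi, -⟩ := hg.2.2 φ hφ (ε / 2) (half_pos hε)
  have key : ∀ μ : SP d, |∫ x, g i x ∂μ.1 - ∫ x, φ x ∂μ.1| ≤ ε / 2 := fun μ => by
    rw [← integral_sub (μ.integrable_of_isC2c (hg.1 i)) (μ.integrable_of_isC2c hφ)]
    exact μ.integral_le_one (half_pos hε).le hi
  have h1 := abs_le.1 (key μ)
  have h2 := abs_le.1 (key ν)
  have h3 : ∫ x, g i x ∂μ.1 = ∫ x, g i x ∂ν.1 := congrFun h i
  rw [Real.dist_eq, abs_le]
  constructor <;> linarith [h1.1, h1.2, h2.1, h2.2]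

theorem continuous_Gmap {g : ℕ → Rd d → ℝ} (hg : GFamily d g) : Continuous (Gmap g) :=
  continuous_pi fun i => continuous_integral (hg.1 i).1.continuous (hg.1 i).2

theorem polishSpace {g : ℕ → Rd d → ℝ} (hg : GFamily d g) : PolishSpace (SP d) :=
  ((continuous_Gmap hg).isClosedEmbedding (injective_Gmap hg)).polishSpace

theorem measurable_val : Measurable fun μ : SP d => μ.1 := by
  have hcpt : ∀ K : Set (Rd d), IsCompact K → Measurable fun μ : SP d => μ.1 K := fun K hK => by
    obtain ⟨f, hf, hlim⟩ := exists_isC2c_seq_tendsto hK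
    have : Measurable fun μ : SP d => μ.1.real K :=
      measurable_of_tendsto_metrizable
        (fun n => (continuous_integral (hf n).1.continuous (hf n).2).measurable)
        (tendsto_pi_nhds.2 fun μ => hlim μ.1 inferInstance)
    simpa [Function.comp_def] using ENNReal.measurable_ofReal.comp this
  have hcl : ∀ F : Set (Rd d), IsClosed F → Measurable fun μ : SP d => μ.1 F := fun F hF => by
    have : ∀ μ : SP d, μ.1 F = ⨆ n : ℕ, μ.1 (F ∩ Metric.closedBall 0 n) := fun μ => by
      rw [← Monotone.measure_iUnion, ← Set.inter_iUnion, Metric.iUnion_closedBall_nat,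
        Set.inter_univ]
      exact fun m n hmn => Set.inter_subset_inter_right _
        (Metric.closedBall_subset_closedBall (by exact_mod_cast hmn))
    simp only [this]
    exact Measurable.iSup fun n => hcpt _ ((isCompact_closedBall _ _).inter_left hF)
  refine Measurable.measure_of_isPiSystem (S := {F | IsClosed F})
    ((BorelSpace.measurable_eq).trans (borel_eq_generateFrom_isClosed)) isPiSystem_isClosed
    (fun F hF => hcl F hF) (hcl _ isClosed_univ)

/-- The identity of `SP d` as a kernel. -/
def kernel (d : ℕ) : ProbabilityTheory.Kernel (SP d) (Rd d) := ⟨fun μ => μ.1, measurable_val⟩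

instance : ProbabilityTheory.IsFiniteKernel (kernel d) :=
  ⟨⟨1, ENNReal.one_lt_top, fun μ => μ.2⟩⟩

end SP

namespace IsC2c

variable {n : ℕ} {φ : (Fin n → ℝ) → ℝ}

theorem contDiff_pd (hφ : ContDiff ℝ 2 φ) (i : Fin n) : ContDiff ℝ 1 (pd φ i) :=
  (hφ.fderiv_right (m := 1) (by norm_num)).clm_apply contDiff_const

theorem continuous_pd (hφ : IsC2c φ) (i : Fin n) : Continuous (pd φ i) :=
  (contDiff_pd hφ.1 i).continuous

theorem continuous_pd2 (hφ : IsC2c φ) (i j : Fin n) : Continuous (pd2 φ i j) :=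
  ((contDiff_pd hφ.1 j).continuous_fderiv one_ne_zero).clm_apply continuous_const

theorem hasCompactSupport_pd (hφ : HasCompactSupport φ) (i : Fin n) :
    HasCompactSupport (pd φ i) :=
  (hφ.fderiv (𝕜 := ℝ)).comp_left (g := fun L : (Fin n → ℝ) →L[ℝ] ℝ => L (Pi.single i 1)) rfl

theorem isC2b (hφ : IsC2c φ) : IsC2b φ := by
  obtain ⟨C, hC⟩ := hφ.2.exists_bound_of_continuous hφ.1.continuous
  choose D hD using fun i => (hasCompactSupport_pd hφ.2 i).exists_bound_of_continuous
    (hφ.continuous_pd i)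
  choose E hE using fun i j => (hasCompactSupport_pd (hasCompactSupport_pd hφ.2 j)
    i).exists_bound_of_continuous (hφ.continuous_pd2 i j)
  refine ⟨hφ.1, |C| + ∑ i, |D i| + ∑ i, ∑ j, |E i j|, fun x => ?_⟩
  have h1 : 0 ≤ ∑ i, |D i| := Finset.sum_nonneg fun i _ => abs_nonneg _
  have h2 : 0 ≤ ∑ i, ∑ j, |E i j| := by positivity
  refine ⟨?_, fun i => ?_, fun i j => ?_⟩
  · linarith [hC x, le_abs_self C, Real.norm_eq_abs (φ x)]
  · have h3 := Finset.single_le_sum (f := fun i => |D i|) (fun i _ => abs_nonneg _)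
      (Finset.mem_univ i)
    linarith [hD i x, le_abs_self (D i), Real.norm_eq_abs (pd φ i x), abs_nonneg C]
  · have h3 := Finset.single_le_sum (f := fun i => ∑ j, |E i j|)
      (fun i _ => Finset.sum_nonneg fun j _ => abs_nonneg _) (Finset.mem_univ i)
    have h4 := Finset.single_le_sum (f := fun j => |E i j|) (fun j _ => abs_nonneg _)
      (Finset.mem_univ j)
    have h5 : |pd2 φ i j x| ≤ E i j := hE i j x
    linarith [le_abs_self (E i j), abs_nonneg C]

end IsC2c

/-- A `C²` function agrees near a compact set with a compactly supported one. -/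
theorem exists_isC2c_eventuallyEq {n : ℕ} {f : (Fin n → ℝ) → ℝ} (hf : ContDiff ℝ 2 f)
    {K : Set (Fin n → ℝ)} (hK : IsCompact K) :
    ∃ h, IsC2c h ∧ ∀ x ∈ K, h =ᶠ[𝓝 x] f := by
  obtain ⟨χ, hχ, -, h1, -⟩ := exists_isC2c_cutoff (hK.cthickening (r := 1)) one_pos
  refine ⟨fun x => χ x * f x, ⟨hχ.1.mul hf, hχ.2.mul_right⟩, fun x hx => ?_⟩
  filter_upwards [Metric.isOpen_thickening.mem_nhds
    (Metric.self_subset_thickening one_pos K hx)] with y hy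
  rw [h1 y (Metric.thickening_subset_cthickening 1 K hy), one_mul]

/-- A family of probability measures depending weakly continuously on a parameter is measurable. -/
theorem measurable_of_continuous_integral {K : Type*} [TopologicalSpace K] [CompactSpace K]
    [TopologicalSpace.PseudoMetrizableSpace K] [MeasurableSpace K] [BorelSpace K]
    {P : ℝ → Measure K} [∀ t, IsProbabilityMeasure (P t)]
    (hP : ∀ f : C(K, ℝ), Continuous fun t => ∫ μ, f μ ∂(P t)) : Measurable P := by
  let _ := TopologicalSpace.pseudoMetrizableSpacePseudoMetric K
  refine Measurable.measure_of_isPiSystem_of_isProbabilityMeasure (S := {s : Set K | IsClosed s})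
    ((BorelSpace.measurable_eq (α := K)).trans (borel_eq_generateFrom_isClosed (α := K)))
    (isPiSystem_isClosed (α := K)) fun s hs => ?_
  refine measurable_of_tendsto_metrizable (f := fun n t => ∫⁻ μ, hs.apprSeq n μ ∂(P t))
    (fun n => ?_) ?_
  · have h : Continuous fun t => ∫ μ, (hs.apprSeq n μ : ℝ) ∂(P t) :=
      hP ⟨fun μ => (hs.apprSeq n μ : ℝ), by fun_prop⟩
    convert h.measurable.ennreal_ofReal using 2 with t
    rw [ofReal_integral_eq_lintegral_ofReal]
    · simp
    · exact ((hs.apprSeq n).integrable_of_nnreal (P t))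
    · exact Eventually.of_forall fun μ => NNReal.coe_nonneg _
  · exact tendsto_pi_nhds.2 fun t => HasOuterApproxClosed.tendsto_lintegral_apprSeq hs (P t)

namespace SP

variable {d : ℕ} {a : ℝ → SP d → Rd d → Fin d → Fin d → ℝ} {b : ℝ → SP d → Rd d → Fin d → ℝ}

theorem measurable_Lop (hab : GoodCoeffs d a b) {φ : Rd d → ℝ} (hφ : IsC2c φ) :
    Measurable fun p : (ℝ × SP d) × Rd d => Lop a b p.1.1 p.1.2 φ p.2 := by
  have ha : ∀ i j, Measurable fun p : (ℝ × SP d) × Rd d => a p.1.1 p.1.2 p.2 i j := fun i j =>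
    (hab.1 i j).comp (g := fun p : ℝ × SP d × Rd d => a p.1 p.2.1 p.2.2 i j)
      (MeasurableEquiv.prodAssoc (α := ℝ) (β := SP d) (γ := Rd d)).measurable
  have hb : ∀ i, Measurable fun p : (ℝ × SP d) × Rd d => b p.1.1 p.1.2 p.2 i := fun i =>
    (hab.2.1 i).comp (g := fun p : ℝ × SP d × Rd d => b p.1 p.2.1 p.2.2 i)
      (MeasurableEquiv.prodAssoc (α := ℝ) (β := SP d) (γ := Rd d)).measurable
  refine (Finset.measurable_sum _ fun i _ => Finset.measurable_sum _ fun j _ => ?_).add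
    (Finset.measurable_sum _ fun i _ => ?_)
  · exact (ha i j).mul ((hφ.continuous_pd2 i j).measurable.comp measurable_snd)
  · exact (hb i).mul ((hφ.continuous_pd i).measurable.comp measurable_snd)

/-- Pointwise size of the coefficients. -/
def size (a : ℝ → SP d → Rd d → Fin d → Fin d → ℝ) (b : ℝ → SP d → Rd d → Fin d → ℝ)
    (t : ℝ) (μ : SP d) (x : Rd d) : ℝ :=
  (∑ i, |b t μ x i|) + ∑ i, ∑ j, |a t μ x i j|

theorem size_nonneg (t : ℝ) (μ : SP d) (x : Rd d) : 0 ≤ size a b t μ x := by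
  unfold size; positivity

theorem measurable_size (hab : GoodCoeffs d a b) :
    Measurable fun p : (ℝ × SP d) × Rd d => size a b p.1.1 p.1.2 p.2 := by
  have ha : ∀ i j, Measurable fun p : (ℝ × SP d) × Rd d => a p.1.1 p.1.2 p.2 i j := fun i j =>
    (hab.1 i j).comp (g := fun p : ℝ × SP d × Rd d => a p.1 p.2.1 p.2.2 i j)
      (MeasurableEquiv.prodAssoc (α := ℝ) (β := SP d) (γ := Rd d)).measurable
  have hb : ∀ i, Measurable fun p : (ℝ × SP d) × Rd d => b p.1.1 p.1.2 p.2 i := fun i =>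
    (hab.2.1 i).comp (g := fun p : ℝ × SP d × Rd d => b p.1 p.2.1 p.2.2 i)
      (MeasurableEquiv.prodAssoc (α := ℝ) (β := SP d) (γ := Rd d)).measurable
  exact (Finset.measurable_sum _ fun i _ => (hb i).abs).add
    (Finset.measurable_sum _ fun i _ => Finset.measurable_sum _ fun j _ => (ha i j).abs)

theorem abs_Lop_le {φ : Rd d → ℝ} {C : ℝ} {x : Rd d}
    (h1 : ∀ i, |pd φ i x| ≤ C) (h2 : ∀ i j, |pd2 φ i j x| ≤ C) (t : ℝ) (μ : SP d) :
    |Lop a b t μ φ x| ≤ C * size a b t μ x := by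
  unfold Lop size
  rw [mul_add, add_comm, Finset.mul_sum, Finset.mul_sum]
  refine (abs_add_le _ _).trans (add_le_add ?_ ?_)
  · refine (Finset.abs_sum_le_sum_abs _ _).trans (Finset.sum_le_sum fun i _ => ?_)
    rw [abs_mul, mul_comm]
    exact mul_le_mul_of_nonneg_right (h1 i) (abs_nonneg _)
  · refine (Finset.abs_sum_le_sum_abs _ _).trans (Finset.sum_le_sum fun i _ => ?_)
    rw [Finset.mul_sum]
    refine (Finset.abs_sum_le_sum_abs _ _).trans (Finset.sum_le_sum fun j _ => ?_)
    rw [abs_mul, mul_comm]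
    exact mul_le_mul_of_nonneg_right (h2 i j) (abs_nonneg _)

/-- Total size of the coefficients at `(t, μ)`. -/
def cost (a : ℝ → SP d → Rd d → Fin d → Fin d → ℝ) (b : ℝ → SP d → Rd d → Fin d → ℝ)
    (p : ℝ × SP d) : ENNReal :=
  ∫⁻ x, ENNReal.ofReal (size a b p.1 p.2 x) ∂p.2.1

theorem measurable_cost (hab : GoodCoeffs d a b) : Measurable (cost a b) :=
  (measurable_size hab).ennreal_ofReal.lintegral_kernel_prod_right'
    (κ := (kernel d).comap (Prod.snd : ℝ × SP d → SP d) measurable_snd)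

/-- The drift `⟨L_{t,μ} φ, μ⟩`. -/
def drift (a : ℝ → SP d → Rd d → Fin d → Fin d → ℝ) (b : ℝ → SP d → Rd d → Fin d → ℝ)
    (φ : Rd d → ℝ) (p : ℝ × SP d) : ℝ :=
  ∫ x, Lop a b p.1 p.2 φ x ∂p.2.1

theorem measurable_drift (hab : GoodCoeffs d a b) {φ : Rd d → ℝ} (hφ : IsC2c φ) :
    Measurable (drift a b φ) :=
  (StronglyMeasurable.integral_kernel_prod_right'
    (κ := (kernel d).comap (Prod.snd : ℝ × SP d → SP d) measurable_snd)
    (measurable_Lop hab hφ).stronglyMeasurable).measurable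

theorem enorm_drift_le {φ : Rd d → ℝ} {C : ℝ} (hC : 0 ≤ C)
    (h1 : ∀ i x, |pd φ i x| ≤ C) (h2 : ∀ i j x, |pd2 φ i j x| ≤ C) (p : ℝ × SP d) :
    ‖drift a b φ p‖ₑ ≤ ENNReal.ofReal C * cost a b p := by
  refine (enorm_integral_le_lintegral_enorm _).trans ?_
  rw [cost, ← lintegral_const_mul' _ _ ENNReal.ofReal_ne_top]
  refine lintegral_mono fun x => ?_
  rw [← ENNReal.ofReal_mul hC, Real.enorm_eq_ofReal_abs]
  exact ENNReal.ofReal_le_ofReal (abs_Lop_le (fun i => h1 i x) (fun i j => h2 i j x) p.1 p.2)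

theorem exists_kernel {T : ℝ} (hT : 0 < T) [TopologicalSpace.PseudoMetrizableSpace (SP d)]
    {Γ : ℝ → Measure (SP d)} (hP : ∀ t ∈ Set.Icc 0 T, IsProbabilityMeasure (Γ t))
    (hc : WeaklyContinuousMeasOn Γ (Set.Icc 0 T)) :
    ∃ κ : ProbabilityTheory.Kernel ℝ (SP d), ProbabilityTheory.IsMarkovKernel κ ∧
      (∀ t ∈ Set.Icc 0 T, κ t = Γ t) ∧ ∀ f : C(SP d, ℝ), Continuous fun t => ∫ μ, f μ ∂(κ t) := by
  let P : ℝ → Measure (SP d) := fun t => Γ (Set.projIcc 0 T hT.le t)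
  have hPP : ∀ t, IsProbabilityMeasure (P t) := fun t => hP _ (Set.projIcc 0 T hT.le t).2
  have hPc : ∀ f : C(SP d, ℝ), Continuous fun t => ∫ μ, f μ ∂(P t) := fun f =>
    (hc f f.continuous ⟨‖f‖, fun μ => f.norm_coe_le_norm μ⟩).comp_continuous
      (continuous_subtype_val.comp continuous_projIcc) fun t => (Set.projIcc 0 T hT.le t).2
  exact ⟨⟨P, measurable_of_continuous_integral hPc⟩, ⟨hPP⟩,
    fun t ht => by simp [P, Set.projIcc_of_mem hT.le ht], hPc⟩

theorem integrable_drift {T : ℝ} (hab : GoodCoeffs d a b)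
    {κ : ProbabilityTheory.Kernel ℝ (SP d)} [ProbabilityTheory.IsMarkovKernel κ]
    (hκ : ∫⁻ p, cost a b p ∂((volume.restrict (Set.Ioc 0 T)).compProd κ) < ⊤)
    {φ : Rd d → ℝ} (hφ : IsC2c φ) :
    Integrable (drift a b φ) ((volume.restrict (Set.Ioc 0 T)).compProd κ) := by
  obtain ⟨-, C, hC⟩ := hφ.isC2b
  refine ⟨(measurable_drift hab hφ).aestronglyMeasurable, ?_⟩
  refine (lintegral_mono (enorm_drift_le ((abs_nonneg _).trans (hC 0).1)
    (fun i x => (hC x).2.1 i) fun i j x => (hC x).2.2 i j)).trans_lt ?_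
  rw [lintegral_const_mul' _ _ ENNReal.ofReal_ne_top]
  exact ENNReal.mul_lt_top ENNReal.ofReal_lt_top hκ

theorem lintegral_cost {T : ℝ} (hab : GoodCoeffs d a b) {g : ℕ → Rd d → ℝ}
    {Γ : ℝ → Measure (SP d)} (hΓ : IsSPCESolution d T a b g Γ)
    {κ : ProbabilityTheory.Kernel ℝ (SP d)} [ProbabilityTheory.IsMarkovKernel κ]
    (hκ : ∀ t ∈ Set.Icc 0 T, κ t = Γ t) :
    ∫⁻ p, cost a b p ∂((volume.restrict (Set.Ioc 0 T)).compProd κ) < ⊤ := by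
  rw [Measure.lintegral_compProd (measurable_cost hab)]
  refine lt_of_eq_of_lt (setLIntegral_congr_fun measurableSet_Ioc fun t ht => ?_) hΓ.2.2.1
  simp only [hκ t (Set.Ioc_subset_Icc_self ht)]
  rfl

end SP

theorem fderiv_apply_eq_sum_pd {n : ℕ} (f : (Fin n → ℝ) → ℝ) (x v : Fin n → ℝ) :
    fderiv ℝ f x v = ∑ k, pd f k x * v k := by
  conv_lhs => rw [pi_eq_sum_univ' v]
  rw [map_sum]
  refine Finset.sum_congr rfl fun k _ => ?_
  rw [map_smul, smul_eq_mul, mul_comm, pd]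

namespace SP

variable {d : ℕ} {a : ℝ → SP d → Rd d → Fin d → Fin d → ℝ} {b : ℝ → SP d → Rd d → Fin d → ℝ}
  {g : ℕ → Rd d → ℝ} {T : ℝ} {Γ : ℝ → Measure (SP d)} {κ : ProbabilityTheory.Kernel ℝ (SP d)}
  [ProbabilityTheory.IsMarkovKernel κ]

theorem bL_eq_of_eventuallyEq {n : ℕ} {f h : (Fin n → ℝ) → ℝ} (t : ℝ) (μ : SP d)
    (hfh : h =ᶠ[𝓝 fun k : Fin n => ∫ x, g k x ∂μ.1] f) :
    bL a b g h t μ =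
      fderiv ℝ f (fun k : Fin n => ∫ x, g k x ∂μ.1) fun k => drift a b (g k) (t, μ) := by
  rw [fderiv_apply_eq_sum_pd, bL]
  simp only [pd, hfh.fderiv_eq, drift]

theorem continuous_coords (hg : GFamily d g) (n : ℕ) :
    Continuous fun (μ : SP d) (k : Fin n) => ∫ x, g k x ∂μ.1 :=
  continuous_pi fun k => continuous_integral (hg.1 k).1.continuous (hg.1 k).2

theorem integrable_bL (hab : GoodCoeffs d a b) (hg : GFamily d g)
    (hκ : ∫⁻ p, cost a b p ∂((volume.restrict (Set.Ioc 0 T)).compProd κ) < ⊤)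
    {n : ℕ} {h : (Fin n → ℝ) → ℝ} (hh : IsC2c h) :
    Integrable (fun p : ℝ × SP d => bL a b g h p.1 p.2)
      ((volume.restrict (Set.Ioc 0 T)).compProd κ) := by
  obtain ⟨-, C, hC⟩ := hh.isC2b
  refine integrable_finsetSum _ fun k _ => ?_
  refine (integrable_drift hab hκ (hg.1 k)).bdd_mul (c := C) ?_ ?_
  · exact (((hh.continuous_pd k).comp
      (continuous_coords hg n)).measurable.comp measurable_snd).aestronglyMeasurable
  · exact Eventually.of_forall fun p => (hC _).2.1 k

theorem eqn_of_isC2c (hab : GoodCoeffs d a b) (hg : GFamily d g)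
    (hΓ : IsSPCESolution d T a b g Γ) (hκ : ∀ t ∈ Set.Icc 0 T, κ t = Γ t)
    {n : ℕ} {h : (Fin n → ℝ) → ℝ} (hh : IsC2c h) {s t : ℝ} (hs : 0 ≤ s) (hst : s ≤ t)
    (ht : t ≤ T) :
    ∫ μ, Fof g h μ ∂(κ t) - ∫ μ, Fof g h μ ∂(κ s) =
      ∫ p in Set.Ioc s t ×ˢ Set.univ, bL a b g h p.1 p.2
        ∂((volume.restrict (Set.Ioc 0 T)).compProd κ) := by
  have hint := integrable_bL hab hg (lintegral_cost hab hΓ hκ) hh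
  have hE := hΓ.2.2.2 n h hh.isC2b
  have hI : IntegrableOn (fun r => ∫ μ, bL a b g h r μ ∂(κ r)) (Set.Ioc 0 T) := by
    simpa [IntegrableOn] using Integrable.integral_compProd (η := ProbabilityTheory.Kernel.prodMkLeft Unit κ)
      (κ := ProbabilityTheory.Kernel.const Unit (volume.restrict (Set.Ioc 0 T))) (a := ()) hint
  have hconv : ∀ r ∈ Set.Icc 0 T, ∫ r in (0:ℝ)..r, ∫ μ, bL a b g h r μ ∂(Γ r) =
      ∫ r in (0:ℝ)..r, ∫ μ, bL a b g h r μ ∂(κ r) := fun r hr => by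
    rw [intervalIntegral.integral_of_le hr.1, intervalIntegral.integral_of_le hr.1]
    refine setIntegral_congr_fun measurableSet_Ioc fun q hq => ?_
    simp only [hκ q ⟨hq.1.le, hq.2.trans hr.2⟩]
  have hii : ∀ r ∈ Set.Icc 0 T, IntervalIntegrable (fun r => ∫ μ, bL a b g h r μ ∂(κ r))
      volume 0 r := fun r hr => by
    rw [intervalIntegrable_iff_integrableOn_Ioc_of_le hr.1]
    exact hI.mono_set (Set.Ioc_subset_Ioc_right hr.2)
  have hsI : s ∈ Set.Icc 0 T := ⟨hs, hst.trans ht⟩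
  have htI : t ∈ Set.Icc 0 T := ⟨hs.trans hst, ht⟩
  rw [Measure.setIntegral_compProd measurableSet_Ioc .univ hint.integrableOn,
    Measure.restrict_restrict measurableSet_Ioc, Set.inter_eq_left.2 (Set.Ioc_subset_Ioc hs ht)]
  simp only [Measure.restrict_univ]
  rw [← intervalIntegral.integral_of_le hst,
    ← intervalIntegral.integral_interval_sub_left (hii t htI) (hii s hsI),
    ← hconv t htI, ← hconv s hsI, ← hE t htI, ← hE s hsI, hκ t htI, hκ s hsI]
  ring

/-- The abstract continuity equation associated with (SP-CE). -/
def continuityEquation [PolishSpace (SP d)] (hT : 0 < T) (hab : GoodCoeffs d a b)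
    (hg : GFamily d g) (hΓ : IsSPCESolution d T a b g Γ)
    (hκ : ∀ t ∈ Set.Icc 0 T, κ t = Γ t)
    (hc : ∀ f : C(SP d, ℝ), Continuous fun t => ∫ μ, f μ ∂(κ t)) :
    ContinuityEquation (SP d) where
  T := T
  T_pos := hT
  x i := ⟨fun μ => ∫ x, g i x ∂μ.1, continuous_integral (hg.1 i).1.continuous (hg.1 i).2⟩
  separates _ _ h := injective_Gmap hg (funext h)
  Γ := κ
  markov := inferInstance
  continuous_Γ := hc
  β i := drift a b (g i)
  integrable_β i := integrable_drift hab (lintegral_cost hab hΓ hκ) (hg.1 i)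
  eqn n f hf s t hs hst ht := by
    obtain ⟨h, hh, hfh⟩ := exists_isC2c_eventuallyEq hf (isCompact_range (continuous_coords hg n))
    have hF : ∀ μ : SP d, f (fun k : Fin n => ∫ x, g k x ∂μ.1) = Fof g h μ := fun μ =>
      (hfh _ ⟨μ, rfl⟩).self_of_nhds.symm
    have hL : ∀ p : ℝ × SP d, fderiv ℝ f (fun k : Fin n => ∫ x, g k x ∂p.2.1)
        (fun k => drift a b (g k) p) = bL a b g h p.1 p.2 := fun p =>
      (bL_eq_of_eventuallyEq p.1 p.2 (hfh _ ⟨p.2, rfl⟩)).symm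
    simp only [ContinuousMap.coe_mk, hF, hL]
    exact eqn_of_isC2c hab hg hΓ hκ hh hs hst ht

theorem exists_superposition (hT : 0 < T) (hab : GoodCoeffs d a b)
    (hg : GFamily d g) (hΓ : IsSPCESolution d T a b g Γ) :
    ∃ (Ω : Type) (_ : MeasurableSpace Ω) (η : Measure Ω) (Y : Ω → ℝ → SP d),
      IsProbabilityMeasure η ∧ (∀ t, Measurable fun ω => Y ω t) ∧ (∀ ω, Continuous (Y ω)) ∧
      (∀ t ∈ Set.Icc 0 T, η.map (fun ω => Y ω t) = Γ t) ∧
      ∀ᵐ ω ∂η, ∀ i, ∀ t ∈ Set.Icc 0 T, ∫ x, g i x ∂(Y ω t).1 - ∫ x, g i x ∂(Y ω 0).1 =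
        ∫ r in Set.Ioc 0 t, drift a b (g i) (r, Y ω r) := by
  have := polishSpace hg
  obtain ⟨κ, _, hκ, hc⟩ := exists_kernel hT hΓ.1 hΓ.2.1
  obtain ⟨η, Y, h1, h2, h3, h4, h5⟩ :=
    (continuityEquation hT hab hg hΓ hκ hc).exists_superposition
  exact ⟨_, _, η, Y, h1, h2, h3, fun t ht => (h4 t ht).trans (hκ t ht), h5⟩

end SP

namespace SP

variable {d : ℕ} {a : ℝ → SP d → Rd d → Fin d → Fin d → ℝ} {b : ℝ → SP d → Rd d → Fin d → ℝ}
  {g : ℕ → Rd d → ℝ} {T : ℝ}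

theorem integrable_size (hab : GoodCoeffs d a b) {t : ℝ} {μ : SP d} (h : cost a b (t, μ) < ⊤) :
    Integrable (size a b t μ) μ.1 := by
  refine ⟨((measurable_size hab).comp (measurable_prodMk_left (x := (t, μ)))).aestronglyMeasurable,
    lt_of_eq_of_lt (lintegral_congr fun x => ?_) h⟩
  rw [Real.enorm_eq_ofReal (size_nonneg t μ x)]

section Curve

variable {y : ℝ → SP d} (hy : Continuous y) (hab : GoodCoeffs d a b)
  (hcost : ∫⁻ r in Set.Ioc 0 T, cost a b (r, y r) < ⊤)

include hy hab in
theorem measurable_cost_curve : Measurable fun r => cost a b (r, y r) :=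
  (measurable_cost hab).comp (measurable_id.prodMk hy.measurable)

include hy hab in
theorem measurable_drift_curve {φ : Rd d → ℝ} (hφ : IsC2c φ) :
    Measurable fun r => drift a b φ (r, y r) :=
  (measurable_drift hab hφ).comp (measurable_id.prodMk hy.measurable)

include hy hab hcost in
theorem ae_cost_lt_top : ∀ᵐ r ∂(volume.restrict (Set.Ioc 0 T)), cost a b (r, y r) < ⊤ :=
  ae_lt_top (measurable_cost_curve hy hab) hcost.ne

include hy hab hcost in
theorem integrableOn_drift {φ : Rd d → ℝ} (hφ : IsC2c φ) :
    IntegrableOn (fun r => drift a b φ (r, y r)) (Set.Ioc 0 T) := by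
  obtain ⟨-, C, hC⟩ := hφ.isC2b
  refine ⟨(measurable_drift_curve hy hab hφ).aestronglyMeasurable, ?_⟩
  refine (lintegral_mono fun r => enorm_drift_le ((abs_nonneg _).trans (hC 0).1)
    (fun i x => (hC x).2.1 i) (fun i j x => (hC x).2.2 i j) (r, y r)).trans_lt ?_
  rw [lintegral_const_mul' _ _ ENNReal.ofReal_ne_top]
  exact ENNReal.mul_lt_top ENNReal.ofReal_lt_top hcost

include hy hab hcost in
/-- Dominated convergence for the time-integrated drift. -/
theorem tendsto_integral_drift {φ : ℕ → Rd d → ℝ} (hφ : ∀ n, IsC2c (φ n)) {M : ℝ}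
    (h1 : ∀ n i x, |pd (φ n) i x| ≤ M) (h2 : ∀ n i j x, |pd2 (φ n) i j x| ≤ M)
    (hM : 0 ≤ M) {ℓ : ℝ → Rd d → ℝ}
    (hℓ : ∀ r x, Tendsto (fun n => Lop a b r (y r) (φ n) x) atTop (𝓝 (ℓ r x)))
    {t : ℝ} (ht : t ≤ T) :
    Tendsto (fun n => ∫ r in Set.Ioc 0 t, drift a b (φ n) (r, y r)) atTop
      (𝓝 (∫ r in Set.Ioc 0 t, ∫ x, ℓ r x ∂(y r).1)) := by
  have hle : (volume.restrict (Set.Ioc 0 t)) ≤ volume.restrict (Set.Ioc 0 T) :=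
    Measure.restrict_mono (Set.Ioc_subset_Ioc_right ht) le_rfl
  have hfin : ∀ᵐ r ∂(volume.restrict (Set.Ioc 0 t)), cost a b (r, y r) < ⊤ :=
    ae_mono hle (ae_cost_lt_top hy hab hcost)
  have hcost' : ∫⁻ r in Set.Ioc 0 t, cost a b (r, y r) < ⊤ :=
    (lintegral_mono' hle le_rfl).trans_lt hcost
  refine tendsto_integral_of_dominated_convergence (fun r => M * (cost a b (r, y r)).toReal)
    (fun n => (measurable_drift_curve hy hab (hφ n)).aestronglyMeasurable)
    ((integrable_toReal_of_lintegral_ne_top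
      (measurable_cost_curve hy hab).aemeasurable hcost'.ne).const_mul M) (fun n => ?_) ?_
  · filter_upwards [hfin] with r hr
    have := enorm_drift_le (a := a) (b := b) hM (h1 n) (h2 n) (r, y r)
    rw [← toReal_enorm]
    refine (ENNReal.toReal_mono (ENNReal.mul_lt_top ENNReal.ofReal_lt_top hr).ne this).trans ?_
    rw [ENNReal.toReal_mul, ENNReal.toReal_ofReal hM]
  · filter_upwards [hfin] with r hr
    refine tendsto_integral_of_dominated_convergence (fun x => M * size a b r (y r) x)
      (fun n => ?_) ((integrable_size hab hr).const_mul M) (fun n => ?_) ?_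
    · exact ((measurable_Lop hab (hφ n)).comp
        (measurable_prodMk_left (x := (r, y r)))).aestronglyMeasurable
    · exact Eventually.of_forall fun x => abs_Lop_le (fun i => h1 n i x) (fun i j => h2 n i j x) _ _
    · exact Eventually.of_forall fun x => hℓ r x

/-- A curve along which the coefficients are integrable and which solves the equation for the
test functions `g i` at rational times. -/
def SolvesRat (T : ℝ) (a : ℝ → SP d → Rd d → Fin d → Fin d → ℝ)
    (b : ℝ → SP d → Rd d → Fin d → ℝ) (g : ℕ → Rd d → ℝ) (y : ℝ → SP d) : Prop :=
  ∫⁻ r in Set.Ioc 0 T, cost a b (r, y r) < ⊤ ∧ ∀ i, ∀ q : ℚ, (q : ℝ) ∈ Set.Ioo 0 T →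
    ∫ x, g i x ∂(y q).1 - ∫ x, g i x ∂(y 0).1 = ∫ r in Set.Ioc 0 (q : ℝ), drift a b (g i) (r, y r)

include hy hab in
theorem SolvesRat.eq (hT : 0 < T) (hg : GFamily d g) (h : SolvesRat T a b g y) (i : ℕ) {t : ℝ}
    (ht : t ∈ Set.Icc 0 T) :
    ∫ x, g i x ∂(y t).1 - ∫ x, g i x ∂(y 0).1 = ∫ r in Set.Ioc 0 t, drift a b (g i) (r, y r) := by
  refine Set.EqOn.of_subset_closure (s := Set.Ioo 0 T ∩ Set.range ((↑) : ℚ → ℝ))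
    (t := Set.Icc 0 T) (f := fun t => ∫ x, g i x ∂(y t).1 - ∫ x, g i x ∂(y 0).1)
    (g := fun t => ∫ r in Set.Ioc 0 t, drift a b (g i) (r, y r)) ?_ ?_ ?_ ?_
    (Icc_subset_closure_ratCast hT) ht
  · rintro _ ⟨hq, q, rfl⟩
    exact h.2 i q hq
  · exact (((continuous_integral (hg.1 i).1.continuous (hg.1 i).2).comp hy).sub
      continuous_const).continuousOn
  · exact intervalIntegral.continuousOn_primitive ((integrableOn_Icc_iff_integrableOn_Ioc
      (by simp)).2 (integrableOn_drift hy hab h.1 (hg.1 i)))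
  · exact Set.inter_subset_left.trans Set.Ioo_subset_Icc_self

include hy hab in
theorem SolvesRat.eq_of_isC2c (hT : 0 < T) (hg : GFamily d g) (h : SolvesRat T a b g y)
    {φ : Rd d → ℝ} (hφ : IsC2c φ) {t : ℝ} (ht : t ∈ Set.Icc 0 T) :
    ∫ x, φ x ∂(y t).1 - ∫ x, φ x ∂(y 0).1 = ∫ r in Set.Ioc 0 t, drift a b φ (r, y r) := by
  choose i hi using fun n : ℕ => hg.2.2 φ hφ (1 / ((n : ℝ) + 1)) Nat.one_div_pos_of_nat
  have hε := tendsto_one_div_add_atTop_nhds_zero_nat (𝕜 := ℝ)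
  have hlim : ∀ {u : ℕ → ℝ} {v : ℝ}, (∀ n : ℕ, |u n - v| ≤ 1 / ((n : ℝ) + 1)) →
      Tendsto u atTop (𝓝 v) := fun hu =>
    tendsto_iff_norm_sub_tendsto_zero.2 (squeeze_zero (fun _ => norm_nonneg _) hu hε)
  have h0 : ∀ s, Tendsto (fun n => ∫ x, g (i n) x ∂(y s).1) atTop (𝓝 (∫ x, φ x ∂(y s).1)) :=
    fun s => hlim fun n => by
      rw [← integral_sub (integrable_of_isC2c _ (hg.1 _)) (integrable_of_isC2c _ hφ)]
      exact integral_le_one (y s) Nat.one_div_pos_of_nat.le (hi n).1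
  obtain ⟨-, C, hC⟩ := hφ.isC2b
  have hn : ∀ n : ℕ, 1 / ((n : ℝ) + 1) ≤ 1 := fun n => by
    rw [div_le_one (by positivity)]; linarith [n.cast_nonneg (α := ℝ)]
  have hb : ∀ {u v : ℝ} {n : ℕ}, |u - v| ≤ 1 / ((n : ℝ) + 1) → |v| ≤ C → |u| ≤ C + 1 :=
    fun {u v n} h1 h2 => by
      have := abs_sub_abs_le_abs_sub u v
      linarith [hn n]
  refine tendsto_nhds_unique ((h0 t).sub (h0 0)) ?_
  simp only [h.eq hy hab hT hg _ ht]
  refine tendsto_integral_drift hy hab h.1 (M := C + 1) (fun n => hg.1 _)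
    (fun n k x => hb ((hi n).2.1 k x) ((hC x).2.1 k))
    (fun n k l x => hb ((hi n).2.2 k l x) ((hC x).2.2 k l))
    (by linarith [(abs_nonneg _).trans (hC 0).1]) (fun r x => ?_) ht.2
  refine Tendsto.add ?_ ?_
  · exact tendsto_finsetSum _ fun k _ => tendsto_finsetSum _ fun l _ =>
      (hlim fun n => (hi n).2.2 k l x).const_mul _
  · exact tendsto_finsetSum _ fun k _ => (hlim fun n => (hi n).2.1 k x).const_mul _

include hy hab in
theorem SolvesRat.isSubprobSolution (hT : 0 < T) (hg : GFamily d g) (h : SolvesRat T a b g y) :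
    IsSubprobSolution d T a b y := by
  refine ⟨hy.continuousOn, fun i j => ?_, fun φ hφ t ht => ?_⟩
  · refine (lintegral_mono fun r => lintegral_mono fun x => ENNReal.ofReal_le_ofReal ?_).trans_lt h.1
    have h1 := Finset.single_le_sum (f := fun i => |b r (y r) x i|)
      (fun i _ => abs_nonneg _) (Finset.mem_univ i)
    have h2 := Finset.single_le_sum (f := fun i => ∑ j, |a r (y r) x i j|)
      (fun i _ => Finset.sum_nonneg fun j _ => abs_nonneg _) (Finset.mem_univ i)
    have h3 := Finset.single_le_sum (f := fun j => |a r (y r) x i j|)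
      (fun j _ => abs_nonneg _) (Finset.mem_univ j)
    simp only [size]
    linarith
  · rw [NLFPKEq, intervalIntegral.integral_of_le ht.1]
    exact h.eq_of_isC2c hy hab hT hg hφ ht

end Curve

end SP

theorem pd_comp_smul {n : ℕ} {φ : (Fin n → ℝ) → ℝ} (hφ : Differentiable ℝ φ) (c : ℝ) (i : Fin n)
    (x : Fin n → ℝ) : pd (fun y => φ (c • y)) i x = c * pd φ i (c • x) := by
  have h : HasFDerivAt (fun y => φ (c • y))
      ((fderiv ℝ φ (c • x)).comp (c • ContinuousLinearMap.id ℝ (Fin n → ℝ))) x :=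
    (hφ (c • x)).hasFDerivAt.comp x ((hasFDerivAt_id x).const_smul c)
  rw [pd, h.fderiv]
  simp [pd]

theorem pd2_comp_smul {n : ℕ} {φ : (Fin n → ℝ) → ℝ} (hφ : ContDiff ℝ 2 φ) (c : ℝ) (i j : Fin n)
    (x : Fin n → ℝ) : pd2 (fun y => φ (c • y)) i j x = c ^ 2 * pd2 φ i j (c • x) := by
  have hd := hφ.differentiable two_ne_zero
  have h1 := (IsC2c.contDiff_pd hφ j).differentiable one_ne_zero
  have h : (fun y => pd (fun y => φ (c • y)) j y) = fun y => c * (pd φ j) (c • y) :=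
    funext fun y => pd_comp_smul hd c j y
  have h2 : DifferentiableAt ℝ (fun y => pd φ j (c • y)) x := by fun_prop
  have h3 := pd_comp_smul h1 c i x
  rw [pd] at h3
  rw [pd2, h, fderiv_const_mul h2, smul_apply, h3, smul_eq_mul, pd2]
  ring_nf
  rfl

/-- Cutoff functions whose derivatives tend to zero. -/
theorem exists_isC2c_flat_seq (d : ℕ) : ∃ (χ : ℕ → Rd d → ℝ) (M : ℝ), (∀ n, IsC2c (χ n)) ∧
    (∀ n x, 0 ≤ χ n x ∧ χ n x ≤ 1) ∧ (∀ x, ∀ᶠ n in atTop, χ n x = 1) ∧ 0 ≤ M ∧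
    (∀ n i x, |pd (χ n) i x| ≤ 1 / ((n : ℝ) + 1) * M) ∧
    ∀ n i j x, |pd2 (χ n) i j x| ≤ 1 / ((n : ℝ) + 1) * M := by
  obtain ⟨χ, hχ, h01, h1, -⟩ := exists_isC2c_cutoff (isCompact_closedBall (0 : Rd d) 1) one_pos
  obtain ⟨-, M, hM⟩ := hχ.isC2b
  have hM0 : 0 ≤ M := (abs_nonneg _).trans (hM 0).1
  have hpos : ∀ n : ℕ, 0 < 1 / ((n : ℝ) + 1) := fun n => Nat.one_div_pos_of_nat
  have hle : ∀ n : ℕ, 1 / ((n : ℝ) + 1) ≤ 1 := fun n => by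
    rw [div_le_one (by positivity)]; linarith [n.cast_nonneg (α := ℝ)]
  refine ⟨fun n x => χ ((1 / ((n : ℝ) + 1)) • x), M, fun n => ⟨?_, ?_⟩, fun n x => h01 _,
    fun x => ?_, hM0, fun n i x => ?_, fun n i j x => ?_⟩
  · exact hχ.1.comp (contDiff_const_smul _)
  · exact hχ.2.comp_homeomorph (Homeomorph.smulOfNeZero _ (hpos n).ne')
  · have h : Tendsto (fun n : ℕ => (1 / ((n : ℝ) + 1)) • x) atTop (𝓝 ((0 : ℝ) • x)) :=
      (tendsto_one_div_add_atTop_nhds_zero_nat (𝕜 := ℝ)).smul_const x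
    rw [zero_smul] at h
    filter_upwards [h (Metric.closedBall_mem_nhds _ one_pos)] with n hn using h1 _ hn
  · rw [pd_comp_smul (hχ.1.differentiable two_ne_zero), abs_mul, abs_of_pos (hpos n)]
    exact mul_le_mul_of_nonneg_left ((hM _).2.1 i) (hpos n).le
  · rw [pd2_comp_smul hχ.1, abs_mul, abs_of_nonneg (sq_nonneg _)]
    exact mul_le_mul (pow_le_of_le_one (hpos n).le (hle n) two_ne_zero) ((hM _).2.2 i j)
      (abs_nonneg _) (hpos n).le

theorem tendsto_integral_cutoff {d : ℕ} {χ : ℕ → Rd d → ℝ} (hχ : ∀ n, IsC2c (χ n))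
    (h01 : ∀ n x, 0 ≤ χ n x ∧ χ n x ≤ 1) (h1 : ∀ x, ∀ᶠ n in atTop, χ n x = 1)
    (μ : Measure (Rd d)) [IsFiniteMeasure μ] :
    Tendsto (fun n => ∫ x, χ n x ∂μ) atTop (𝓝 (μ.real Set.univ)) := by
  rw [show μ.real Set.univ = ∫ _x, (1 : ℝ) ∂μ by simp]
  refine tendsto_integral_of_dominated_convergence (fun _ => 1)
    (fun n => (hχ n).1.continuous.aestronglyMeasurable) (integrable_const 1) (fun n => ?_) ?_
  · exact Eventually.of_forall fun x => by
      rw [Real.norm_eq_abs, abs_of_nonneg (h01 n x).1]; exact (h01 n x).2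
  · exact Eventually.of_forall fun x => tendsto_nhds_of_eventually_eq (h1 x)

namespace SP

variable {d : ℕ} {a : ℝ → SP d → Rd d → Fin d → Fin d → ℝ} {b : ℝ → SP d → Rd d → Fin d → ℝ}
  {g : ℕ → Rd d → ℝ} {T : ℝ} {y : ℝ → SP d}

/-- Conservation of mass. -/
theorem SolvesRat.mass_eq (hy : Continuous y) (hab : GoodCoeffs d a b) (hT : 0 < T)
    (hg : GFamily d g) (h : SolvesRat T a b g y) {t : ℝ} (ht : t ∈ Set.Icc 0 T) :
    (y t).1 Set.univ = (y 0).1 Set.univ := by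
  obtain ⟨χ, M, hχ, h01, h1, hM, hb1, hb2⟩ := exists_isC2c_flat_seq d
  have hle : ∀ n : ℕ, 1 / ((n : ℝ) + 1) * M ≤ M := fun n =>
    mul_le_of_le_one_left hM (by
      rw [div_le_one (by positivity)]; linarith [n.cast_nonneg (α := ℝ)])
  have h2 := tendsto_integral_drift hy hab h.1 hχ (fun n i x => (hb1 n i x).trans (hle n))
    (fun n i j x => (hb2 n i j x).trans (hle n)) hM (ℓ := 0) (fun r x => ?_) ht.2
  · simp only [Pi.zero_apply, integral_zero, ← h.eq_of_isC2c hy hab hT hg (hχ _) ht] at h2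
    have h3 := tendsto_nhds_unique h2 ((tendsto_integral_cutoff hχ h01 h1 (y t).1).sub
      (tendsto_integral_cutoff hχ h01 h1 (y 0).1))
    exact (measureReal_eq_measureReal_iff).1 (sub_eq_zero.1 h3.symm)
  · refine squeeze_zero_norm (fun n => abs_Lop_le (fun i => hb1 n i x) (fun i j => hb2 n i j x)
      r (y r)) ?_
    simpa using ((tendsto_one_div_add_atTop_nhds_zero_nat (𝕜 := ℝ)).mul_const M).mul_const
      (size a b r (y r) x)

/-- A vaguely continuous curve of probability measures is weakly continuous. -/
theorem weaklyContinuousOn {s : Set ℝ} (hy : ContinuousOn y s)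
    (h1 : ∀ t ∈ s, (y t).1 Set.univ = 1) : WeaklyContinuousOn y s := by
  rintro f hf ⟨M, hM⟩
  obtain ⟨χ, -, hχ, h01, hev, -⟩ := exists_isC2c_flat_seq d
  have hM0 : 0 ≤ M := (abs_nonneg _).trans (hM 0)
  have hreal : ∀ t ∈ s, (y t).1.real Set.univ = 1 := fun t ht => by simp [Measure.real, h1 t ht]
  have hfi : ∀ t, Integrable f (y t).1 := fun t =>
    Integrable.of_bound hf.aestronglyMeasurable M (Eventually.of_forall hM)
  have hχc : ∀ n, ContinuousOn (fun t => ∫ x, χ n x ∂(y t).1) s := fun n =>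
    (continuous_integral (hχ n).1.continuous (hχ n).2).comp_continuousOn hy
  have key : ∀ n, ∀ t ∈ s, |∫ x, f x ∂(y t).1 - ∫ x, f x * χ n x ∂(y t).1| ≤
      M * (1 - ∫ x, χ n x ∂(y t).1) := fun n t ht => by
    have hi : Integrable (χ n) (y t).1 := integrable_of_isC2c _ (hχ n)
    have hi2 : Integrable (fun x => f x * χ n x) (y t).1 :=
      (hf.mul (hχ n).1.continuous).integrable_of_hasCompactSupport (hχ n).2.mul_left
    have hone : ∫ _x, (1 : ℝ) ∂(y t).1 = 1 := by simp [hreal t ht]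
    rw [← integral_sub (hfi t) hi2, ← Real.norm_eq_abs]
    conv_rhs => rw [← hone, ← integral_sub (integrable_const _) hi, ← integral_const_mul]
    refine norm_integral_le_of_norm_le (((integrable_const _).sub hi).const_mul M)
      (Eventually.of_forall fun x => ?_)
    rw [← mul_one_sub, norm_mul, Real.norm_eq_abs (1 - _), abs_of_nonneg (sub_nonneg.2 (h01 n x).2)]
    exact mul_le_mul_of_nonneg_right (hM x) (sub_nonneg.2 (h01 n x).2)
  refine continuousOn_of_locally_uniform_approx_of_continuousWithinAt fun t ht u hu => ?_
  obtain ⟨ε, hε, hεu⟩ := Metric.mem_uniformity_dist.1 hu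
  have hlim : Tendsto (fun n => M * (1 - ∫ x, χ n x ∂(y t).1)) atTop (𝓝 (M * (1 - 1))) := by
    have := tendsto_integral_cutoff hχ h01 hev (y t).1
    rw [hreal t ht] at this
    exact (this.const_sub 1).const_mul M
  rw [sub_self, mul_zero] at hlim
  obtain ⟨n, hn⟩ := (hlim.eventually_lt_const hε).exists
  refine ⟨_, inter_mem ((continuousOn_const.mul (continuousOn_const.sub (hχc n)) t ht).eventually_lt_const hn)
    self_mem_nhdsWithin, fun r => ∫ x, f x * χ n x ∂(y r).1, ?_, fun r hr => hεu ?_⟩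
  · exact (continuous_integral (hf.mul (hχ n).1.continuous)
      (hχ n).2.mul_left).continuousAt.comp_continuousWithinAt (hy t ht)
  · exact (key n r hr.2).trans_lt hr.1

end SP

namespace SP

variable {d : ℕ} {a : ℝ → SP d → Rd d → Fin d → Fin d → ℝ} {b : ℝ → SP d → Rd d → Fin d → ℝ}
  {g : ℕ → Rd d → ℝ} {T : ℝ}

theorem isSubprobSolution_congr (hT : 0 < T) {y z : ℝ → SP d} (hyz : Set.EqOn y z (Set.Icc 0 T))
    (h : IsSubprobSolution d T a b y) : IsSubprobSolution d T a b z := by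
  refine ⟨h.1.congr hyz.symm, fun i j => ?_, fun φ hφ t ht => ?_⟩
  · refine lt_of_eq_of_lt (setLIntegral_congr_fun measurableSet_Ioc fun t ht => ?_) (h.2.1 i j)
    simp only [hyz (Set.Ioc_subset_Icc_self ht)]
  · have h1 := h.2.2 φ hφ t ht
    rw [NLFPKEq, hyz ht, hyz (Set.left_mem_Icc.2 hT.le)] at h1
    rw [NLFPKEq, h1]
    refine intervalIntegral.integral_congr fun s hs => ?_
    rw [Set.uIcc_of_le ht.1] at hs
    simp only [hyz (Set.Icc_subset_Icc_right ht.2 hs)]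

theorem measurableSet_solvesRat [TopologicalSpace.PseudoMetrizableSpace (SP d)] {Ω : Type*}
    [MeasurableSpace Ω] {Y : Ω → ℝ → SP d} (hYm : ∀ t, Measurable fun ω => Y ω t)
    (hYc : ∀ ω, Continuous (Y ω)) (hab : GoodCoeffs d a b) (hg : GFamily d g) :
    MeasurableSet {ω | SolvesRat T a b g (Y ω)} := by
  have hm : Measurable fun p : Ω × ℝ => (p.2, Y p.1 p.2) :=
    measurable_snd.prodMk ((measurable_uncurry_of_continuous_of_measurable
      (u := fun t ω => Y ω t) hYc hYm).comp measurable_swap)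
  have hgm : ∀ i t, Measurable fun ω => ∫ x, g i x ∂(Y ω t).1 := fun i t =>
    (continuous_integral (hg.1 i).1.continuous (hg.1 i).2).measurable.comp (hYm t)
  simp only [SolvesRat, Set.ofPred_and, Set.ofPred_forall]
  refine (measurableSet_lt ((measurable_cost hab).comp hm).lintegral_prod_right'
    measurable_const).inter ?_
  refine MeasurableSet.iInter fun i => MeasurableSet.iInter fun q => MeasurableSet.iInter fun _ => ?_
  exact measurableSet_eq_fun ((hgm i q).sub (hgm i 0))
    (((measurable_drift hab (hg.1 i)).comp hm).stronglyMeasurable.integral_prod_right').measurable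

/-- Extension of a path by constants. -/
def constExtend (hT : 0 < T) (γ : PathSP d T) : ℝ → SP d := fun t => γ.1 (Set.projIcc 0 T hT.le t)

theorem continuous_constExtend (hT : 0 < T) (γ : PathSP d T) : Continuous (constExtend hT γ) :=
  γ.2.comp continuous_projIcc

theorem measurable_eval (t : Set.Icc (0 : ℝ) T) : Measurable fun γ : PathSP d T => γ.1 t :=
  Measurable.mono (comap_measurable _)
    (le_iSup (fun t : Set.Icc (0 : ℝ) T => MeasurableSpace.comap (fun γ : PathSP d T => γ.1 t)
      inferInstance) t) le_rfl

theorem measurable_toPathSP {Ω : Type*} [MeasurableSpace Ω] {f : Ω → PathSP d T}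
    (hf : ∀ t, Measurable fun ω => (f ω).1 t) : Measurable f := by
  refine measurable_iff_le_map.2 (iSup_le fun t => ?_)
  rw [MeasurableSpace.comap_le_iff_le_map, MeasurableSpace.map_comp]
  exact measurable_iff_le_map.1 (hf t)

theorem eqOn_constExtend_extendPath (hT : 0 < T) (γ : PathSP d T) :
    Set.EqOn (constExtend hT γ) (extendPath γ.1) (Set.Icc 0 T) := fun t ht => by
  simp [constExtend, extendPath, ht, Set.projIcc_of_mem hT.le ht]

theorem measurableSet_prob : MeasurableSet {ν : SP d | ν.1 Set.univ = 1} :=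
  measurableSet_eq_fun ((Measure.measurable_coe .univ).comp measurable_val) measurable_const

theorem ae_lintegral_cost_lt_top [TopologicalSpace.PseudoMetrizableSpace (SP d)] {Ω : Type*}
    [MeasurableSpace Ω] {η : Measure Ω} [IsProbabilityMeasure η] {Y : Ω → ℝ → SP d}
    (hYm : ∀ t, Measurable fun ω => Y ω t) (hYc : ∀ ω, Continuous (Y ω)) (hab : GoodCoeffs d a b)
    {Γ : ℝ → Measure (SP d)} (hΓ : IsSPCESolution d T a b g Γ)
    (hY : ∀ t ∈ Set.Icc 0 T, η.map (fun ω => Y ω t) = Γ t) :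
    ∀ᵐ ω ∂η, ∫⁻ r in Set.Ioc 0 T, cost a b (r, Y ω r) < ⊤ := by
  have hm : Measurable fun p : Ω × ℝ => (p.2, Y p.1 p.2) :=
    measurable_snd.prodMk ((measurable_uncurry_of_continuous_of_measurable
      (u := fun t ω => Y ω t) hYc hYm).comp measurable_swap)
  have hcm := (measurable_cost hab).comp hm
  refine ae_lt_top hcm.lintegral_prod_right' (ne_of_lt ?_)
  rw [lintegral_lintegral_swap (f := fun ω r => cost a b (r, Y ω r)) hcm.aemeasurable]
  refine lt_of_eq_of_lt (setLIntegral_congr_fun measurableSet_Ioc fun t ht => ?_) hΓ.2.2.1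
  simp only [← hY t (Set.Ioc_subset_Icc_self ht)]
  exact (lintegral_map ((measurable_cost hab).comp measurable_prodMk_left) (hYm t)).symm

end SP

/-- Theorem 3.6, superposition principle: every weakly continuous solution
`(Γ_t)` to (SP-CE) is the family of one-dimensional marginals of a probability measure `η`
on `C([0,T],SP)` concentrated on subprobability solutions to (NLFPK); if `Γ_0` is
concentrated on probability measures, `η` is concentrated on probability solutions. -/
theorem superposition_principle_deterministic (d : ℕ) (T : ℝ) (hT : 0 < T)
    (a : ℝ → SP d → Rd d → Fin d → Fin d → ℝ) (b : ℝ → SP d → Rd d → Fin d → ℝ)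
    (hab : GoodCoeffs d a b) (g : ℕ → Rd d → ℝ) (hg : GFamily d g)
    (Γ : ℝ → Measure (SP d)) (hΓ : IsSPCESolution d T a b g Γ) :
    ∃ η : Measure (PathSP d T), IsProbabilityMeasure η ∧
      (∃ S : Set (PathSP d T), MeasurableSet S ∧ η S = 1 ∧
        ∀ γ ∈ S, IsSubprobSolution d T a b (extendPath γ.1)) ∧
      (∀ (t : ℝ) (ht : t ∈ Set.Icc (0:ℝ) T),
        η.map (fun γ : PathSP d T => γ.1 ⟨t, ht⟩) = Γ t) ∧
      (Γ 0 {ν : SP d | ν.1 Set.univ = 1} = 1 →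
        ∃ S' : Set (PathSP d T), MeasurableSet S' ∧ η S' = 1 ∧
          ∀ γ ∈ S', IsProbSolution d T a b (extendPath γ.1)) := by
  have := SP.polishSpace hg
  obtain ⟨Ω, _, P, Y, _, hYm, hYc, hY, hE⟩ := SP.exists_superposition hT hab hg hΓ
  let path : Ω → PathSP d T := fun ω => ⟨fun t => Y ω t, (hYc ω).comp continuous_subtype_val⟩
  have hpath : Measurable path := SP.measurable_toPathSP fun t => hYm t
  have hprob : IsProbabilityMeasure (P.map path) :=
    Measure.isProbabilityMeasure_map hpath.aemeasurable
  have hmarg : ∀ (t : ℝ) (ht : t ∈ Set.Icc (0:ℝ) T),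
      (P.map path).map (fun γ : PathSP d T => γ.1 ⟨t, ht⟩) = Γ t := fun t ht => by
    rw [Measure.map_map (SP.measurable_eval _) hpath, ← hY t ht]
    rfl
  let S : Set (PathSP d T) := {γ | SP.SolvesRat T a b g (SP.constExtend hT γ)}
  have hS : MeasurableSet S := SP.measurableSet_solvesRat (fun t => SP.measurable_eval _)
    (SP.continuous_constExtend hT) hab hg
  have hSη : ∀ᵐ γ ∂(P.map path), γ ∈ S := by
    refine (ae_map_iff hpath.aemeasurable hS).2 ?_
    filter_upwards [hE, SP.ae_lintegral_cost_lt_top hYm hYc hab hΓ hY] with ω h1 h2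
    have h3 : ∀ t ∈ Set.Icc 0 T, SP.constExtend hT (path ω) t = Y ω t := fun t ht => by
      simp [SP.constExtend, path, Set.projIcc_of_mem hT.le ht]
    refine ⟨?_, fun i q hq => ?_⟩
    · refine lt_of_eq_of_lt (setLIntegral_congr_fun measurableSet_Ioc fun t ht => ?_) h2
      simp only [h3 t (Set.Ioc_subset_Icc_self ht)]
    · rw [h3 q (Set.Ioo_subset_Icc_self hq), h3 0 (Set.left_mem_Icc.2 hT.le),
        h1 i q (Set.Ioo_subset_Icc_self hq)]
      refine setIntegral_congr_fun measurableSet_Ioc fun t ht => ?_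
      simp only [h3 t ⟨ht.1.le, ht.2.trans hq.2.le⟩]
  have hsol : ∀ γ ∈ S, IsSubprobSolution d T a b (extendPath γ.1) := fun γ hγ =>
    SP.isSubprobSolution_congr hT (SP.eqOn_constExtend_extendPath hT γ)
      (hγ.isSubprobSolution (SP.continuous_constExtend hT γ) hab hT hg)
  refine ⟨P.map path, hprob, ⟨S, hS, (mem_ae_iff_prob_eq_one hS).1 hSη, hsol⟩, hmarg, fun h0 => ?_⟩
  have h0T : (0 : ℝ) ∈ Set.Icc 0 T := Set.left_mem_Icc.2 hT.le
  let A : Set (PathSP d T) := (fun γ => γ.1 ⟨0, h0T⟩) ⁻¹' {ν : SP d | ν.1 Set.univ = 1}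
  have hA : MeasurableSet A := SP.measurable_eval _ SP.measurableSet_prob
  have hAη : P.map path A = 1 := by
    rw [← h0, ← hmarg 0 h0T, Measure.map_apply (SP.measurable_eval _) SP.measurableSet_prob]
  refine ⟨S ∩ A, hS.inter hA, (mem_ae_iff_prob_eq_one (hS.inter hA)).1
    (inter_mem hSη ((mem_ae_iff_prob_eq_one hA).2 hAη)), fun γ hγ => ?_⟩
  have hmass : ∀ t ∈ Set.Icc (0:ℝ) T, (extendPath γ.1 t).1 Set.univ = 1 := fun t ht => by
    rw [← SP.eqOn_constExtend_extendPath hT γ ht,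
      hγ.1.mass_eq (SP.continuous_constExtend hT γ) hab hT hg ht,
      SP.constExtend, Set.projIcc_left]
    exact hγ.2
  exact ⟨hsol γ hγ.1, hmass, SP.weaklyContinuousOn (hsol γ hγ.1).1 hmass⟩
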